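/- Suppose in addition that a < 0. For every norm ‖·‖ on ℝ⁵ there exists a constant C > 0 (depending on a, f and the norm) such that for every real B ≥ 2, the number of pairs ((y,z,t),(u,v)) with (y,z,t) ∈ ℤ³ primitive, (u,v) ∈ ℤ² primitive, ‖(v²t, uvt, u²t, y, z)‖ ≤ B and y² − a·z² = t²·F(u,v), is at most C·B·(log B)^{ρ−1}. -/

import Mathlib

/-- The binary quartic form `F(u,v) = v⁴·f(u/v)`, the degree-4 homogenization of `f`. -/
noncomputable def binQuartic (f : Polynomial ℤ) (u v : ℤ) : ℤ :=
  ∑ i ∈ Finset.range 5, f.coeff i * u ^ i * v ^ (4 - i)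

theorem sum_union_le_add {ι : Type*} [DecidableEq ι] (s t : Finset ι) {f : ι → ℝ}
    (hf : ∀ i, 0 ≤ f i) : ∑ i ∈ s ∪ t, f i ≤ ∑ i ∈ s, f i + ∑ i ∈ t, f i := by
  rw [← Finset.sum_union_inter]
  exact le_add_of_nonneg_right (Finset.sum_nonneg fun i _ => hf i)

open Finset Real in
theorem sum_log_div_prime_le : ∃ C : ℝ, 0 ≤ C ∧ ∀ n : ℕ, 1 ≤ n →
    ∑ p ∈ n.primesLE, Real.log p / p ≤ Real.log n + C := by
  refine ⟨Real.log 4, Real.log_nonneg (by norm_num), fun n hn => ?_⟩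
  have hn0 : (0 : ℝ) < n := by exact_mod_cast hn
  have h1 : ∑ p ∈ n.primesLE, ((n / p : ℕ) : ℝ) * Real.log p ≤ Real.log (n.factorial) := by
    rw [Real.log_nat_eq_sum_factorization, Finsupp.sum]
    have hsub : n.primesLE ⊆ n.factorial.factorization.support := by
      intro p hp
      rw [Nat.mem_primesLE] at hp
      rw [Nat.support_factorization, Nat.mem_primeFactors]
      exact ⟨hp.2, (hp.2.dvd_factorial).2 hp.1, Nat.factorial_ne_zero n⟩
    refine le_trans (Finset.sum_le_sum fun p hp => ?_)
      (Finset.sum_le_sum_of_subset_of_nonneg hsub fun p _ _ =>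
        mul_nonneg (Nat.cast_nonneg _) (Real.log_natCast_nonneg p))
    rw [Nat.mem_primesLE] at hp
    refine mul_le_mul_of_nonneg_right ?_ (Real.log_natCast_nonneg p)
    rw [Nat.factorization_factorial hp.2 (Nat.lt_succ_self _)]
    have hlog : 1 ≤ Nat.log p n := Nat.log_pos hp.2.one_lt hp.1
    have := Finset.single_le_sum (f := fun i => n / p ^ i) (fun i _ => Nat.zero_le _)
      (show 1 ∈ Finset.Ico 1 (Nat.log p n).succ from
        Finset.mem_Ico.2 ⟨le_rfl, Nat.lt_succ_of_le hlog⟩)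
    simpa using (Nat.cast_le (α := ℝ)).2 this
  have h2 : Real.log (n.factorial) ≤ n * Real.log n := by
    rw [← Real.log_pow]
    refine Real.log_le_log (by exact_mod_cast n.factorial_pos) ?_
    exact_mod_cast Nat.factorial_le_pow n
  have h3 : ∑ p ∈ n.primesLE, ((n : ℝ) / p - 1) * Real.log p
      ≤ ∑ p ∈ n.primesLE, ((n / p : ℕ) : ℝ) * Real.log p := by
    refine Finset.sum_le_sum fun p hp => ?_
    rw [Nat.mem_primesLE] at hp
    refine mul_le_mul_of_nonneg_right ?_ (Real.log_natCast_nonneg p)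
    have hp0 : (0 : ℝ) < p := by exact_mod_cast hp.2.pos
    have h : n < p * (n / p + 1) := Nat.lt_mul_div_succ n hp.2.pos
    rw [sub_le_iff_le_add, div_le_iff₀ hp0]
    have h' : (n : ℝ) < p * ((n / p : ℕ) + 1) := by exact_mod_cast h
    nlinarith
  have h4 : ∑ p ∈ n.primesLE, Real.log p ≤ Real.log 4 * n := by
    rw [← Chebyshev.theta_eq_sum_primesLE_log]
    exact Chebyshev.theta_le_log4_mul_x hn0.le
  have h5 : ∑ p ∈ n.primesLE, ((n : ℝ) / p - 1) * Real.log p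
      = n * ∑ p ∈ n.primesLE, Real.log p / p - ∑ p ∈ n.primesLE, Real.log p := by
    rw [Finset.mul_sum, ← Finset.sum_sub_distrib]
    refine Finset.sum_congr rfl fun p _ => by ring
  have h6 : (n : ℝ) * ∑ p ∈ n.primesLE, Real.log p / p ≤ n * (Real.log n + Real.log 4) := by
    linarith
  exact le_of_mul_le_mul_left h6 hn0

/-- Sum of `1/p` over the primes in `(w, n]`. -/
theorem sum_inv_prime_Ioc_le : ∃ C : ℝ, 0 ≤ C ∧ ∀ w n : ℕ, 2 ≤ w → 1 ≤ n →
    ∑ p ∈ n.primesLE with w < p, (1 : ℝ) / p ≤ (Real.log n + C) / Real.log w := by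
  obtain ⟨C, hC, h⟩ := sum_log_div_prime_le
  refine ⟨C, hC, fun w n hw hn => ?_⟩
  have hlw : 0 < Real.log w := Real.log_pos (by exact_mod_cast hw)
  rw [le_div_iff₀ hlw, Finset.sum_mul]
  refine le_trans ?_ (h n hn)
  refine le_trans (Finset.sum_le_sum (g := fun p : ℕ => Real.log p / p) fun p hp => ?_)
    (Finset.sum_le_sum_of_subset_of_nonneg (Finset.filter_subset _ _) fun p _ _ =>
      div_nonneg (Real.log_natCast_nonneg p) (Nat.cast_nonneg p))
  rw [Finset.mem_filter] at hp
  have hp0 : (0 : ℝ) < p := by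
    have : 0 < p := by omega
    exact_mod_cast this
  rw [one_div, ← div_eq_inv_mul]
  gcongr
  exact hp.2.le

/-- Tail of the prime zeta function just to the right of `1`. -/
theorem sum_prime_tail_le : ∃ C : ℝ, 0 ≤ C ∧ ∀ Y n : ℕ, 2 ≤ Y →
    ∑ p ∈ n.primesLE with Y < p, (p : ℝ) ^ (-(1 + 1 / Real.log Y)) ≤ C := by
  obtain ⟨C, hC, h⟩ := sum_inv_prime_Ioc_le
  have hl2 : 0 < Real.log 2 := Real.log_pos (by norm_num)
  set D : ℝ := 2 + C / Real.log 2 with hD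
  have hD0 : 0 ≤ D := by positivity
  have hr : Real.exp (-1) < 1 := by rw [Real.exp_lt_one_iff]; norm_num
  refine ⟨D * (1 - Real.exp (-1))⁻¹, mul_nonneg hD0 (inv_nonneg.2 (by linarith)),
    fun Y n hY => ?_⟩
  have hY0 : (0 : ℝ) < Y := by positivity
  have hlY : Real.log 2 ≤ Real.log Y := Real.log_le_log (by norm_num) (by exact_mod_cast hY)
  have hlY0 : 0 < Real.log Y := by linarith
  have key : ∀ J : ℕ, ∑ p ∈ (Y ^ (J + 1)).primesLE with Y < p,
      (p : ℝ) ^ (-(1 + 1 / Real.log Y)) ≤ D * ∑ j ∈ Finset.range J, Real.exp (-1) ^ j := by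
    intro J
    induction J with
    | zero =>
      simp only [zero_add, pow_one, Finset.range_zero, Finset.sum_empty, mul_zero]
      refine le_of_eq (Finset.sum_eq_zero fun p hp => ?_)
      rw [Finset.mem_filter, Nat.mem_primesLE] at hp
      omega
    | succ J ih =>
      rw [Finset.sum_range_succ, mul_add]
      have hsplit : ((Y ^ (J + 1 + 1)).primesLE.filter (fun p => Y < p)) ⊆
          ((Y ^ (J + 1)).primesLE.filter (fun p => Y < p)) ∪
          ((Y ^ (J + 1 + 1)).primesLE.filter (fun p => Y ^ (J + 1) < p)) := by
        intro p hp
        simp only [Finset.mem_union, Finset.mem_filter, Nat.mem_primesLE] at hp ⊢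
        by_cases hc : p ≤ Y ^ (J + 1)
        · exact Or.inl ⟨⟨hc, hp.1.2⟩, hp.2⟩
        · exact Or.inr ⟨hp.1, by omega⟩
      refine le_trans (Finset.sum_le_sum_of_subset_of_nonneg hsplit
        fun p _ _ => Real.rpow_nonneg (Nat.cast_nonneg p) _) ?_
      refine le_trans (sum_union_le_add _ _ fun p =>
        Real.rpow_nonneg (Nat.cast_nonneg p) _) ?_
      refine add_le_add ih ?_
      have hY2 : 2 ≤ Y ^ (J + 1) := le_trans hY (Nat.le_self_pow (by omega) Y)
      have hb := h (Y ^ (J + 1)) (Y ^ (J + 1 + 1)) hY2 (Nat.one_le_pow _ _ (by omega))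
      have hle : ∑ p ∈ (Y ^ (J + 1 + 1)).primesLE with Y ^ (J + 1) < p,
          (p : ℝ) ^ (-(1 + 1 / Real.log Y)) ≤
          Real.exp (-1) ^ J * ∑ p ∈ (Y ^ (J + 1 + 1)).primesLE with Y ^ (J + 1) < p, (1 : ℝ) / p := by
        rw [Finset.mul_sum]
        refine Finset.sum_le_sum fun p hp => ?_
        rw [Finset.mem_filter, Nat.mem_primesLE] at hp
        have hp0 : (0 : ℝ) < p := by exact_mod_cast hp.1.2.pos
        rw [neg_add, Real.rpow_add hp0, Real.rpow_neg_one, mul_comm, ← one_div (p : ℝ)]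
        refine mul_le_mul_of_nonneg_right ?_ (one_div_nonneg.2 hp0.le)
        rw [Real.rpow_def_of_pos hp0, ← Real.exp_nat_mul]
        refine Real.exp_le_exp.2 ?_
        have : (J + 1 : ℝ) * Real.log Y ≤ Real.log p := by
          have h2 : Real.log ((Y ^ (J + 1) : ℕ) : ℝ) ≤ Real.log p :=
            Real.log_le_log (by positivity) (by exact_mod_cast hp.2.le)
          rw [Nat.cast_pow, Real.log_pow] at h2
          exact_mod_cast h2
        have h3 : (J + 1 : ℝ) ≤ Real.log p * (1 / Real.log Y) := by
          rw [mul_one_div, le_div_iff₀ hlY0]; exact this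
        have : Real.log p * -(1 / Real.log Y) = -(Real.log p * (1 / Real.log Y)) := by ring
        rw [this]
        linarith
      refine le_trans hle ?_
      rw [mul_comm D]
      refine mul_le_mul_of_nonneg_left (le_trans hb ?_) (by positivity)
      rw [Nat.cast_pow, Nat.cast_pow, Real.log_pow, Real.log_pow, div_le_iff₀ (by positivity), hD]
      have h5 : C ≤ C / Real.log 2 * Real.log Y := by
        rw [div_mul_eq_mul_div, le_div_iff₀ hl2]
        exact mul_le_mul_of_nonneg_left hlY hC
      have h6 : C / Real.log 2 * Real.log Y * 1 ≤ C / Real.log 2 * Real.log Y * (J + 1) :=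
        mul_le_mul_of_nonneg_left (by linarith [Nat.cast_nonneg (α := ℝ) J]) (by positivity)
      push_cast
      nlinarith [Nat.cast_nonneg (α := ℝ) J, mul_nonneg (Nat.cast_nonneg (α := ℝ) J) hlY0.le]
  have hnJ : n ≤ Y ^ (n + 1) := by
    exact (Nat.lt_pow_self (by omega)).le.trans (Nat.pow_le_pow_right (by omega) (Nat.le_succ n))
  refine le_trans ?_ ((key n).trans ?_)
  · refine Finset.sum_le_sum_of_subset_of_nonneg ?_
      fun p _ _ => Real.rpow_nonneg (Nat.cast_nonneg p) _
    intro p hp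
    simp only [Finset.mem_filter, Nat.mem_primesLE] at hp ⊢
    exact ⟨⟨hp.1.1.trans hnJ, hp.1.2⟩, hp.2⟩
  · refine mul_le_mul_of_nonneg_left ?_ hD0
    rw [← tsum_geometric_of_lt_one (Real.exp_pos _).le hr]
    exact (summable_geometric_of_lt_one (Real.exp_pos _).le hr).sum_le_tsum _
      (fun _ _ => by positivity)

theorem sum_prime_sub_rpow_le : ∃ C : ℝ, 0 ≤ C ∧ ∀ Y : ℕ, 2 ≤ Y →
    ∑ p ∈ Y.primesLE, ((1 : ℝ) / p - (p : ℝ) ^ (-(1 + 1 / Real.log Y))) ≤ C := by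
  obtain ⟨C, hC, h⟩ := sum_log_div_prime_le
  have hl2 : 0 < Real.log 2 := Real.log_pos (by norm_num)
  refine ⟨1 + C / Real.log 2, by positivity, fun Y hY => ?_⟩
  have hlY : Real.log 2 ≤ Real.log Y := Real.log_le_log (by norm_num) (by exact_mod_cast hY)
  have hlY0 : 0 < Real.log Y := by linarith
  have h1 : ∑ p ∈ Y.primesLE, ((1 : ℝ) / p - (p : ℝ) ^ (-(1 + 1 / Real.log Y)))
      ≤ (∑ p ∈ Y.primesLE, Real.log p / p) / Real.log Y := by
    rw [Finset.sum_div]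
    refine Finset.sum_le_sum fun p hp => ?_
    rw [Nat.mem_primesLE] at hp
    have hp0 : (0 : ℝ) < p := by exact_mod_cast hp.2.pos
    rw [neg_add, Real.rpow_add hp0, Real.rpow_neg_one, Real.rpow_def_of_pos hp0 (-(1 / Real.log Y))]
    have h2 := Real.add_one_le_exp (Real.log p * -(1 / Real.log Y))
    have h3 : (p : ℝ)⁻¹ * (Real.log p * -(1 / Real.log Y) + 1)
        ≤ (p : ℝ)⁻¹ * Real.exp (Real.log p * -(1 / Real.log Y)) :=
      mul_le_mul_of_nonneg_left h2 (by positivity)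
    have h4 : Real.log p / p / Real.log Y
      = 1 / p - (p : ℝ)⁻¹ * (Real.log p * -(1 / Real.log Y) + 1) := by
      field_simp; ring
    rw [h4]
    linarith
  refine h1.trans ?_
  rw [div_le_iff₀ hlY0]
  have := h Y (by omega)
  have h5 : C ≤ C / Real.log 2 * Real.log Y := by
    rw [div_mul_eq_mul_div, le_div_iff₀ hl2]
    exact mul_le_mul_of_nonneg_left hlY hC
  nlinarith

/-- The number of integral ideals of norm `n` of a number field. -/
noncomputable def idealCount (K : Type*) [Field K] [NumberField K] (n : ℕ) : ℕ :=
  Nat.card {I : Ideal (NumberField.RingOfIntegers K) // Ideal.absNorm I = n}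

section IdealCount

open NumberField UniqueFactorizationMonoid

variable (K : Type*) [Field K] [NumberField K]

instance idealCount_finite (n : ℕ) : Finite {I : Ideal (𝓞 K) // Ideal.absNorm I = n} :=
  (Ideal.finite_setOfPred_absNorm_eq n).to_subtype

theorem idealCount_one : idealCount K 1 = 1 := by
  rw [idealCount, Nat.card_eq_one_iff_unique]
  refine ⟨⟨fun I J => Subtype.ext ?_⟩, ⟨⟨⊤, Ideal.absNorm_top⟩⟩⟩
  rw [Ideal.absNorm_eq_one_iff.1 I.2, Ideal.absNorm_eq_one_iff.1 J.2]

theorem span_natCast_sup_eq_top {m n : ℕ} (h : m.Coprime n) {I J : Ideal (𝓞 K)}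
    (hm : (m : 𝓞 K) ∈ I) (hn : (n : 𝓞 K) ∈ J) : I ⊔ J = ⊤ := by
  rw [← Ideal.isCoprime_iff_sup_eq]
  rw [Ideal.isCoprime_iff_exists]
  obtain ⟨a, b, hab⟩ := (Nat.isCoprime_iff_coprime.2 h)
  refine ⟨(a : 𝓞 K) * m, Ideal.mul_mem_left _ _ hm, (b : 𝓞 K) * n, Ideal.mul_mem_left _ _ hn, ?_⟩
  exact_mod_cast congrArg (Int.cast : ℤ → 𝓞 K) hab

theorem idealCount_mul {m n : ℕ} (h : m.Coprime n) :
    idealCount K (m * n) = idealCount K m * idealCount K n := by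
  rcases Nat.eq_zero_or_pos m with rfl | hm
  · rw [Nat.coprime_zero_left] at h; subst h; simp [idealCount_one]
  rcases Nat.eq_zero_or_pos n with rfl | hn
  · rw [Nat.coprime_zero_right] at h; subst h; simp [idealCount_one]
  have hmem : ∀ {k : ℕ} {I : Ideal (𝓞 K)}, Ideal.absNorm I = k → (k : 𝓞 K) ∈ I := by
    rintro k I rfl; exact Ideal.absNorm_mem I
  rw [idealCount, idealCount, idealCount, ← Nat.card_prod]
  symm
  refine Nat.card_eq_of_bijective (fun IJ => ⟨IJ.1.1 * IJ.2.1, by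
    rw [map_mul, IJ.1.2, IJ.2.2]⟩) ⟨?_, ?_⟩
  · have key : ∀ {k l : ℕ} (hkl : k.Coprime l) {I J : Ideal (𝓞 K)}, Ideal.absNorm I = k →
        Ideal.absNorm J = l → I * J ⊔ Ideal.span {(k : 𝓞 K)} = I := by
      intro k l hkl I J hI hJ
      have hs : J ⊔ Ideal.span {(k : 𝓞 K)} = ⊤ :=
        span_natCast_sup_eq_top K hkl.symm (hmem hJ) (Ideal.mem_span_singleton_self _)
      refine le_antisymm (sup_le Ideal.mul_le_left ?_) ?_
      · rw [Ideal.span_singleton_le_iff_mem]; exact hmem hI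
      · calc I = I * (J ⊔ Ideal.span {(k : 𝓞 K)}) := by rw [hs, Ideal.mul_top]
          _ ≤ _ := by
            rw [Ideal.mul_sup]
            exact sup_le_sup_left Ideal.mul_le_right _
    rintro ⟨⟨I, hI⟩, ⟨J, hJ⟩⟩ ⟨⟨I', hI'⟩, ⟨J', hJ'⟩⟩ he
    simp only [Subtype.mk.injEq] at he
    have h1 : I = I' := by rw [← key h hI hJ, ← key h hI' hJ', he]
    have h2 : J = J' := by
      rw [← key h.symm hJ hI, ← key h.symm hJ' hI', mul_comm, he, mul_comm]
    subst h1; subst h2; rfl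
  · rintro ⟨L, hL⟩
    have hmn : ((m : 𝓞 K) * n) ∈ L := by exact_mod_cast hmem hL
    set I := L ⊔ Ideal.span {(m : 𝓞 K)} with hI
    set J := L ⊔ Ideal.span {(n : 𝓞 K)} with hJ
    have hmI : (m : 𝓞 K) ∈ I := Ideal.mem_sup_right (Ideal.mem_span_singleton_self _)
    have hnJ : (n : 𝓞 K) ∈ J := Ideal.mem_sup_right (Ideal.mem_span_singleton_self _)
    have hIJ : I * J = L := by
      refine le_antisymm ?_ ?_
      · rw [hI, hJ, Ideal.sup_mul, Ideal.mul_sup, Ideal.mul_sup]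
        refine sup_le (sup_le Ideal.mul_le_right Ideal.mul_le_left)
          (sup_le Ideal.mul_le_right ?_)
        rw [Ideal.span_singleton_mul_span_singleton, Ideal.span_singleton_le_iff_mem]
        exact hmn
      · rw [Ideal.mul_eq_inf_of_coprime (span_natCast_sup_eq_top K h hmI hnJ)]
        exact le_inf le_sup_left le_sup_left
    have hdI : Ideal.absNorm I ∣ m ^ Module.finrank ℤ (𝓞 K) := by
      rw [← Ideal.absNorm_span_natCast]
      exact Ideal.absNorm_dvd_absNorm_of_le le_sup_right
    have hdJ : Ideal.absNorm J ∣ n ^ Module.finrank ℤ (𝓞 K) := by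
      rw [← Ideal.absNorm_span_natCast]
      exact Ideal.absNorm_dvd_absNorm_of_le le_sup_right
    have hprod : Ideal.absNorm I * Ideal.absNorm J = m * n := by rw [← map_mul, hIJ, hL]
    have hIm : Ideal.absNorm I ∣ m :=
      Nat.Coprime.dvd_of_dvd_mul_right ((h.pow_left _).coprime_dvd_left hdI)
        (hprod ▸ Dvd.intro _ rfl)
    have hJn : Ideal.absNorm J ∣ n :=
      Nat.Coprime.dvd_of_dvd_mul_left ((h.symm.pow_left _).coprime_dvd_left hdJ)
        (hprod ▸ Dvd.intro_left _ rfl)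
    have e1 := Nat.le_of_dvd hm hIm
    have e2 := Nat.le_of_dvd hn hJn
    have e3 : Ideal.absNorm I = m := by
      by_contra hne
      have : Ideal.absNorm I < m := lt_of_le_of_ne e1 hne
      have : Ideal.absNorm I * Ideal.absNorm J < m * n :=
        Nat.mul_lt_mul_of_lt_of_le this e2 hn
      omega
    have e4 : Ideal.absNorm J = n := by
      rw [e3] at hprod; exact Nat.eq_of_mul_eq_mul_left hm hprod
    exact ⟨⟨⟨I, e3⟩, ⟨J, e4⟩⟩, Subtype.ext hIJ⟩

theorem idealCount_prime_pow_le {p : ℕ} (hp : p.Prime) (k : ℕ) :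
    idealCount K (p ^ k) ≤ (k + 1) ^ Module.finrank ℤ (𝓞 K) := by
  classical
  set d := Module.finrank ℤ (𝓞 K)
  set P := Ideal.span {(p : 𝓞 K)} with hP
  have hNP : Ideal.absNorm P = p ^ d := Ideal.absNorm_span_natCast p
  have hP0 : P ≠ ⊥ := by
    rw [Ne, ← Ideal.absNorm_eq_zero_iff, hNP]
    exact pow_ne_zero _ hp.ne_zero
  set PP := (normalizedFactors P).toFinset
  have hnorm : ∀ Q ∈ normalizedFactors P, p ≤ Ideal.absNorm Q := by
    intro Q hQ
    have h1 : Ideal.absNorm Q ∣ p ^ d := by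
      rw [← hNP]; exact map_dvd _ (dvd_of_mem_normalizedFactors hQ)
    obtain ⟨j, -, hj⟩ := (Nat.dvd_prime_pow hp).1 h1
    rw [hj]
    refine Nat.le_self_pow ?_ p
    rintro rfl
    rw [pow_zero, Ideal.absNorm_eq_one_iff] at hj
    exact (prime_of_normalized_factor Q hQ).not_isUnit (Ideal.isUnit_iff.2 hj)
  have hcard : PP.card ≤ d := by
    refine (Multiset.toFinset_card_le _).trans ?_
    have h2 : (Multiset.map Ideal.absNorm (normalizedFactors P)).prod = p ^ d := by
      rw [← map_multiset_prod, Ideal.prod_normalizedFactors_eq_self hP0, hNP]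
    have h3 : p ^ Multiset.card (normalizedFactors P) ≤
        (Multiset.map Ideal.absNorm (normalizedFactors P)).prod := by
      rw [← Multiset.card_map Ideal.absNorm]
      refine Multiset.pow_card_le_prod ?_
      intro x hx
      obtain ⟨Q, hQ, rfl⟩ := Multiset.mem_map.1 hx
      exact hnorm Q hQ
    rw [h2] at h3
    exact (Nat.pow_le_pow_iff_right hp.one_lt).1 h3
  have hI0 : ∀ I : {I : Ideal (𝓞 K) // Ideal.absNorm I = p ^ k}, I.1 ≠ ⊥ := by
    rintro ⟨I, hI⟩ h
    rw [← Ideal.absNorm_eq_zero_iff, hI] at h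
    exact pow_ne_zero _ hp.ne_zero h
  have hmem : ∀ I : {I : Ideal (𝓞 K) // Ideal.absNorm I = p ^ k}, ∀ Q ∈ normalizedFactors I.1,
      Q ∈ normalizedFactors P := by
    rintro ⟨I, hI⟩ Q hQ
    have hQI := dvd_of_mem_normalizedFactors hQ
    have hpr := prime_of_normalized_factor Q hQ
    have h4 : I ∣ P ^ k := by
      rw [Ideal.dvd_iff_le, hP, Ideal.span_singleton_pow, Ideal.span_singleton_le_iff_mem]
      have := Ideal.absNorm_mem I
      rw [hI] at this
      exact_mod_cast this
    have h5 : Q ∣ P := hpr.dvd_of_dvd_pow (hQI.trans h4)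
    rw [Ideal.mem_normalizedFactors_iff hP0]
    exact ⟨Ideal.isPrime_of_prime hpr, Ideal.dvd_iff_le.1 h5⟩
  have hcount : ∀ I : {I : Ideal (𝓞 K) // Ideal.absNorm I = p ^ k}, ∀ Q ∈ normalizedFactors P,
      Multiset.count Q (normalizedFactors I.1) < k + 1 := by
    rintro ⟨I, hI⟩ Q hQ
    have h6 : Q ^ Multiset.count Q (normalizedFactors I) ∣ I := by
      have h0 : I ≠ ⊥ := hI0 ⟨I, hI⟩
      conv_rhs => rw [← Ideal.prod_normalizedFactors_eq_self h0]
      rw [← Multiset.prod_replicate]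
      exact Multiset.prod_dvd_prod_of_le (Multiset.le_count_iff_replicate_le.1 le_rfl)
    have h7 := map_dvd Ideal.absNorm h6
    rw [map_pow, hI] at h7
    have h8 := Nat.le_of_dvd (pow_pos hp.pos _) h7
    have h9 := (Nat.pow_le_pow_left (hnorm Q hQ) _).trans h8
    exact Nat.lt_succ_of_le ((Nat.pow_le_pow_iff_right hp.one_lt).1 h9)
  let φ : {I : Ideal (𝓞 K) // Ideal.absNorm I = p ^ k} → (PP → Fin (k + 1)) := fun I Q =>
    ⟨Multiset.count Q.1 (normalizedFactors I.1), hcount I Q.1 (Multiset.mem_toFinset.1 Q.2)⟩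
  have hφ : Function.Injective φ := by
    intro I J hIJ
    refine Subtype.ext ?_
    rw [← Ideal.prod_normalizedFactors_eq_self (hI0 I), ← Ideal.prod_normalizedFactors_eq_self (hI0 J)]
    congr 1
    ext Q
    by_cases hQ : Q ∈ normalizedFactors P
    · have := congrFun hIJ ⟨Q, Multiset.mem_toFinset.2 hQ⟩
      simpa [φ] using this
    · rw [Multiset.count_eq_zero_of_notMem fun h => hQ (hmem I Q h),
        Multiset.count_eq_zero_of_notMem fun h => hQ (hmem J Q h)]
  have h10 := Nat.card_le_card_of_injective φ hφ
  rw [Nat.card_fun, Nat.card_fin, Nat.card_eq_fintype_card (α := PP), Fintype.card_coe] at h10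
  exact h10.trans (Nat.pow_le_pow_right (by omega) hcard)

end IdealCount

section PrimeIdealSums

open NumberField Filter Topology

variable (K : Type*) [Field K] [NumberField K]

theorem dedekindZeta_bounds : ∃ s₀ c C : ℝ, 1 < s₀ ∧ 0 < c ∧ 0 < C ∧ ∀ s : ℝ, 1 < s → s < s₀ →
    Summable (fun n : ℕ => (idealCount K n : ℝ) * (n : ℝ) ^ (-s)) ∧
    c / (s - 1) ≤ ∑' n : ℕ, (idealCount K n : ℝ) * (n : ℝ) ^ (-s) ∧
    ∑' n : ℕ, (idealCount K n : ℝ) * (n : ℝ) ^ (-s) ≤ C / (s - 1) := by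
  have hres := dedekindZeta_residue_pos K
  set R := dedekindZeta_residue K
  have hz : ∀ s : ℝ, 1 < s → dedekindZeta K (s : ℂ) =
      ((∑' n : ℕ, (idealCount K n : ℝ) * (n : ℝ) ^ (-s) : ℝ) : ℂ) := by
    intro s hs
    rw [dedekindZeta, LSeries, Complex.ofReal_tsum]
    refine tsum_congr fun n => ?_
    rw [LSeries.term_def]
    split_ifs with hn
    · subst hn
      rw [Nat.cast_zero, Real.zero_rpow (by linarith)]
      simp
    · rw [Real.rpow_neg (Nat.cast_nonneg n)]
      push_cast
      rw [Complex.ofReal_cpow (Nat.cast_nonneg n)]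
      rfl
  have ht : Tendsto (fun s : ℝ => (s - 1) * ∑' n : ℕ, (idealCount K n : ℝ) * (n : ℝ) ^ (-s))
      (𝓝[>] 1) (𝓝 R) := by
    have h1 := (Complex.continuous_re.tendsto _).comp (tendsto_sub_one_mul_dedekindZeta_nhdsGT K)
    refine h1.congr' ?_
    filter_upwards [self_mem_nhdsWithin] with s hs
    simp only [Function.comp]
    rw [hz s hs, ← Complex.ofReal_one, ← Complex.ofReal_sub, ← Complex.ofReal_mul,
      Complex.ofReal_re]
  have hev : ∀ᶠ s : ℝ in 𝓝[>] 1, (s - 1) * ∑' n : ℕ, (idealCount K n : ℝ) * (n : ℝ) ^ (-s) ∈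
      Set.Ioo (R / 2) (2 * R) :=
    ht (Ioo_mem_nhds (by change R / 2 < R; linarith) (by change R < 2 * R; linarith))
  obtain ⟨s₀, hs₀, hsub⟩ := (mem_nhdsGT_iff_exists_Ioo_subset).1 hev
  refine ⟨s₀, R / 2, 2 * R, hs₀, by positivity, by positivity, fun s h1 h2 => ?_⟩
  have hs1 : 0 < s - 1 := by linarith
  obtain ⟨ha, hb⟩ := hsub ⟨h1, h2⟩
  refine ⟨?_, ?_, ?_⟩
  · by_contra hns
    rw [tsum_eq_zero_of_not_summable hns, mul_zero] at ha
    linarith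
  · rw [div_le_iff₀ hs1]; linarith
  · rw [le_div_iff₀ hs1]; linarith

theorem exp_sub_sq_le_one_add {x : ℝ} (hx : 0 ≤ x) : Real.exp (x - x ^ 2) ≤ 1 + x := by
  have h := Real.add_one_le_exp (-(x - x ^ 2))
  rw [Real.exp_neg] at h
  have hpos : 0 < -(x - x ^ 2) + 1 := by nlinarith [sq_nonneg (x - 1)]
  have h2 : Real.exp (x - x ^ 2) ≤ (-(x - x ^ 2) + 1)⁻¹ := by
    rw [le_inv_comm₀ (Real.exp_pos _) hpos]; exact h
  refine h2.trans ?_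
  rw [inv_le_iff_one_le_mul₀ hpos]
  nlinarith [pow_nonneg hx 3]

theorem sum_inv_sq_le (s : Finset ℕ) : ∑ p ∈ s, (1 : ℝ) / (p : ℝ) ^ 2 ≤
    ∑' n : ℕ, (1 : ℝ) / (n : ℝ) ^ 2 :=
  (Real.summable_one_div_nat_pow.2 (by norm_num)).sum_le_tsum _ fun _ _ => by positivity

theorem idealCount_prime_le {p : ℕ} (hp : p.Prime) :
    (idealCount K p : ℝ) ≤ 2 ^ Module.finrank ℤ (𝓞 K) := by
  have := idealCount_prime_pow_le K hp 1
  rw [pow_one] at this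
  exact_mod_cast this

/-- The Dirichlet coefficients `a_n n^{-s}` of the Dedekind zeta function. -/
noncomputable def zetaTerm (s : ℝ) (n : ℕ) : ℝ := (idealCount K n : ℝ) * (n : ℝ) ^ (-s)

theorem zetaTerm_nonneg (s : ℝ) (n : ℕ) : 0 ≤ zetaTerm K s n := by
  unfold zetaTerm; positivity

theorem zetaTerm_one (s : ℝ) : zetaTerm K s 1 = 1 := by simp [zetaTerm, idealCount_one]

theorem zetaTerm_mul (s : ℝ) {m n : ℕ} (h : m.Coprime n) :
    zetaTerm K s (m * n) = zetaTerm K s m * zetaTerm K s n := by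
  unfold zetaTerm
  rw [idealCount_mul K h, Nat.cast_mul, Nat.cast_mul,
    Real.mul_rpow (Nat.cast_nonneg m) (Nat.cast_nonneg n)]
  ring

theorem log_log_bddBelow {Y : ℕ} (hY : 2 ≤ Y) :
    Real.log (Real.log 2) ≤ Real.log (Real.log Y) := by
  have hl2 : 0 < Real.log 2 := Real.log_pos (by norm_num)
  exact Real.log_le_log hl2 (Real.log_le_log (by norm_num) (by exact_mod_cast hY))

theorem primesLE_mono {m n : ℕ} (h : m ≤ n) : m.primesLE ⊆ n.primesLE := by
  intro p hp
  rw [Nat.mem_primesLE] at hp ⊢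
  exact ⟨hp.1.trans h, hp.2⟩

theorem sum_idealCount_le : ∃ C : ℝ, ∀ Y : ℕ, 2 ≤ Y →
    ∑ p ∈ Y.primesLE, (idealCount K p : ℝ) / p ≤ Real.log (Real.log Y) + C := by
  obtain ⟨s₀, c, C, hs₀, hc, hC, h⟩ := dedekindZeta_bounds K
  obtain ⟨C₁, hC₁, h₁⟩ := sum_prime_sub_rpow_le
  set D : ℝ := 2 ^ Module.finrank ℤ (𝓞 K) with hD
  have hD0 : 0 < D := by positivity
  set Q : ℝ := ∑' n : ℕ, (1 : ℝ) / (n : ℝ) ^ 2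
  obtain ⟨Y₀, hY₀⟩ := exists_nat_gt (Real.exp (1 / (s₀ - 1)))
  have hs0' : 0 < s₀ - 1 := by linarith
  set C₂ : ℝ := Real.log C + D ^ 2 * Q + D * C₁
  set C₃ : ℝ := ∑ p ∈ Y₀.primesLE, (idealCount K p : ℝ) / p - Real.log (Real.log 2)
  refine ⟨max C₂ C₃, fun Y hY => ?_⟩
  have hl2 : 0 < Real.log 2 := Real.log_pos (by norm_num)
  rcases le_total Y Y₀ with hYY | hYY
  · have h1 : ∑ p ∈ Y.primesLE, (idealCount K p : ℝ) / p ≤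
        ∑ p ∈ Y₀.primesLE, (idealCount K p : ℝ) / p :=
      Finset.sum_le_sum_of_subset_of_nonneg (primesLE_mono hYY) fun _ _ _ => by positivity
    have h2 := log_log_bddBelow hY
    have h3 := le_max_right C₂ C₃
    simp only [C₃] at h3 ⊢
    linarith
  · have hY0 : (0 : ℝ) < Y := by positivity
    have hlY0 : 0 < Real.log Y := Real.log_pos (by exact_mod_cast hY)
    set s : ℝ := 1 + 1 / Real.log Y with hs
    have hs1 : 1 < s := by rw [hs]; have := one_div_pos.2 hlY0; linarith
    have hs2 : s < s₀ := by
      have h3 : 1 / (s₀ - 1) < Real.log Y := by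
        rw [Real.lt_log_iff_exp_lt hY0]
        exact hY₀.trans_le (by exact_mod_cast hYY)
      have h4 : 1 / Real.log Y < s₀ - 1 := by
        rw [div_lt_iff₀ hs0'] at h3
        rw [div_lt_iff₀ hlY0]; linarith
      rw [hs]; linarith
    obtain ⟨hsum, -, hub⟩ := h s hs1 hs2
    have hsum' : Summable (zetaTerm K s) := hsum
    have hpsum : ∀ {p : ℕ}, p.Prime → Summable fun n : ℕ => ‖zetaTerm K s (p ^ n)‖ := by
      intro p hp
      exact hsum'.norm.comp_injective (Nat.pow_right_injective hp.two_le)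
    have hE := EulerProduct.summable_and_hasSum_smoothNumbers_prod_primesBelow_tsum
      (zetaTerm_one K s) (fun {m n} h => zetaTerm_mul K s h) hpsum (Y + 1)
    have h5 : ∏ p ∈ (Y + 1).primesBelow, ∑' n : ℕ, zetaTerm K s (p ^ n) ≤ C * Real.log Y := by
      rw [← hE.2.tsum_eq]
      refine (hsum'.tsum_subtype_le _ _ (zetaTerm_nonneg K s)).trans (hub.trans (le_of_eq ?_))
      rw [hs]; field_simp; ring
    have h6 : ∏ p ∈ Y.primesLE, (1 + zetaTerm K s p) ≤
        ∏ p ∈ (Y + 1).primesBelow, ∑' n : ℕ, zetaTerm K s (p ^ n) := by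
      refine Finset.prod_le_prod (fun p _ => by linarith [zetaTerm_nonneg K s p]) fun p hp => ?_
      have hp' := (Nat.mem_primesLE.1 hp).2
      have h7 := (hpsum hp').of_norm.sum_le_tsum (Finset.range 2)
        fun n _ => zetaTerm_nonneg K s (p ^ n)
      simpa [Finset.sum_range_succ, zetaTerm_one] using h7
    have hzp : ∀ p ∈ Y.primesLE, zetaTerm K s p ≤ D * (1 / p) := by
      intro p hp
      have hp' := (Nat.mem_primesLE.1 hp).2
      have hp1 : (1 : ℝ) ≤ p := by exact_mod_cast hp'.one_lt.le
      unfold zetaTerm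
      refine mul_le_mul ?_ ?_ (by positivity) hD0.le
      · exact idealCount_prime_le K hp'
      · rw [one_div, ← Real.rpow_neg_one]
        exact Real.rpow_le_rpow_of_exponent_le hp1 (by linarith)
    have h8 : Real.exp (∑ p ∈ Y.primesLE, (zetaTerm K s p - zetaTerm K s p ^ 2)) ≤
        ∏ p ∈ Y.primesLE, (1 + zetaTerm K s p) := by
      rw [Real.exp_sum]
      exact Finset.prod_le_prod (fun _ _ => (Real.exp_pos _).le)
        fun p _ => exp_sub_sq_le_one_add (zetaTerm_nonneg K s p)
    have h9 : ∑ p ∈ Y.primesLE, (zetaTerm K s p - zetaTerm K s p ^ 2) ≤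
        Real.log C + Real.log (Real.log Y) := by
      rw [← Real.log_mul hC.ne' hlY0.ne', Real.le_log_iff_exp_le (by positivity)]
      exact h8.trans (h6.trans h5)
    have h10 : ∑ p ∈ Y.primesLE, zetaTerm K s p ^ 2 ≤ D ^ 2 * Q := by
      refine le_trans ?_ (mul_le_mul_of_nonneg_left (sum_inv_sq_le Y.primesLE) (by positivity))
      rw [Finset.mul_sum]
      refine Finset.sum_le_sum fun p hp => ?_
      calc zetaTerm K s p ^ 2 ≤ (D * (1 / p)) ^ 2 :=
            pow_le_pow_left₀ (zetaTerm_nonneg K s p) (hzp p hp) 2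
        _ = _ := by ring
    have h11 : ∑ p ∈ Y.primesLE, ((idealCount K p : ℝ) / p - zetaTerm K s p) ≤ D * C₁ := by
      refine le_trans ?_ (mul_le_mul_of_nonneg_left (h₁ Y hY) hD0.le)
      rw [Finset.mul_sum]
      refine Finset.sum_le_sum fun p hp => ?_
      have hp' := (Nat.mem_primesLE.1 hp).2
      have hp1 : (1 : ℝ) ≤ p := by exact_mod_cast hp'.one_lt.le
      have h12 : (p : ℝ) ^ (-(1 + 1 / Real.log Y)) ≤ 1 / p := by
        rw [one_div (p : ℝ), ← Real.rpow_neg_one]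
        exact Real.rpow_le_rpow_of_exponent_le hp1 (by rw [← hs]; linarith)
      have h13 : (idealCount K p : ℝ) ≤ D := idealCount_prime_le K hp'
      unfold zetaTerm
      rw [← hs] at h12 ⊢
      calc (idealCount K p : ℝ) / p - idealCount K p * (p : ℝ) ^ (-s)
          = idealCount K p * (1 / p - (p : ℝ) ^ (-s)) := by ring
        _ ≤ _ := mul_le_mul_of_nonneg_right h13 (by linarith)
    rw [Finset.sum_sub_distrib] at h9 h11
    have h14 := le_max_left C₂ C₃
    simp only [C₂] at h14 ⊢
    linarith

theorem le_sum_idealCount : ∃ C : ℝ, ∀ Y : ℕ, 2 ≤ Y →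
    Real.log (Real.log Y) - C ≤ ∑ p ∈ Y.primesLE, (idealCount K p : ℝ) / p := by
  obtain ⟨s₀, c, C, hs₀, hc, hC, h⟩ := dedekindZeta_bounds K
  obtain ⟨C₁, hC₁, h₁⟩ := sum_prime_tail_le
  set d := Module.finrank ℤ (𝓞 K) with hd
  set D : ℝ := 2 ^ d with hD
  have hD0 : 0 < D := by positivity
  set Q : ℝ := ∑' n : ℕ, (1 : ℝ) / (n : ℝ) ^ 2
  have hEsum : Summable fun k : ℕ => ((k : ℝ) + 3) ^ d * (1 / 2 : ℝ) ^ k := by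
    have h1 : Summable fun k : ℕ => ((k : ℝ)) ^ d * (1 / 2 : ℝ) ^ k :=
      summable_pow_mul_geometric_of_norm_lt_one d (by norm_num)
    have h2 := ((summable_nat_add_iff 3).2 h1).mul_left 8
    refine h2.congr fun k => ?_
    push_cast
    rw [pow_add]; ring
  set E : ℝ := ∑' k : ℕ, ((k : ℝ) + 3) ^ d * (1 / 2 : ℝ) ^ k
  have hE0 : 0 ≤ E := tsum_nonneg fun k => by positivity
  obtain ⟨Y₀, hY₀⟩ := exists_nat_gt (Real.exp (1 / (s₀ - 1)))
  have hs0' : 0 < s₀ - 1 := by linarith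
  set C₂ : ℝ := D * C₁ + E * Q - Real.log c with hC₂
  set C₃ : ℝ := Real.log (Real.log Y₀)
  refine ⟨max C₂ C₃, fun Y hY => ?_⟩
  have hl2 : 0 < Real.log 2 := Real.log_pos (by norm_num)
  have hY0 : (0 : ℝ) < Y := by positivity
  have hlY0 : 0 < Real.log Y := Real.log_pos (by exact_mod_cast hY)
  rcases le_total Y Y₀ with hYY | hYY
  · have h1 : 0 ≤ ∑ p ∈ Y.primesLE, (idealCount K p : ℝ) / p :=
      Finset.sum_nonneg fun _ _ => by positivity
    have h2 : Real.log (Real.log Y) ≤ Real.log (Real.log Y₀) :=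
      Real.log_le_log hlY0 (Real.log_le_log hY0 (by exact_mod_cast hYY))
    have h3 := le_max_right C₂ C₃
    simp only [C₃] at h3 ⊢
    linarith
  · set s : ℝ := 1 + 1 / Real.log Y with hs
    have hs1 : 1 < s := by rw [hs]; have := one_div_pos.2 hlY0; linarith
    have hs2 : s < s₀ := by
      have h3 : 1 / (s₀ - 1) < Real.log Y := by
        rw [Real.lt_log_iff_exp_lt hY0]
        exact hY₀.trans_le (by exact_mod_cast hYY)
      have h4 : 1 / Real.log Y < s₀ - 1 := by
        rw [div_lt_iff₀ hs0'] at h3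
        rw [div_lt_iff₀ hlY0]; linarith
      rw [hs]; linarith
    obtain ⟨hsum, hlb, -⟩ := h s hs1 hs2
    have hsum' : Summable (zetaTerm K s) := hsum
    have h0 : zetaTerm K s 0 = 0 := by
      unfold zetaTerm; rw [Nat.cast_zero (R := ℝ), Real.zero_rpow (by linarith), mul_zero]
    have hT := EulerProduct.eulerProduct (zetaTerm_one K s) (fun {m n} h => zetaTerm_mul K s h)
      hsum'.norm h0
    have hfac : ∀ p : ℕ, p.Prime → ∑' e : ℕ, zetaTerm K s (p ^ e) ≤
        Real.exp (zetaTerm K s p + E * (1 / (p : ℝ) ^ 2)) := by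
      intro p hp
      have hp0 : (0 : ℝ) < p := by exact_mod_cast hp.pos
      have hp2 : (2 : ℝ) ≤ p := by exact_mod_cast hp.two_le
      have hps : Summable fun n : ℕ => zetaTerm K s (p ^ n) :=
        hsum'.comp_injective (Nat.pow_right_injective hp.two_le)
      rw [← hps.sum_add_tsum_nat_add 2]
      have h5 : ∑' k : ℕ, zetaTerm K s (p ^ (k + 2)) ≤ E * (1 / (p : ℝ) ^ 2) := by
        rw [← tsum_mul_right]
        refine Summable.tsum_le_tsum (fun k => ?_) ((summable_nat_add_iff 2).2 hps)
          (hEsum.mul_right _)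
        unfold zetaTerm
        have h6 : (idealCount K (p ^ (k + 2)) : ℝ) ≤ ((k : ℝ) + 3) ^ d := by
          have := idealCount_prime_pow_le K hp (k + 2)
          have h7 : (idealCount K (p ^ (k + 2)) : ℝ) ≤ ((k + 2 + 1 : ℕ) : ℝ) ^ d := by
            exact_mod_cast this
          refine h7.trans (le_of_eq ?_)
          push_cast; ring
        have h8 : ((p ^ (k + 2) : ℕ) : ℝ) ^ (-s) ≤ (1 / 2 : ℝ) ^ k * (1 / (p : ℝ) ^ 2) := by
          have h9 : ((p ^ (k + 2) : ℕ) : ℝ) ^ (-s) ≤ ((p ^ (k + 2) : ℕ) : ℝ) ^ (-1 : ℝ) := by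
            refine Real.rpow_le_rpow_of_exponent_le ?_ (by linarith)
            exact_mod_cast Nat.one_le_pow _ _ hp.pos
          refine h9.trans ?_
          rw [Real.rpow_neg_one]
          push_cast
          rw [pow_add, mul_inv, one_div, one_div, inv_pow]
          gcongr
        calc _ ≤ ((k : ℝ) + 3) ^ d * ((1 / 2 : ℝ) ^ k * (1 / (p : ℝ) ^ 2)) :=
              mul_le_mul h6 h8 (by positivity) (by positivity)
          _ = _ := by ring
      have h6 : ∑ i ∈ Finset.range 2, zetaTerm K s (p ^ i) = 1 + zetaTerm K s p := by
        simp [Finset.sum_range_succ, zetaTerm_one]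
      rw [h6]
      have h7 := Real.add_one_le_exp (zetaTerm K s p + E * (1 / (p : ℝ) ^ 2))
      linarith
    have hbound : ∀ n : ℕ, ∏ p ∈ n.primesBelow, ∑' e : ℕ, zetaTerm K s (p ^ e) ≤
        Real.exp (∑ p ∈ Y.primesLE, (idealCount K p : ℝ) / p + D * C₁ + E * Q) := by
      intro n
      have h5 : ∏ p ∈ n.primesBelow, ∑' e : ℕ, zetaTerm K s (p ^ e) ≤
          Real.exp (∑ p ∈ n.primesBelow, (zetaTerm K s p + E * (1 / (p : ℝ) ^ 2))) := by
        rw [Real.exp_sum]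
        exact Finset.prod_le_prod (fun p _ => tsum_nonneg fun e => zetaTerm_nonneg K s _)
          fun p hp => hfac p (Nat.prime_of_mem_primesBelow hp)
      refine h5.trans (Real.exp_le_exp.2 ?_)
      rw [Finset.sum_add_distrib, ← Finset.mul_sum]
      have h6 := mul_le_mul_of_nonneg_left (sum_inv_sq_le n.primesBelow) hE0
      have h7 : ∑ p ∈ n.primesBelow, zetaTerm K s p ≤
          ∑ p ∈ Y.primesLE, (idealCount K p : ℝ) / p + D * C₁ := by
        have hsub : n.primesBelow ⊆ Y.primesLE ∪ n.primesLE.filter (fun p => Y < p) := by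
          intro p hp
          have hpp := Nat.prime_of_mem_primesBelow hp
          have hlt := Nat.lt_of_mem_primesBelow hp
          simp only [Finset.mem_union, Finset.mem_filter, Nat.mem_primesLE]
          by_cases hc : p ≤ Y
          · exact Or.inl ⟨hc, hpp⟩
          · exact Or.inr ⟨⟨hlt.le, hpp⟩, by omega⟩
        refine (Finset.sum_le_sum_of_subset_of_nonneg hsub
          fun p _ _ => zetaTerm_nonneg K s p).trans ?_
        refine (sum_union_le_add _ _ (zetaTerm_nonneg K s)).trans (add_le_add ?_ ?_)
        · refine Finset.sum_le_sum fun p hp => ?_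
          have hp' := (Nat.mem_primesLE.1 hp).2
          have hp1 : (1 : ℝ) ≤ p := by exact_mod_cast hp'.one_lt.le
          unfold zetaTerm
          rw [div_eq_mul_inv, ← Real.rpow_neg_one (p : ℝ)]
          exact mul_le_mul_of_nonneg_left
            (Real.rpow_le_rpow_of_exponent_le hp1 (by linarith)) (Nat.cast_nonneg _)
        · refine le_trans ?_ (mul_le_mul_of_nonneg_left (h₁ Y n hY) hD0.le)
          rw [Finset.mul_sum]
          refine Finset.sum_le_sum fun p hp => ?_
          rw [Finset.mem_filter, Nat.mem_primesLE] at hp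
          unfold zetaTerm
          refine mul_le_mul_of_nonneg_right ?_ (by positivity)
          exact idealCount_prime_le K hp.1.2
      linarith
    have h15 : c * Real.log Y ≤
        Real.exp (∑ p ∈ Y.primesLE, (idealCount K p : ℝ) / p + D * C₁ + E * Q) := by
      refine le_trans (le_of_eq ?_) (hlb.trans (le_of_tendsto' hT hbound))
      rw [hs]; field_simp; ring
    rw [← Real.log_le_iff_le_exp (by positivity), Real.log_mul hc.ne' hlY0.ne'] at h15
    have h14 := le_max_left C₂ C₃
    simp only [hC₂] at h14 ⊢
    linarith

end PrimeIdealSums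

section RingHoms

open NumberField

variable (K : Type*) [Field K] [NumberField K]

theorem ringHom_zmod_surjective {R : Type*} [CommRing R] {p : ℕ} (ψ : R →+* ZMod p) :
    Function.Surjective ψ := by
  intro y
  obtain ⟨n, rfl⟩ := ZMod.intCast_surjective y
  exact ⟨n, map_intCast ψ n⟩

theorem idealCount_eq_card_ringHom {p : ℕ} (hp : p.Prime) :
    idealCount K p = Nat.card (𝓞 K →+* ZMod p) := by
  have := Fact.mk hp
  rw [idealCount]
  symm
  refine Nat.card_eq_of_bijective (fun ψ => ⟨RingHom.ker ψ, ?_⟩) ⟨?_, ?_⟩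
  · rw [Ideal.absNorm_apply, Submodule.cardQuot_apply,
      Nat.card_congr (RingHom.quotientKerEquivOfSurjective (ringHom_zmod_surjective ψ)).toEquiv,
      Nat.card_zmod]
  · intro ψ ψ' h
    have hk : RingHom.ker ψ = RingHom.ker ψ' := congrArg Subtype.val h
    ext x
    obtain ⟨n, hn⟩ := ZMod.intCast_surjective (ψ x)
    have h1 : x - n ∈ RingHom.ker ψ := by
      rw [RingHom.mem_ker, map_sub, map_intCast, hn, sub_self]
    rw [hk, RingHom.mem_ker, map_sub, map_intCast, sub_eq_zero] at h1
    rw [h1, hn]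
  · rintro ⟨I, hI⟩
    rw [Ideal.absNorm_apply, Submodule.cardQuot_apply] at hI
    have : Finite (𝓞 K ⧸ I) := Nat.finite_of_card_ne_zero (by rw [hI]; exact hp.ne_zero)
    have := Fintype.ofFinite (𝓞 K ⧸ I)
    rw [Nat.card_eq_fintype_card] at hI
    let e := ZMod.ringEquivOfPrime (𝓞 K ⧸ I) hp hI
    refine ⟨e.symm.toRingHom.comp (Ideal.Quotient.mk I), Subtype.ext ?_⟩
    ext x
    simp [RingHom.mem_ker, Ideal.Quotient.eq_zero_iff_mem]

variable {K}

theorem exists_uniform_denominator {A : Type*} [CommRing A] (s : A →+* 𝓞 K)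
    (h : Algebra.adjoin ℚ (Set.range fun b => (s b : K)) = ⊤) :
    ∃ M : ℕ, M ≠ 0 ∧ ∀ x : 𝓞 K, ∃ b, s b = M * x := by
  have h1 : ∀ x : K, ∃ M : ℕ, M ≠ 0 ∧ ∃ b, (s b : K) = M * x := by
    intro x
    have hx : x ∈ Algebra.adjoin ℚ (Set.range fun b => (s b : K)) := by rw [h]; trivial
    induction hx using Algebra.adjoin_induction with
    | mem x hx =>
      obtain ⟨b, rfl⟩ := hx
      exact ⟨1, one_ne_zero, b, by simp⟩
    | algebraMap r =>
      refine ⟨r.den, r.den_ne_zero, (r.num : A), ?_⟩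
      rw [map_intCast]
      have h2 : (r.den : ℚ) * r = r.num := by rw [mul_comm]; exact Rat.mul_den_eq_num r
      have h3 := congrArg (algebraMap ℚ K) h2
      rw [map_mul, map_natCast, map_intCast] at h3
      rw [h3]; simp
    | add x y _ _ hx hy =>
      obtain ⟨M, hM, b, hb⟩ := hx
      obtain ⟨N, hN, c, hc⟩ := hy
      refine ⟨M * N, mul_ne_zero hM hN, N * b + M * c, ?_⟩
      simp only [map_add, map_mul, map_natCast, hb, hc, Nat.cast_mul]
      ring
    | mul x y _ _ hx hy =>
      obtain ⟨M, hM, b, hb⟩ := hx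
      obtain ⟨N, hN, c, hc⟩ := hy
      refine ⟨M * N, mul_ne_zero hM hN, b * c, ?_⟩
      simp only [map_mul, hb, hc, Nat.cast_mul]
      ring
  have h2 : ∀ x : 𝓞 K, ∃ M : ℕ, M ≠ 0 ∧ ∃ b, s b = M * x := by
    intro x
    obtain ⟨M, hM, b, hb⟩ := h1 x
    refine ⟨M, hM, b, RingOfIntegers.ext ?_⟩
    simp [hb]
  obtain ⟨S, hS⟩ := (Module.Finite.fg_top : (⊤ : Submodule ℤ (𝓞 K)).FG)
  choose M hM b hb using h2
  refine ⟨∏ x ∈ S, M x, Finset.prod_ne_zero_iff.2 fun x _ => hM x, fun x => ?_⟩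
  have hx : x ∈ Submodule.span ℤ (S : Set (𝓞 K)) := by rw [hS]; trivial
  induction hx using Submodule.span_induction with
  | mem x hx =>
    obtain ⟨k, hk⟩ := Finset.dvd_prod_of_mem M hx
    refine ⟨k * b x, ?_⟩
    rw [hk, map_mul, map_natCast, hb, Nat.cast_mul]; ring
  | zero => exact ⟨0, by simp⟩
  | add x y _ _ hx hy =>
    obtain ⟨u, hu⟩ := hx
    obtain ⟨v, hv⟩ := hy
    exact ⟨u + v, by rw [map_add, hu, hv, mul_add]⟩
  | smul n x _ hx =>
    obtain ⟨u, hu⟩ := hx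
    refine ⟨n • u, ?_⟩
    rw [map_zsmul, hu, mul_smul_comm]

theorem ringHom_comp_injective {A R : Type*} [CommRing A] [CommRing R] {s : A →+* R} {M : ℕ}
    (hs : ∀ x : R, ∃ b, s b = M * x) {p : ℕ} (hp : p.Prime) (hpM : ¬ p ∣ M) :
    Function.Injective fun ψ : R →+* ZMod p => ψ.comp s := by
  have := Fact.mk hp
  intro ψ ψ' h
  ext x
  obtain ⟨b, hb⟩ := hs x
  have h1 := congrArg (fun φ : A →+* ZMod p => φ b) h
  simp only [RingHom.comp_apply, hb, map_mul, map_natCast] at h1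
  refine mul_left_cancel₀ ?_ h1
  rwa [Ne, ZMod.natCast_eq_zero_iff]

theorem exists_ringHom_comp_eq {A R : Type*} [CommRing A] [CommRing R] {s : A →+* R} {M : ℕ}
    (hs : ∀ x : R, ∃ b, s b = M * x) {p : ℕ} (hp : p.Prime) (hpM : ¬ p ∣ M)
    (φ : A →+* ZMod p) (hφ : ∀ b, s b = 0 → φ b = 0) :
    ∃ ψ : R →+* ZMod p, ψ.comp s = φ := by
  have := Fact.mk hp
  have hM : (M : ZMod p) ≠ 0 := by rwa [Ne, ZMod.natCast_eq_zero_iff]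
  have hφ' : ∀ b c, s b = s c → φ b = φ c := fun b c h => by
    rw [← sub_eq_zero, ← map_sub]; exact hφ _ (by rw [map_sub, h, sub_self])
  choose b hb using hs
  have key : ∀ x c, s c = M * x → φ c = φ (b x) := fun x c h => hφ' _ _ (by rw [h, hb])
  let ψ : R →+* ZMod p :=
    { toFun := fun x => (M : ZMod p)⁻¹ * φ (b x)
      map_one' := by
        rw [← key 1 (M : A) (by simp), map_natCast, inv_mul_cancel₀ hM]
      map_mul' := fun x y => by
        have h1 : φ (b x * b y) = φ (M * b (x * y)) := hφ' _ _ (by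
          rw [map_mul, map_mul, map_natCast, hb, hb, hb]; ring)
        rw [map_mul, map_mul, map_natCast] at h1
        field_simp
        rw [h1]
      map_zero' := by
        rw [← key 0 0 (by simp), map_zero, mul_zero]
      map_add' := fun x y => by
        rw [← key (x + y) (b x + b y) (by rw [map_add, hb, hb, mul_add]), map_add, mul_add] }
  refine ⟨ψ, RingHom.ext fun c => ?_⟩
  change (M : ZMod p)⁻¹ * φ (b (s c)) = φ c
  rw [← key (s c) (M * c) (by simp), map_mul, map_natCast, inv_mul_cancel_left₀ hM]

end RingHoms

section RootCounts

open Polynomial NumberField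

/-- The number of roots of `G` modulo `p`. -/
noncomputable def rootCount (G : ℤ[X]) (p : ℕ) : ℕ := Nat.card {x : ZMod p // aeval x G = 0}

/-- The number of square roots of `a` modulo `p`. -/
noncomputable def sqCount (a : ℤ) (p : ℕ) : ℕ := Nat.card {x : ZMod p // x ^ 2 = (a : ZMod p)}

theorem aeval_eq_zero_of_irreducible {K : Type*} [Field K] [CharZero K] {G : ℤ[X]}
    (hG : Irreducible (G.map (Int.castRingHom ℚ))) {x₀ : K} (hx₀ : aeval x₀ G = 0)
    {P : ℤ[X]} (hP : aeval x₀ P = 0) {p : ℕ} (hp : p.Prime) (hpG : ¬ (p : ℤ) ∣ G.content)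
    {x : ZMod p} (hx : aeval x G = 0) : aeval x P = 0 := by
  have := Fact.mk hp
  have hmap : ∀ Q : ℤ[X], aeval x₀ (Q.map (Int.castRingHom ℚ)) = aeval x₀ Q := fun Q => by
    rw [← algebraMap_int_eq, aeval_map_algebraMap]
  have hc : (G.content : ℤ) ≠ 0 := fun h => hpG (h ▸ dvd_zero _)
  have h1 : G.map (Int.castRingHom ℚ) ∣ P.map (Int.castRingHom ℚ) := by
    have h2 : minpoly ℚ x₀ ∣ P.map (Int.castRingHom ℚ) :=
      minpoly.dvd ℚ x₀ (by rw [hmap, hP])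
    rw [← minpoly.eq_of_irreducible hG (by rw [hmap, hx₀])] at h2
    exact (dvd_mul_right _ _).trans h2
  have h3 : G.primPart.map (Int.castRingHom ℚ) ∣ P.map (Int.castRingHom ℚ) := by
    refine dvd_trans ?_ h1
    conv_rhs => rw [eq_C_content_mul_primPart G, Polynomial.map_mul]
    exact dvd_mul_left _ _
  have h4 := (IsPrimitive.Int.dvd_iff_map_cast_dvd_map_cast _ P (isPrimitive_primPart G)).2 h3
  have h5 : aeval x G.primPart = 0 := by
    rw [eq_C_content_mul_primPart G, map_mul, aeval_C] at hx
    refine (mul_eq_zero.1 hx).resolve_left ?_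
    rwa [algebraMap_int_eq, eq_intCast, ZMod.intCast_zmod_eq_zero_iff_dvd]
  exact aeval_eq_zero_of_dvd_aeval_eq_zero h4 h5

theorem aeval_mul_eq_zero_of_irreducible {K : Type*} [Field K] [CharZero K] {G : ℤ[X]}
    (hG : Irreducible (G.map (Int.castRingHom ℚ))) {x₀ : K} (hx₀ : aeval x₀ G = 0) (m : ℤ)
    {P : ℤ[X]} (hP : aeval (m * x₀) P = 0) {p : ℕ} (hp : p.Prime) (hpG : ¬ (p : ℤ) ∣ G.content)
    {x : ZMod p} (hx : aeval x G = 0) : aeval (m * x) P = 0 := by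
  have h := aeval_eq_zero_of_irreducible hG hx₀ (P := P.comp (C m * X)) (by
    rw [aeval_comp]; simpa using hP) hp hpG hx
  rw [aeval_comp] at h
  simpa using h

theorem zmod_intCast_ne_zero {p : ℕ} {m : ℤ} (h : ¬ p ∣ m.natAbs) : (m : ZMod p) ≠ 0 := by
  rwa [Ne, ZMod.intCast_zmod_eq_zero_iff_dvd, Int.natCast_dvd]

theorem exists_integral_root {K : Type*} [Field K] {G : ℤ[X]} {x₀ : K} (hx₀ : aeval x₀ G = 0) :
    ∃ θ : 𝓞 K, (θ : K) = G.leadingCoeff * x₀ :=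
  ⟨⟨G.leadingCoeff • x₀, isIntegral_leadingCoeff_smul G x₀ hx₀⟩, zsmul_eq_mul _ _⟩

variable {K : Type*} [Field K] [NumberField K]

variable (K) in
theorem finite_ringHom_zmod {p : ℕ} (hp : p.Prime) : Finite (𝓞 K →+* ZMod p) := by
  by_contra h
  rw [not_finite_iff_infinite] at h
  have h1 := idealCount_eq_card_ringHom K hp
  rw [Nat.card_eq_zero_of_infinite, idealCount, Finite.card_eq_zero_iff] at h1
  obtain ⟨ψ⟩ : Nonempty (𝓞 K →+* ZMod p) := inferInstance
  refine h1.false ⟨RingHom.ker ψ, ?_⟩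
  have := Fact.mk hp
  rw [Ideal.absNorm_apply, Submodule.cardQuot_apply,
    Nat.card_congr (RingHom.quotientKerEquivOfSurjective (ringHom_zmod_surjective ψ)).toEquiv,
    Nat.card_zmod]

theorem exists_rootCount_le_idealCount {G : ℤ[X]}
    (hG : Irreducible (G.map (Int.castRingHom ℚ))) {x₀ : K} (hx₀ : aeval x₀ G = 0)
    (hgen : Algebra.adjoin ℚ {x₀} = ⊤) :
    ∃ N : ℕ, N ≠ 0 ∧ ∀ p : ℕ, p.Prime → ¬ p ∣ N →
      rootCount G p ≤ idealCount K p ∧ idealCount K p ≤ rootCount G p := by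
  have hG0 : G ≠ 0 := by rintro rfl; simp at hG
  have hm : G.leadingCoeff ≠ 0 := leadingCoeff_ne_zero.2 hG0
  obtain ⟨θ, hθ⟩ := exists_integral_root hx₀
  let s : ℤ[X] →+* 𝓞 K := (aeval θ : ℤ[X] →ₐ[ℤ] 𝓞 K).toRingHom
  have hsval : ∀ P, s P = aeval θ P := fun _ => rfl
  have hsK : ∀ P, ((s P : 𝓞 K) : K) = aeval ((G.leadingCoeff : K) * x₀) P := fun P => by
    rw [hsval, ← hθ]
    exact (aeval_algebraMap_apply K θ P).symm
  obtain ⟨M, hM, hMs⟩ := exists_uniform_denominator s (by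
    rw [eq_top_iff, ← hgen]
    refine Algebra.adjoin_le (Set.singleton_subset_iff.2 ?_)
    have h1 : (G.leadingCoeff : K) * x₀ ∈ Algebra.adjoin ℚ (Set.range fun b => (s b : K)) :=
      Algebra.subset_adjoin ⟨X, by simp [hsK]⟩
    have h2 := Subalgebra.smul_mem _ h1 ((G.leadingCoeff : ℚ)⁻¹)
    rwa [Algebra.smul_def, map_inv₀, map_intCast, inv_mul_cancel_left₀ (by exact_mod_cast hm)]
      at h2)
  refine ⟨M * G.leadingCoeff.natAbs * G.content.natAbs, ?_, fun p hp hpN => ?_⟩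
  · simp [hM, hm, content_eq_zero_iff, hG0]
  have := Fact.mk hp
  have hpM : ¬ p ∣ M := fun h => hpN (Dvd.dvd.mul_right (Dvd.dvd.mul_right h _) _)
  have hpm : ¬ p ∣ G.leadingCoeff.natAbs := fun h =>
    hpN (Dvd.dvd.mul_right (Dvd.dvd.mul_left h _) _)
  have hpc : ¬ (p : ℤ) ∣ G.content := fun h =>
    hpN (Dvd.dvd.mul_left (Int.natCast_dvd.1 h) _)
  have hm' := zmod_intCast_ne_zero hpm
  rw [idealCount_eq_card_ringHom K hp, rootCount]
  have hfin := finite_ringHom_zmod K hp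
  constructor
  · have hex : ∀ x : {x : ZMod p // aeval x G = 0}, ∃ ψ : 𝓞 K →+* ZMod p,
        ψ.comp s = (aeval ((G.leadingCoeff : ZMod p) * x.1) : ℤ[X] →ₐ[ℤ] ZMod p).toRingHom :=
      fun x => exists_ringHom_comp_eq hMs hp hpM _ fun b hb =>
        aeval_mul_eq_zero_of_irreducible hG hx₀ _ (by rw [← hsK, hb]; simp) hp hpc x.2
    choose ψ hψ using hex
    refine Nat.card_le_card_of_injective ψ fun x y hxy => Subtype.ext ?_
    have h1 := congrArg (fun φ : ℤ[X] →+* ZMod p => φ X) ((hψ x).symm.trans (hxy ▸ hψ y))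
    simpa [hm'] using h1
  · refine Nat.card_le_card_of_injective
      (fun ψ => ⟨(G.leadingCoeff : ZMod p)⁻¹ * ψ θ, ?_⟩) fun ψ ψ' h => ?_
    · have h1 : aeval θ (G.scaleRoots G.leadingCoeff) = 0 := by
        apply RingOfIntegers.ext
        have h2 := scaleRoots_aeval_eq_zero (r := G.leadingCoeff) hx₀
        rw [algebraMap_int_eq, eq_intCast, ← hθ] at h2
        exact ((aeval_algebraMap_apply K θ _).symm).trans (h2.trans (map_zero (algebraMap (𝓞 K) K)).symm)
      have h3 : aeval (ψ θ) (G.scaleRoots G.leadingCoeff) = 0 := by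
        have h4 := congrArg ψ h1
        rw [map_zero] at h4
        rw [← h4]
        exact aeval_algHom_apply ψ.toIntAlgHom θ _
      have h5 := scaleRoots_eval₂_mul (p := G) (algebraMap ℤ (ZMod p))
        ((G.leadingCoeff : ZMod p)⁻¹ * ψ θ) G.leadingCoeff
      rw [algebraMap_int_eq, eq_intCast, mul_inv_cancel_left₀ hm'] at h5
      rw [aeval_def] at h3 ⊢
      rw [algebraMap_int_eq] at h3 ⊢
      rw [h3] at h5
      exact (mul_eq_zero.1 h5.symm).resolve_left (pow_ne_zero _ hm')
    · have h1 : ψ θ = ψ' θ := mul_left_cancel₀ (inv_ne_zero hm') (congrArg Subtype.val h)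
      refine ringHom_comp_injective hMs hp hpM (Polynomial.ringHom_ext (fun n => ?_) ?_)
      · simp
      · simpa [hsval] using h1

theorem exists_sqCount_mul_rootCount_le {G : ℤ[X]} {a : ℤ}
    (hG : Irreducible (G.map (Int.castRingHom ℚ))) {x₀ α : K} (hx₀ : aeval x₀ G = 0)
    (hα : α ^ 2 = a)
    (hind : ∀ A B : ℤ[X], aeval (G.leadingCoeff * x₀) A + aeval (G.leadingCoeff * x₀) B * α = 0 →
      aeval (G.leadingCoeff * x₀) A = 0 ∧ aeval (G.leadingCoeff * x₀) B = 0)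
    (hgen : Algebra.adjoin ℚ {x₀, α} = ⊤) :
    ∃ N : ℕ, N ≠ 0 ∧ ∀ p : ℕ, p.Prime → ¬ p ∣ N →
      sqCount a p * rootCount G p ≤ idealCount K p := by
  have hG0 : G ≠ 0 := by rintro rfl; simp at hG
  have hm : G.leadingCoeff ≠ 0 := leadingCoeff_ne_zero.2 hG0
  obtain ⟨θ, hθ⟩ := exists_integral_root hx₀
  have hαint : IsIntegral ℤ α := by
    refine ⟨X ^ 2 - C a, monic_X_pow_sub_C a two_ne_zero, ?_⟩
    rw [eval₂_sub, eval₂_pow, eval₂_X, eval₂_C, hα, algebraMap_int_eq, eq_intCast, sub_self]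
  obtain ⟨β, hβα⟩ : ∃ β : 𝓞 K, (β : K) = α := ⟨⟨α, hαint⟩, rfl⟩
  let s : ℤ[X][X] →+* 𝓞 K := eval₂RingHom (aeval θ : ℤ[X] →ₐ[ℤ] 𝓞 K).toRingHom β
  have hsC : ∀ P : ℤ[X], ((s (C P) : 𝓞 K) : K) = aeval ((G.leadingCoeff : K) * x₀) P := fun P => by
    have h1 : s (C P) = aeval θ P := eval₂_C _ _
    rw [h1, ← hθ]
    exact (aeval_algebraMap_apply K θ P).symm
  have hsX : s X = β := eval₂_X _ _
  have hβ : β ^ 2 = a := RingOfIntegers.ext (by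
    change algebraMap (𝓞 K) K (β ^ 2) = algebraMap (𝓞 K) K a
    rw [map_pow, map_intCast, ← hα, ← hβα])
  obtain ⟨M, hM, hMs⟩ := exists_uniform_denominator s (by
    rw [eq_top_iff, ← hgen]
    refine Algebra.adjoin_le (Set.insert_subset_iff.2 ⟨?_, Set.singleton_subset_iff.2 ?_⟩)
    · have h1 : (G.leadingCoeff : K) * x₀ ∈ Algebra.adjoin ℚ (Set.range fun b => (s b : K)) :=
        Algebra.subset_adjoin ⟨C X, by simp [hsC]⟩
      have h2 := Subalgebra.smul_mem _ h1 ((G.leadingCoeff : ℚ)⁻¹)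
      rwa [Algebra.smul_def, map_inv₀, map_intCast, inv_mul_cancel_left₀ (by exact_mod_cast hm)]
        at h2
    · exact Algebra.subset_adjoin ⟨X, by simp [hsX, hβα]⟩)
  refine ⟨M * G.leadingCoeff.natAbs * G.content.natAbs, ?_, fun p hp hpN => ?_⟩
  · simp [hM, hm, content_eq_zero_iff, hG0]
  have := Fact.mk hp
  have hpM : ¬ p ∣ M := fun h => hpN (Dvd.dvd.mul_right (Dvd.dvd.mul_right h _) _)
  have hpm : ¬ p ∣ G.leadingCoeff.natAbs := fun h =>
    hpN (Dvd.dvd.mul_right (Dvd.dvd.mul_left h _) _)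
  have hpc : ¬ (p : ℤ) ∣ G.content := fun h =>
    hpN (Dvd.dvd.mul_left (Int.natCast_dvd.1 h) _)
  have hm' := zmod_intCast_ne_zero hpm
  rw [idealCount_eq_card_ringHom K hp, rootCount, sqCount, ← Nat.card_prod]
  have hfin := finite_ringHom_zmod K hp
  have hex : ∀ x : {x : ZMod p // x ^ 2 = (a : ZMod p)} × {x : ZMod p // aeval x G = 0},
      ∃ ψ : 𝓞 K →+* ZMod p, ψ.comp s = eval₂RingHom
        (aeval ((G.leadingCoeff : ZMod p) * x.2.1) : ℤ[X] →ₐ[ℤ] ZMod p).toRingHom x.1.1 := by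
    refine fun x => exists_ringHom_comp_eq hMs hp hpM _ fun b hb => ?_
    set φ := eval₂RingHom
        (aeval ((G.leadingCoeff : ZMod p) * x.2.1) : ℤ[X] →ₐ[ℤ] ZMod p).toRingHom x.1.1 with hφ
    have hmon : (X ^ 2 - C (C a) : ℤ[X][X]).Monic := monic_X_pow_sub_C _ two_ne_zero
    have hdeg : (b %ₘ (X ^ 2 - C (C a))).natDegree ≤ 1 := by
      have h1 := natDegree_modByMonic_lt b hmon (by
        intro h
        have h2 := congrArg natDegree h
        rw [natDegree_X_pow_sub_C] at h2
        simp at h2)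
      rw [natDegree_X_pow_sub_C] at h1
      omega
    obtain ⟨B, A, hAB⟩ := exists_eq_X_add_C_of_natDegree_le_one hdeg
    have hb' := modByMonic_add_div b (X ^ 2 - C (C a))
    rw [hAB] at hb'
    have h1 : s (X ^ 2 - C (C a)) = 0 := by
      rw [map_sub, map_pow, hsX, hβ, sub_eq_zero]
      simp [s]
    have h2 : φ (X ^ 2 - C (C a)) = 0 := by
      rw [map_sub, map_pow, hφ, coe_eval₂RingHom, eval₂_X, eval₂_C, x.1.2]
      simp
    have h3 : s b = s (C B) * β + s (C A) := by
      rw [← hb', map_add, map_mul, h1, zero_mul, add_zero, map_add, map_mul, hsX]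
    have h4 : φ b = φ (C B) * x.1.1 + φ (C A) := by
      rw [← hb', map_add, map_mul, h2, zero_mul, add_zero, map_add, map_mul]
      simp [φ]
    have h5 := congrArg (algebraMap (𝓞 K) K) (h3.symm.trans hb)
    rw [map_add, map_mul, map_zero, add_comm] at h5
    change ((s (C A) : 𝓞 K) : K) + ((s (C B) : 𝓞 K) : K) * β = 0 at h5
    rw [hsC, hsC, hβα] at h5
    obtain ⟨h6, h7⟩ := hind A B h5
    have h8 := aeval_mul_eq_zero_of_irreducible hG hx₀ _ h6 hp hpc x.2.2
    have h9 := aeval_mul_eq_zero_of_irreducible hG hx₀ _ h7 hp hpc x.2.2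
    rw [h4]
    simp [φ, h8, h9]
  choose ψ hψ using hex
  refine Nat.card_le_card_of_injective ψ fun x y hxy => ?_
  have h0 := (hψ x).symm.trans (hxy ▸ hψ y)
  have h1 := congrArg (fun φ : ℤ[X][X] →+* ZMod p => φ X) h0
  have h2 := congrArg (fun φ : ℤ[X][X] →+* ZMod p => φ (C X)) h0
  refine Prod.ext (Subtype.ext ?_) (Subtype.ext ?_)
  · simpa using h1
  · simpa [hm'] using h2

end RootCounts

section PrimeSums

open Polynomial NumberField

theorem exists_sum_primesLE_le {b b' : ℕ → ℝ} {N : ℕ} (hN : N ≠ 0)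
    (h : ∀ p : ℕ, p.Prime → ¬ p ∣ N → b p ≤ b' p) :
    ∃ C : ℝ, ∀ Y : ℕ, ∑ p ∈ Y.primesLE, b p ≤ ∑ p ∈ Y.primesLE, b' p + C := by
  refine ⟨∑ p ∈ N.primeFactors, |b p - b' p|, fun Y => ?_⟩
  rw [← sub_le_iff_le_add', ← Finset.sum_sub_distrib]
  calc ∑ p ∈ Y.primesLE, (b p - b' p)
      ≤ ∑ p ∈ Y.primesLE, if p ∣ N then |b p - b' p| else 0 := by
        refine Finset.sum_le_sum fun p hp => ?_
        split_ifs with hpN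
        · exact le_abs_self _
        · exact sub_nonpos.2 (h p (Nat.mem_primesLE.1 hp).2 hpN)
    _ = ∑ p ∈ Y.primesLE with p ∣ N, |b p - b' p| := (Finset.sum_filter _ _).symm
    _ ≤ _ := by
        refine Finset.sum_le_sum_of_subset_of_nonneg (fun p hp => ?_) fun _ _ _ => abs_nonneg _
        rw [Finset.mem_filter, Nat.mem_primesLE] at hp
        exact Nat.mem_primeFactors.2 ⟨hp.1.2, hp.2, hN⟩

theorem card_sq_eq_le {R : Type*} [CommRing R] [IsDomain R] (a : R) :
    Nat.card {x : R // x ^ 2 = a} ≤ 2 := by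
  by_cases h : ∃ b : R, b ^ 2 = a
  · obtain ⟨b, hb⟩ := h
    calc Nat.card {x : R // x ^ 2 = a} = Set.ncard {x : R | x ^ 2 = a} := rfl
      _ ≤ Set.ncard {b, -b} := Set.ncard_le_ncard (fun x hx => by
          rw [Set.mem_ofPred_eq, ← hb, sq_eq_sq_iff_eq_or_eq_neg] at hx
          exact hx) (Set.toFinite _)
      _ ≤ 2 := (Set.ncard_insert_le b {-b}).trans (by simp)
  · have : IsEmpty {x : R // x ^ 2 = a} := ⟨fun x => h ⟨x.1, x.2⟩⟩
    simp

theorem sqCount_le_two (a : ℤ) {p : ℕ} (hp : p.Prime) : sqCount a p ≤ 2 := by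
  have := Fact.mk hp
  exact card_sq_eq_le _

theorem finiteDimensional_rat_congr {K : Type*} [Field K] (i j : Algebra ℚ K)
    (h : @FiniteDimensional ℚ K _ _ i.toModule) : @FiniteDimensional ℚ K _ _ j.toModule := by
  obtain rfl := Subsingleton.elim i j
  exact h

theorem adjoin_rat_congr {K : Type*} [Field K] (i j : Algebra ℚ K) {s : Set K}
    (h : @Algebra.adjoin ℚ K _ _ i s = ⊤) : @Algebra.adjoin ℚ K _ _ j s = ⊤ := by
  obtain rfl := Subsingleton.elim i j
  exact h

variable {K : Type*} [Field K] [NumberField K]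

theorem exists_sum_sqCount_le_loglog (a : ℤ) {G : ℤ[X]}
    (hG : Irreducible (G.map (Int.castRingHom ℚ))) {x₀ : K} (hx₀ : aeval x₀ G = 0)
    (hgen : Algebra.adjoin ℚ {x₀} = ⊤) :
    ∃ C : ℝ, ∀ Y : ℕ, 2 ≤ Y →
      ∑ p ∈ Y.primesLE, ((sqCount a p : ℝ) - 1) * rootCount G p / p ≤
        Real.log (Real.log Y) + C := by
  obtain ⟨N, hN, h⟩ := exists_rootCount_le_idealCount hG hx₀ hgen
  obtain ⟨C₁, h₁⟩ := exists_sum_primesLE_le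
    (b := fun p => ((sqCount a p : ℝ) - 1) * rootCount G p / p)
    (b' := fun p => (idealCount K p : ℝ) / p) hN (fun p hp hpN => by
      have h1 : (sqCount a p : ℝ) ≤ 2 := by exact_mod_cast sqCount_le_two a hp
      have h2 : (rootCount G p : ℝ) ≤ idealCount K p := by exact_mod_cast (h p hp hpN).1
      have h3 : (0 : ℝ) ≤ rootCount G p := Nat.cast_nonneg _
      have : ((sqCount a p : ℝ) - 1) * rootCount G p ≤ idealCount K p := by nlinarith
      gcongr)
  obtain ⟨C₂, h₂⟩ := sum_idealCount_le K
  exact ⟨C₁ + C₂, fun Y hY => by linarith [h₁ Y, h₂ Y hY]⟩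

theorem exists_sum_sqCount_le_const {L : Type*} [Field L] [NumberField L] [Algebra K L]
    {a : ℤ} {G : ℤ[X]}
    (hG : Irreducible (G.map (Int.castRingHom ℚ))) {x₀ : K} (hx₀ : aeval x₀ G = 0)
    (hgen : Algebra.adjoin ℚ {x₀} = ⊤) {α : L} (hα : α ^ 2 = a)
    (hind : ∀ x y : K, algebraMap K L x + algebraMap K L y * α = 0 → x = 0 ∧ y = 0)
    (hgenL : Algebra.adjoin ℚ {algebraMap K L x₀, α} = ⊤) :
    ∃ C : ℝ, ∀ Y : ℕ, 2 ≤ Y →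
      ∑ p ∈ Y.primesLE, ((sqCount a p : ℝ) - 1) * rootCount G p / p ≤ C := by
  obtain ⟨N, hN, h⟩ := exists_rootCount_le_idealCount hG hx₀ hgen
  have hcoe : ∀ P : ℤ[X], aeval ((G.leadingCoeff : L) * algebraMap K L x₀) P =
      algebraMap K L (aeval ((G.leadingCoeff : K) * x₀) P) := fun P => by
    rw [← aeval_algebraMap_apply, map_mul, map_intCast]
  obtain ⟨N', hN', h'⟩ := exists_sqCount_mul_rootCount_le (a := a) hG
    (x₀ := algebraMap K L x₀) (by rw [aeval_algebraMap_apply, hx₀, map_zero]) hα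
    (fun A B hAB => by
      rw [hcoe, hcoe] at hAB ⊢
      obtain ⟨h1, h2⟩ := hind _ _ hAB
      rw [h1, h2, map_zero]; exact ⟨rfl, rfl⟩) hgenL
  obtain ⟨C₁, h₁⟩ := exists_sum_primesLE_le
    (b := fun p => ((sqCount a p : ℝ) - 1) * rootCount G p / p)
    (b' := fun p => (idealCount L p : ℝ) / p - (idealCount K p : ℝ) / p)
    (mul_ne_zero hN hN') (fun p hp hpN => by
      have h1 : (sqCount a p : ℝ) * rootCount G p ≤ idealCount L p := by
        exact_mod_cast h' p hp fun h => hpN (Dvd.dvd.mul_left h _)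
      have h2 : (idealCount K p : ℝ) ≤ rootCount G p := by
        exact_mod_cast (h p hp fun h => hpN (Dvd.dvd.mul_right h _)).2
      rw [← sub_div]
      gcongr
      linarith)
  obtain ⟨C₂, h₂⟩ := sum_idealCount_le L
  obtain ⟨C₃, h₃⟩ := le_sum_idealCount K
  refine ⟨C₁ + C₂ + C₃, fun Y hY => ?_⟩
  have h4 := h₁ Y
  rw [Finset.sum_sub_distrib] at h4
  linarith [h₂ Y hY, h₃ Y hY]

theorem exists_sum_sqCount_le_const_of_not_isSquare {a : ℤ} {G : ℤ[X]}
    (hG : Irreducible (G.map (Int.castRingHom ℚ))) {x₀ : K} (hx₀ : aeval x₀ G = 0)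
    (hgen : Algebra.adjoin ℚ {x₀} = ⊤) (ha : ¬ IsSquare (a : K)) :
    ∃ C : ℝ, ∀ Y : ℕ, 2 ≤ Y →
      ∑ p ∈ Y.primesLE, ((sqCount a p : ℝ) - 1) * rootCount G p / p ≤ C := by
  have hirr : Irreducible (X ^ 2 - C (a : K)) :=
    X_pow_sub_C_irreducible_of_prime Nat.prime_two fun b hb => ha ⟨b, by rw [← hb, sq]⟩
  have := Fact.mk hirr
  let L := AdjoinRoot (X ^ 2 - C (a : K))
  have : Module.Finite K L := (AdjoinRoot.powerBasis hirr.ne_zero).finite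
  have : CharZero L := charZero_of_injective_algebraMap (algebraMap K L).injective
  have : NumberField L := NumberField.of_module_finite K L
  let α : L := AdjoinRoot.root _
  have hα : α ^ 2 = a := by
    have h := AdjoinRoot.eval₂_root (X ^ 2 - C (a : K))
    rw [eval₂_sub, eval₂_pow, eval₂_X, eval₂_C, sub_eq_zero] at h
    exact h.trans (map_intCast (AdjoinRoot.of _) a)
  refine exists_sum_sqCount_le_const (L := L) hG hx₀ hgen hα (fun x y h => ?_) ?_
  · have h1 : AdjoinRoot.mk (X ^ 2 - C (a : K)) (C x + C y * X) = 0 := by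
      rw [map_add, map_mul, AdjoinRoot.mk_X]; exact h
    rw [AdjoinRoot.mk_eq_zero] at h1
    have h2 : C x + C y * X = 0 := by
      refine eq_zero_of_dvd_of_degree_lt h1 ?_
      rw [degree_X_pow_sub_C two_pos, add_comm]
      exact lt_of_le_of_lt degree_linear_le (by norm_num)
    have h3 := congrArg (fun P => coeff P 0) h2
    have h4 := congrArg (fun P => coeff P 1) h2
    simp at h3 h4
    exact ⟨h3, h4⟩
  · have hK : ∀ x : K, algebraMap K L x ∈ Algebra.adjoin ℚ {algebraMap K L x₀, α} := fun x => by
      have hx : x ∈ Algebra.adjoin ℚ {x₀} := by rw [hgen]; trivial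
      induction hx using Algebra.adjoin_induction with
      | mem x hx =>
        rw [Set.mem_singleton_iff.1 hx]
        exact Algebra.subset_adjoin (by simp)
      | algebraMap r =>
        rw [← IsScalarTower.algebraMap_apply ℚ K L]
        exact Subalgebra.algebraMap_mem _ r
      | add x y _ _ hx hy => rw [map_add]; exact add_mem hx hy
      | mul x y _ _ hx hy => rw [map_mul]; exact mul_mem hx hy
    rw [eq_top_iff]
    rintro z -
    induction z using AdjoinRoot.induction_on with
    | ih P =>
      induction P using Polynomial.induction_on with
      | C x => exact hK x
      | add P Q hP hQ => rw [map_add]; exact add_mem hP hQ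
      | monomial n x _ =>
        rw [map_mul, map_pow, AdjoinRoot.mk_X]
        exact mul_mem (hK x) (pow_mem (Algebra.subset_adjoin (by simp [α])) _)

theorem exists_sum_sqCount_mul_rootCount_le (a : ℤ) {G : ℤ[X]} {g : ℚ[X]} (hg : Irreducible g)
    {c : ℚ} (hc : c ≠ 0) (hG : G.map (Int.castRingHom ℚ) = C c * g) :
    ∃ C : ℝ, ∀ Y : ℕ, 2 ≤ Y →
      ∑ p ∈ Y.primesLE, ((sqCount a p : ℝ) - 1) * rootCount G p / p ≤
        (open Classical in if IsSquare (a : AdjoinRoot g) then 1 else 0) * Real.log (Real.log Y)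
          + C := by
  have := Fact.mk hg
  have hu : IsUnit (C c : ℚ[X]) := isUnit_C.2 (isUnit_iff_ne_zero.2 hc)
  have hirr : Irreducible (G.map (Int.castRingHom ℚ)) := by
    rw [hG]
    exact (irreducible_isUnit_mul hu).2 hg
  have : CharZero (AdjoinRoot g) :=
    charZero_of_injective_algebraMap (algebraMap ℚ (AdjoinRoot g)).injective
  have hfin : FiniteDimensional ℚ (AdjoinRoot g) := (AdjoinRoot.powerBasis hg.ne_zero).finite
  have : NumberField (AdjoinRoot g) := 
    { to_charZero := inferInstance
      to_finiteDimensional := finiteDimensional_rat_congr _ _ hfin }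
  have hroot : aeval (AdjoinRoot.root g) G = 0 := by
    have h1 : aeval (AdjoinRoot.root g) (G.map (Int.castRingHom ℚ)) = 0 := by
      rw [hG, map_mul]
      have h2 := AdjoinRoot.eval₂_root g
      rw [aeval_def, aeval_def]
      rw [show algebraMap ℚ (AdjoinRoot g) = AdjoinRoot.of g from Subsingleton.elim _ _, h2,
        mul_zero]
    rwa [← algebraMap_int_eq, aeval_map_algebraMap] at h1
  have hgen : Algebra.adjoin ℚ {AdjoinRoot.root g} = ⊤ := by
    exact adjoin_rat_congr _ _ (AdjoinRoot.adjoinRoot_eq_top (f := g))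
  split_ifs with h
  · simpa using exists_sum_sqCount_le_loglog a hirr hroot hgen
  · simpa using exists_sum_sqCount_le_const_of_not_isSquare hirr hroot hgen h

end PrimeSums

section PeriodicMeans

theorem sum_range_add_of_periodic {n : ℕ} {f : ℤ → ℝ} (hf : Function.Periodic f n) (b : ℤ) :
    ∑ i ∈ Finset.range n, f (b + i) = ∑ i ∈ Finset.range n, f i := by
  have hstep : ∀ b : ℤ,
      ∑ i ∈ Finset.range n, f (b + 1 + i) = ∑ i ∈ Finset.range n, f (b + i) := fun b => by
    have h1 := Finset.sum_range_succ (fun i : ℕ => f (b + i)) n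
    rw [Finset.sum_range_succ', hf b, Nat.cast_zero, add_zero] at h1
    refine (Finset.sum_congr rfl fun i _ => ?_).trans (add_right_cancel h1)
    rw [Nat.cast_add_one]; congr 1; ring
  induction b using Int.induction_on with
  | zero => simp
  | succ k ih => rw [hstep, ih]
  | pred k ih => rw [← ih, ← hstep, sub_add_cancel]

theorem abs_sum_range_sub_le {n : ℕ} (hn : n ≠ 0) {f : ℤ → ℝ} (hf : Function.Periodic f n)
    (hb : ∀ x, |f x| ≤ 1) (L : ℕ) (b : ℤ) :
    |∑ i ∈ Finset.range L, f (b + i) - L * ((∑ i ∈ Finset.range n, f i) / n)| ≤ 2 * n := by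
  have hn' : (0 : ℝ) < n := by positivity
  have hm : |(∑ i ∈ Finset.range n, f i) / n| ≤ 1 := by
    rw [abs_div, Nat.abs_cast, div_le_one hn']
    calc _ ≤ ∑ i ∈ Finset.range n, |f i| := Finset.abs_sum_le_sum_abs _ _
      _ ≤ ∑ i ∈ Finset.range n, 1 := Finset.sum_le_sum fun i _ => hb i
      _ = n := by simp
  induction L using Nat.strong_induction_on generalizing b with
  | _ L ih =>
    rcases lt_or_ge L n with h | h
    · have hL : (L : ℝ) ≤ n := by exact_mod_cast h.le
      have h1 : |∑ i ∈ Finset.range L, f (b + i)| ≤ L :=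
        calc _ ≤ ∑ i ∈ Finset.range L, |f (b + i)| := Finset.abs_sum_le_sum_abs _ _
          _ ≤ ∑ i ∈ Finset.range L, 1 := Finset.sum_le_sum fun i _ => hb _
          _ = L := by simp
      have h2 : |(L : ℝ) * ((∑ i ∈ Finset.range n, f i) / n)| ≤ L := by
        rw [abs_mul, Nat.abs_cast]
        exact mul_le_of_le_one_right (Nat.cast_nonneg _) hm
      linarith [abs_sub (∑ i ∈ Finset.range L, f (b + i))
        ((L : ℝ) * ((∑ i ∈ Finset.range n, f i) / n))]
    · obtain ⟨k, rfl⟩ := Nat.exists_eq_add_of_le h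
      have h1 := ih k (by omega) (b + n)
      rw [Finset.sum_range_add, sum_range_add_of_periodic hf]
      have h2 : ∑ x ∈ Finset.range k, f (b + ((n + x : ℕ) : ℤ)) =
          ∑ x ∈ Finset.range k, f (b + n + x) :=
        Finset.sum_congr rfl fun x _ => by push_cast; rw [add_assoc]
      rw [h2]
      convert h1 using 2
      push_cast
      field_simp
      ring

theorem sum_range_mul_of_coprime {m n : ℕ} (hm : m ≠ 0) (hn : n ≠ 0) (h : m.Coprime n)
    {f g : ℤ → ℝ} (hf : Function.Periodic f m) (hg : Function.Periodic g n) :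
    ∑ i ∈ Finset.range (m * n), f i * g i =
      (∑ i ∈ Finset.range m, f i) * ∑ j ∈ Finset.range n, g j := by
  rw [Finset.sum_mul_sum, ← Finset.sum_product']
  have hfm : ∀ i : ℕ, f ((i % m : ℕ) : ℤ) = f i := fun i => by
    have h1 := hf.int_mul (i / m : ℕ) ((i % m : ℕ) : ℤ)
    rw [← h1]; congr 1
    have := Nat.mod_add_div i m
    push_cast at this ⊢
    have h2 : (i : ℤ) % m + m * (i / m) = i := Int.emod_add_mul_ediv _ _
    linarith
  have hgn : ∀ i : ℕ, g ((i % n : ℕ) : ℤ) = g i := fun i => by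
    have h1 := hg.int_mul (i / n : ℕ) ((i % n : ℕ) : ℤ)
    rw [← h1]; congr 1
    push_cast
    have h2 : (i : ℤ) % n + n * (i / n) = i := Int.emod_add_mul_ediv _ _
    linarith
  refine Finset.sum_nbij (fun i => (i % m, i % n)) ?_ ?_ ?_ ?_
  · intro i _
    simp [Nat.mod_lt _ (Nat.pos_of_ne_zero hm), Nat.mod_lt _ (Nat.pos_of_ne_zero hn)]
  · intro i hi j hj hij
    simp only [Finset.coe_range, Set.mem_Iio, Prod.mk.injEq] at hi hj hij
    exact ((Nat.modEq_and_modEq_iff_modEq_mul h).1 hij).eq_of_lt_of_lt hi hj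
  · rintro ⟨x, y⟩ hxy
    simp only [Finset.coe_product, Finset.coe_range, Set.mem_prod, Set.mem_Iio] at hxy
    obtain ⟨k, hk1, hk2⟩ := Nat.chineseRemainder h x y
    refine ⟨k % (m * n), ?_, ?_⟩
    · simp [Nat.mod_lt _ (Nat.pos_of_ne_zero (mul_ne_zero hm hn))]
    · simp only [Prod.mk.injEq, Nat.mod_mul_right_mod, Nat.mod_mul_left_mod]
      exact ⟨Eq.trans hk1 (Nat.mod_eq_of_lt hxy.1),
        Eq.trans hk2 (Nat.mod_eq_of_lt hxy.2)⟩
  · intro i _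
    simp only [hfm, hgn]

/-- Functions on `ℤ²` that are `n`-periodic in each variable. -/
def PeriodicTwo (n : ℕ) (f : ℤ → ℤ → ℝ) : Prop :=
  ∀ u v, f (u + n) v = f u v ∧ f u (v + n) = f u v

/-- The mean over one period of an `n`-periodic function on `ℤ²`. -/
noncomputable def meanTwo (n : ℕ) (f : ℤ → ℤ → ℝ) : ℝ :=
  (∑ i ∈ Finset.range n, ∑ j ∈ Finset.range n, f i j) / (n : ℝ) ^ 2

theorem PeriodicTwo.left {n : ℕ} {f : ℤ → ℤ → ℝ} (hf : PeriodicTwo n f) (v : ℤ) :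
    Function.Periodic (fun u => f u v) n := fun u => (hf u v).1

theorem PeriodicTwo.right {n : ℕ} {f : ℤ → ℤ → ℝ} (hf : PeriodicTwo n f) (u : ℤ) :
    Function.Periodic (f u) n := fun v => (hf u v).2

theorem PeriodicTwo.mul_left {n : ℕ} {f : ℤ → ℤ → ℝ} (hf : PeriodicTwo n f) (m : ℕ) :
    PeriodicTwo (m * n) f := fun u v => by
  push_cast
  exact ⟨(hf.left v).int_mul m u, (hf.right u).int_mul m v⟩

theorem PeriodicTwo.mul_right {n : ℕ} {f : ℤ → ℤ → ℝ} (hf : PeriodicTwo n f) (m : ℕ) :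
    PeriodicTwo (n * m) f := by
  rw [mul_comm]; exact hf.mul_left m

theorem PeriodicTwo.mul {n : ℕ} {f g : ℤ → ℤ → ℝ} (hf : PeriodicTwo n f)
    (hg : PeriodicTwo n g) : PeriodicTwo n fun u v => f u v * g u v := fun u v => by
  simp only [(hf u v).1, (hf u v).2, (hg u v).1, (hg u v).2, and_self]

theorem meanTwo_mul_of_coprime {m n : ℕ} (hm : m ≠ 0) (hn : n ≠ 0) (h : m.Coprime n)
    {f g : ℤ → ℤ → ℝ} (hf : PeriodicTwo m f) (hg : PeriodicTwo n g) :
    meanTwo (m * n) (fun u v => f u v * g u v) = meanTwo m f * meanTwo n g := by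
  have h1 : ∑ i ∈ Finset.range (m * n), ∑ j ∈ Finset.range (m * n), f i j * g i j =
      (∑ i ∈ Finset.range m, ∑ j ∈ Finset.range m, f i j) *
        ∑ i ∈ Finset.range n, ∑ j ∈ Finset.range n, g i j := by
    rw [Finset.sum_congr rfl fun (i : ℕ) _ =>
      sum_range_mul_of_coprime hm hn h (hf.right i) (hg.right i)]
    refine sum_range_mul_of_coprime hm hn h (f := fun u => ∑ j ∈ Finset.range m, f u j)
      (g := fun u => ∑ j ∈ Finset.range n, g u j) (fun u => ?_) (fun u => ?_)
    · exact Finset.sum_congr rfl fun j _ => (hf u j).1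
    · exact Finset.sum_congr rfl fun j _ => (hg u j).1
  rw [meanTwo, meanTwo, meanTwo, h1]
  push_cast
  rw [mul_pow, div_mul_div_comm]

theorem meanTwo_mul_prod {ι : Type*} {m : ℕ} (hm : m ≠ 0) {f : ℤ → ℤ → ℝ} (hf : PeriodicTwo m f)
    (T : Finset ι) (n : ι → ℕ) (hn : ∀ i ∈ T, n i ≠ 0)
    (hcop : (T : Set ι).Pairwise fun i j => (n i).Coprime (n j))
    (hm' : ∀ i ∈ T, m.Coprime (n i)) (χ : ι → ℤ → ℤ → ℝ) (hχ : ∀ i ∈ T, PeriodicTwo (n i) (χ i)) :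
    PeriodicTwo (m * ∏ i ∈ T, n i) (fun u v => f u v * ∏ i ∈ T, χ i u v) ∧
    meanTwo (m * ∏ i ∈ T, n i) (fun u v => f u v * ∏ i ∈ T, χ i u v) =
      meanTwo m f * ∏ i ∈ T, meanTwo (n i) (χ i) := by
  classical
  induction T using Finset.induction_on with
  | empty => simpa using hf
  | insert i T hi ih =>
    obtain ⟨h1, h2⟩ := ih (fun j hj => hn j (Finset.mem_insert_of_mem hj))
      (hcop.mono (by simp)) (fun j hj => hm' j (Finset.mem_insert_of_mem hj))
      (fun j hj => hχ j (Finset.mem_insert_of_mem hj))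
    have hi' := Finset.mem_insert_self i T
    have e : ∀ u v, f u v * ∏ j ∈ insert i T, χ j u v = (f u v * ∏ j ∈ T, χ j u v) * χ i u v :=
      fun u v => by rw [Finset.prod_insert hi]; ring
    have e' : m * ∏ j ∈ insert i T, n j = (m * ∏ j ∈ T, n j) * n i := by
      rw [Finset.prod_insert hi]; ring
    have hc : (m * ∏ j ∈ T, n j).Coprime (n i) := by
      refine Nat.Coprime.mul_left (hm' i hi') (Nat.Coprime.prod_left fun j hj => ?_)
      refine hcop (Finset.mem_insert_of_mem hj) hi' ?_
      rintro rfl; exact hi hj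
    have hne : m * ∏ j ∈ T, n j ≠ 0 :=
      mul_ne_zero hm (Finset.prod_ne_zero_iff.2 fun j hj => hn j (Finset.mem_insert_of_mem hj))
    simp only [e, e']
    refine ⟨(h1.mul_right _).mul ((hχ i hi').mul_left _), ?_⟩
    rw [meanTwo_mul_of_coprime hne (hn i hi') hc h1 (hχ i hi'), h2, Finset.prod_insert hi]
    ring

theorem abs_sum_box_sub_le {n : ℕ} (hn : n ≠ 0) {f : ℤ → ℤ → ℝ} (hf : PeriodicTwo n f)
    (hb : ∀ u v, |f u v| ≤ 1) (L : ℕ) (b : ℤ) :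
    |∑ i ∈ Finset.range L, ∑ j ∈ Finset.range L, f (b + i) (b + j) - (L : ℝ) ^ 2 * meanTwo n f| ≤
      4 * L * n := by
  have hn' : (0 : ℝ) < n := by positivity
  let m : ℤ → ℝ := fun u => (∑ j ∈ Finset.range n, f u j) / n
  have hmp : Function.Periodic m n := fun u => by
    simp only [m, (hf u _).1]
  have hmb : ∀ u, |m u| ≤ 1 := fun u => by
    rw [abs_div, Nat.abs_cast, div_le_one hn']
    calc _ ≤ ∑ j ∈ Finset.range n, |f u j| := Finset.abs_sum_le_sum_abs _ _
      _ ≤ ∑ j ∈ Finset.range n, 1 := Finset.sum_le_sum fun j _ => hb _ _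
      _ = n := by simp
  have h1 : ∀ u, |∑ j ∈ Finset.range L, f u (b + j) - L * m u| ≤ 2 * n := fun u =>
    abs_sum_range_sub_le hn (hf.right u) (hb u) L b
  have h2 := abs_sum_range_sub_le hn hmp hmb L b
  have h3 : (∑ i ∈ Finset.range n, m i) / n = meanTwo n f := by
    rw [meanTwo, ← Finset.sum_div, div_div, sq]
  rw [h3] at h2
  have h4 : |∑ i ∈ Finset.range L, (∑ j ∈ Finset.range L, f (b + i) (b + j) - L * m (b + i))| ≤
      L * (2 * n) :=
    calc _ ≤ ∑ i ∈ Finset.range L, |∑ j ∈ Finset.range L, f (b + i) (b + j) - L * m (b + i)| :=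
          Finset.abs_sum_le_sum_abs _ _
      _ ≤ ∑ i ∈ Finset.range L, (2 * n : ℝ) := Finset.sum_le_sum fun i _ => h1 _
      _ = L * (2 * n) := by simp
  rw [Finset.sum_sub_distrib, ← Finset.mul_sum] at h4
  have h5 : |(L : ℝ) * (∑ i ∈ Finset.range L, m (b + i) - L * meanTwo n f)| ≤ L * (2 * n) := by
    rw [abs_mul, Nat.abs_cast]
    exact mul_le_mul_of_nonneg_left h2 (Nat.cast_nonneg _)
  rw [abs_le] at h4 h5 ⊢
  constructor <;> nlinarith [h4.1, h4.2, h5.1, h5.2]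

end PeriodicMeans

section Sieve

theorem card_filter_prod_primes_le {P : Finset ℕ} (hP : ∀ p ∈ P, p.Prime) (D : ℕ) :
    (P.powerset.filter fun S => ∏ p ∈ S, p ≤ D).card ≤ D := by
  calc _ ≤ (Finset.Icc 1 D).card := by
        refine Finset.card_le_card_of_injOn (fun S => ∏ p ∈ S, p) (fun S hS => ?_) ?_
        · rw [Finset.mem_coe, Finset.mem_filter, Finset.mem_powerset] at hS
          rw [Finset.mem_coe, Finset.mem_Icc]
          exact ⟨Finset.one_le_prod' fun p hp => (hP p (hS.1 hp)).one_le, hS.2⟩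
        · intro S hS T hT h
          rw [Finset.mem_coe, Finset.mem_filter, Finset.mem_powerset] at hS hT
          rw [← Nat.primeFactors_prod fun p hp => hP p (hS.1 hp),
            ← Nat.primeFactors_prod fun p hp => hP p (hT.1 hp)]
          exact congrArg Nat.primeFactors h
    _ = D := by simp

theorem half_prod_le_sum_filter {C₀ : ℝ} (hC₀ : 0 ≤ C₀) :
    ∃ k : ℕ, ∀ (y : ℕ), 2 ≤ y → ∀ P ⊆ y.primesLE, ∀ h : ℕ → ℝ, (∀ p ∈ P, 0 ≤ h p) →
      (∀ p ∈ P, h p ≤ C₀ / p) →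
      (∏ p ∈ P, (1 + h p)) / 2 ≤
        ∑ S ∈ P.powerset with ∏ p ∈ S, p ≤ y ^ k, ∏ p ∈ S, h p := by
  obtain ⟨C, hC, hlog⟩ := sum_log_div_prime_le
  obtain ⟨k, hk⟩ := exists_nat_ge (2 * C₀ * (1 + C / Real.log 2) + Real.log 2)
  refine ⟨k, fun y hy P hPy h h0 h1 => ?_⟩
  have hP : ∀ p ∈ P, p.Prime := fun p hp => (Nat.mem_primesLE.1 (hPy hp)).2
  have hy2 : (2 : ℝ) ≤ y := by exact_mod_cast hy
  have hl2 : 0 < Real.log 2 := Real.log_pos one_lt_two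
  have hly : Real.log 2 ≤ Real.log y := Real.log_le_log two_pos hy2
  have hly0 : 0 < Real.log y := hl2.trans_le hly
  let w : ℕ → ℝ := fun p => Real.exp (Real.log p / Real.log y)
  have hbig : ∑ S ∈ P.powerset with ¬ ∏ p ∈ S, p ≤ y ^ k, ∏ p ∈ S, h p ≤
      (∏ p ∈ P, (1 + h p)) / 2 := by
    calc _ ≤ ∑ S ∈ P.powerset with ¬ ∏ p ∈ S, p ≤ y ^ k,
          Real.exp (-k) * ∏ p ∈ S, (h p * w p) := by
          refine Finset.sum_le_sum fun S hS => ?_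
          rw [Finset.mem_filter, Finset.mem_powerset] at hS
          rw [Finset.prod_mul_distrib, mul_left_comm]
          refine le_mul_of_one_le_right (Finset.prod_nonneg fun p hp => h0 p (hS.1 hp)) ?_
          rw [← Real.exp_sum, ← Real.exp_add]
          refine Real.one_le_exp ?_
          rw [← Finset.sum_div, ← Real.log_prod fun p hp =>
            (Nat.cast_ne_zero.2 (hP p (hS.1 hp)).ne_zero)]
          have h2 : ((y : ℝ) ^ k) ≤ ∏ p ∈ S, (p : ℝ) := by
            rw [← Nat.cast_pow, ← Nat.cast_prod]
            exact Nat.cast_le.2 (not_le.1 hS.2).le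
          have h3 := Real.log_le_log (by positivity) h2
          rw [Real.log_pow] at h3
          rw [neg_add_eq_sub, sub_nonneg, le_div_iff₀ hly0]
          exact h3
      _ ≤ ∑ S ∈ P.powerset, Real.exp (-k) * ∏ p ∈ S, (h p * w p) := by
          refine Finset.sum_le_sum_of_subset_of_nonneg (Finset.filter_subset _ _) fun S hS _ => ?_
          rw [Finset.mem_powerset] at hS
          exact mul_nonneg (Real.exp_nonneg _) (Finset.prod_nonneg fun p hp =>
            mul_nonneg (h0 p (hS hp)) (Real.exp_nonneg _))
      _ = Real.exp (-k) * ∏ p ∈ P, (1 + h p * w p) := by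
          rw [← Finset.mul_sum, Finset.prod_one_add]
      _ ≤ Real.exp (-k) * ∏ p ∈ P, ((1 + h p) *
            Real.exp (2 * C₀ / Real.log y * (Real.log p / p))) := by
          refine mul_le_mul_of_nonneg_left (Finset.prod_le_prod (fun p hp => ?_) fun p hp => ?_)
            (Real.exp_nonneg _)
          · have := h0 p hp
            positivity
          · have hp0 : (1 : ℝ) ≤ p := by exact_mod_cast (hP p hp).one_le
            have hx0 : 0 ≤ Real.log p / Real.log y := div_nonneg (Real.log_nonneg hp0) hly0.le
            have hx1 : Real.log p / Real.log y ≤ 1 := by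
              rw [div_le_one hly0]
              exact Real.log_le_log (by linarith)
                (by exact_mod_cast (Nat.mem_primesLE.1 (hPy hp)).1)
            have h2 := Real.abs_exp_sub_one_le (by rwa [abs_of_nonneg hx0])
            rw [abs_of_nonneg hx0] at h2
            have h3 : w p ≤ 1 + 2 * (Real.log p / Real.log y) := by
              linarith [(abs_le.1 h2).2]
            have h4 := h0 p hp
            have h5 := h1 p hp
            calc 1 + h p * w p ≤ 1 + h p * (1 + 2 * (Real.log p / Real.log y)) := by gcongr
              _ ≤ (1 + h p) * (1 + 2 * h p * (Real.log p / Real.log y)) := by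
                nlinarith [mul_nonneg (mul_nonneg h4 h4) hx0]
              _ ≤ (1 + h p) * (1 + 2 * (C₀ / p) * (Real.log p / Real.log y)) := by gcongr
              _ = (1 + h p) * (2 * C₀ / Real.log y * (Real.log p / p) + 1) := by ring
              _ ≤ _ := by gcongr; exact Real.add_one_le_exp _
      _ = (∏ p ∈ P, (1 + h p)) * Real.exp (-k + 2 * C₀ / Real.log y *
            ∑ p ∈ P, Real.log p / p) := by
          rw [Finset.prod_mul_distrib, ← Real.exp_sum, ← Finset.mul_sum, Real.exp_add]; ring
      _ ≤ (∏ p ∈ P, (1 + h p)) * Real.exp (-Real.log 2) := by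
          have hpr : 0 ≤ ∏ p ∈ P, (1 + h p) := Finset.prod_nonneg fun p hp => by
            have := h0 p hp
            positivity
          refine mul_le_mul_of_nonneg_left (Real.exp_le_exp.2 ?_) hpr
          have h2 : ∑ p ∈ P, Real.log p / p ≤ Real.log y + C :=
            (Finset.sum_le_sum_of_subset_of_nonneg hPy fun p _ _ =>
              div_nonneg (Real.log_natCast_nonneg _) (Nat.cast_nonneg _)).trans
              (hlog y (by omega))
          have h3 : 2 * C₀ / Real.log y * ∑ p ∈ P, Real.log p / p ≤
              2 * C₀ * (1 + C / Real.log 2) := by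
            calc _ ≤ 2 * C₀ / Real.log y * (Real.log y + C) := by gcongr
              _ = 2 * C₀ * (1 + C / Real.log y) := by field_simp
              _ ≤ _ := by gcongr
          linarith
      _ = _ := by rw [Real.exp_neg, Real.exp_log two_pos]; rfl
  have hsum := Finset.sum_filter_add_sum_filter_not P.powerset (fun S => ∏ p ∈ S, p ≤ y ^ k)
    (fun S => ∏ p ∈ S, h p)
  rw [← Finset.prod_one_add] at hsum
  linarith

theorem sum_box_sifted_le {C₀ : ℝ} (hC₀ : 0 ≤ C₀) :
    ∃ k : ℕ, ∀ e : ℕ → ℤ → ℤ → ℝ, (∀ n, PeriodicTwo n (e n)) →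
      (∀ n u v, e n u v = 0 ∨ e n u v = 1) →
      ∀ (y : ℕ), 2 ≤ y → ∀ P ⊆ y.primesLE, (∀ p ∈ P, meanTwo p (e p) ≤ C₀ / p) →
      (∀ p ∈ P, meanTwo p (e p) ≤ 1 / 2) →
      ∀ a : ℕ, a ≠ 0 → (∀ p ∈ P, ¬ p ∣ a) → ∀ (L : ℕ) (b : ℤ),
      ∑ i ∈ Finset.range L, ∑ j ∈ Finset.range L,
          e a (b + i) (b + j) * ∏ p ∈ P, (1 - e p (b + i) (b + j)) ≤
        2 * L ^ 2 * meanTwo a (e a) * ∏ p ∈ P, (1 - meanTwo p (e p)) + 4 * L * a * y ^ k := by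
  obtain ⟨k, hk⟩ := half_prod_le_sum_filter (C₀ := 2 * C₀) (by positivity)
  refine ⟨4 * k, fun e hper h01 y hy P hPy hg1 hg2 a ha hPa L b => ?_⟩
  have hP : ∀ p ∈ P, p.Prime := fun p hp => (Nat.mem_primesLE.1 (hPy hp)).2
  have he0 : ∀ n u v, 0 ≤ e n u v := fun n u v => by rcases h01 n u v with h | h <;> simp [h]
  have hm0 : ∀ n, 0 ≤ meanTwo n (e n) := fun n =>
    div_nonneg (Finset.sum_nonneg fun i _ => Finset.sum_nonneg fun j _ => he0 _ _ _) (sq_nonneg _)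
  set g : ℕ → ℝ := fun p => meanTwo p (e p) with hg
  let h : ℕ → ℝ := fun p => g p / (1 - g p)
  have hg2' : ∀ p ∈ P, 1 / 2 ≤ 1 - g p := fun p hp => by linarith [hg2 p hp]
  have hh0 : ∀ p ∈ P, 0 ≤ h p := fun p hp => div_nonneg (hm0 p) (by linarith [hg2' p hp])
  have hh1 : ∀ p ∈ P, h p ≤ 2 * g p := fun p hp => by
    rw [div_le_iff₀ (by linarith [hg2' p hp])]
    nlinarith [hg2' p hp, hm0 p]
  have hhle : ∀ p ∈ P, h p ≤ 1 := fun p hp => by linarith [hh1 p hp, hg2 p hp]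
  have h1h : ∀ p ∈ P, 1 + h p = (1 - g p)⁻¹ := fun p hp => by
    have : 1 - g p ≠ 0 := by linarith [hg2' p hp]
    simp only [h]
    field_simp
    ring
  have hH := hk y hy P hPy h hh0 fun p hp => (hh1 p hp).trans (by
    rw [mul_div_assoc]; exact mul_le_mul_of_nonneg_left (hg1 p hp) two_pos.le)
  set 𝓓 := P.powerset.filter fun S => ∏ p ∈ S, p ≤ y ^ k with h𝓓
  set H := ∑ S ∈ 𝓓, ∏ p ∈ S, h p with hHdef
  have hS : ∀ S ∈ 𝓓, S ⊆ P := fun S hS => Finset.mem_powerset.1 (Finset.mem_filter.1 hS).1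
  have hone : 1 ≤ H := by
    have h1 : ∅ ∈ 𝓓 := by
      rw [h𝓓, Finset.mem_filter]
      exact ⟨Finset.empty_mem_powerset _, by simpa using Nat.one_le_pow _ _ (by omega)⟩
    have h2 := Finset.single_le_sum (f := fun S => ∏ p ∈ S, h p)
      (fun S hSD => Finset.prod_nonneg fun p hp => hh0 p (hS S hSD hp)) h1
    simpa using h2
  have hHpos : 0 < H := by linarith
  let ψ : ℕ → ℤ → ℤ → ℝ := fun p u v => h p - (1 + h p) * e p u v
  have hψ1 : ∀ p ∈ P, ∀ u v, |ψ p u v| ≤ 1 := fun p hp u v => by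
    rcases h01 p u v with h' | h' <;> simp only [ψ, h']
    · rw [mul_zero, sub_zero, abs_of_nonneg (hh0 p hp)]; exact hhle p hp
    · rw [abs_le]; constructor <;> linarith
  have hpoint : ∀ u v, e a u v * ∏ p ∈ P, (1 - e p u v) ≤
      (∑ S ∈ 𝓓, ∑ T ∈ 𝓓, e a u v * ((∏ p ∈ S, ψ p u v) * ∏ p ∈ T, ψ p u v)) / H ^ 2 := by
    intro u v
    simp only [← Finset.mul_sum]
    rw [← Finset.sum_mul, mul_div_assoc]
    refine mul_le_mul_of_nonneg_left ?_ (he0 _ _ _)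
    by_cases hall : ∀ p ∈ P, e p u v = 0
    · have h1 : ∑ S ∈ 𝓓, ∏ p ∈ S, ψ p u v = H :=
        Finset.sum_congr rfl fun S hSD => Finset.prod_congr rfl fun p hp => by
          simp [ψ, hall p (hS S hSD hp)]
      rw [h1, ← sq, div_self (by positivity)]
      refine Finset.prod_le_one (fun p hp => ?_) fun p hp => ?_ <;> simp [hall p hp]
    · push Not at hall
      obtain ⟨p, hp, hne⟩ := hall
      rw [Finset.prod_eq_zero hp (by rw [(h01 p u v).resolve_left hne, sub_self])]
      exact div_nonneg (mul_self_nonneg _) (sq_nonneg _)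
  have hpair : ∀ S ∈ 𝓓, ∀ T ∈ 𝓓, ∑ i ∈ Finset.range L, ∑ j ∈ Finset.range L,
      e a (b + i) (b + j) * ((∏ p ∈ S, ψ p (b + i) (b + j)) * ∏ p ∈ T, ψ p (b + i) (b + j)) ≤
      (if S = T then L ^ 2 * g a * ∏ p ∈ S, h p else 0) + 4 * L * a * (y ^ k * y ^ k) := by
    intro S hSD T hTD
    have hSP := hS S hSD
    have hTP := hS T hTD
    let χ : ℕ → ℤ → ℤ → ℝ := fun p u v =>
      (if p ∈ S then ψ p u v else 1) * (if p ∈ T then ψ p u v else 1)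
    have hU : S ∪ T ⊆ P := Finset.union_subset hSP hTP
    have heq : ∀ u v, e a u v * ((∏ p ∈ S, ψ p u v) * ∏ p ∈ T, ψ p u v) =
        e a u v * ∏ p ∈ S ∪ T, χ p u v := fun u v => by
      rw [Finset.prod_mul_distrib, Finset.prod_ite_mem, Finset.prod_ite_mem,
        Finset.union_inter_cancel_left, Finset.union_inter_cancel_right]
    have hψper : ∀ p, PeriodicTwo p (ψ p) := fun p u v => by
      simp only [ψ, (hper p u v).1, (hper p u v).2, and_self]
    have hχper : ∀ p ∈ S ∪ T, PeriodicTwo p (χ p) := fun p _ => by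
      refine PeriodicTwo.mul ?_ ?_ <;> split_ifs <;>
        first | exact hψper p | exact fun u v => ⟨rfl, rfl⟩
    obtain ⟨hp1, hp2⟩ := meanTwo_mul_prod ha (hper a) (S ∪ T) id
      (fun p hp => (hP p (hU hp)).ne_zero)
      (fun p hp q hq hpq => (Nat.coprime_primes (hP p (hU hp)) (hP q (hU hq))).2 hpq)
      (fun p hp => ((hP p (hU hp)).coprime_iff_not_dvd.2 (hPa p (hU hp))).symm) χ hχper
    simp only [heq]
    have hprod0 : ∏ p ∈ S ∪ T, id p ≠ 0 :=
      Finset.prod_ne_zero_iff.2 fun p hp => (hP p (hU hp)).ne_zero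
    have hbox := abs_sum_box_sub_le (mul_ne_zero ha hprod0) hp1 (fun u v => by
      rw [abs_mul, Finset.abs_prod]
      refine mul_le_one₀ ?_ (Finset.prod_nonneg fun _ _ => abs_nonneg _)
        (Finset.prod_le_one (fun _ _ => abs_nonneg _) fun p hp => ?_)
      · rcases h01 a u v with h | h <;> simp [h]
      · rw [abs_mul]
        refine mul_le_one₀ ?_ (abs_nonneg _) ?_ <;> split_ifs <;>
          first | exact hψ1 p (hU hp) u v | simp) L b
    have hmean : meanTwo a (e a) * ∏ p ∈ S ∪ T, meanTwo (id p) (χ p) ≤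
        if S = T then g a * ∏ p ∈ S, h p else 0 := by
      have hcomp : ∀ p ∈ P, ∀ x y z : ℝ,
          meanTwo p (fun u v => x + y * e p u v) = x + y * g p := fun p hp x y z => by
        have hp0 : (p : ℝ) ≠ 0 := Nat.cast_ne_zero.2 (hP p hp).ne_zero
        simp only [hg, meanTwo, Finset.sum_add_distrib, ← Finset.mul_sum]
        simp only [Finset.sum_const, Finset.card_range, nsmul_eq_mul]
        field_simp
      have hψ0 : ∀ p ∈ P, meanTwo p (ψ p) = 0 := fun p hp => by
        have h1 := hcomp p hp (h p) (-(1 + h p)) 0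
        have h2 : (fun u v => h p + -(1 + h p) * e p u v) = ψ p := by
          ext u v; simp only [ψ]; ring
        rw [h2] at h1
        rw [h1, h1h p hp]
        have : 1 - g p ≠ 0 := by linarith [hg2' p hp]
        simp only [h]
        field_simp
        ring
      have hψψ : ∀ p ∈ P, meanTwo p (fun u v => ψ p u v * ψ p u v) = h p := fun p hp => by
        have h1 := hcomp p hp (h p ^ 2) (1 - h p ^ 2) 0
        have h2 : (fun u v => h p ^ 2 + (1 - h p ^ 2) * e p u v) =
            fun u v => ψ p u v * ψ p u v := by
          ext u v
          rcases h01 p u v with h' | h' <;> simp only [ψ, h'] <;> ring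
        rw [h2] at h1
        rw [h1]
        have : 1 - g p ≠ 0 := by linarith [hg2' p hp]
        simp only [h]
        field_simp
        ring
      split_ifs with hST
      · subst hST
        rw [Finset.union_self]
        refine le_of_eq (congrArg _ (Finset.prod_congr rfl fun p hp => ?_))
        simp only [χ, hp, if_true, id]
        exact hψψ p (hSP hp)
      · have hex : ∃ p ∈ S ∪ T, ¬ (p ∈ S ∧ p ∈ T) := by
          by_contra hcon
          push Not at hcon
          exact hST (Finset.Subset.antisymm
            (fun p hp => (hcon p (Finset.mem_union_left _ hp)).2)
            fun p hp => (hcon p (Finset.mem_union_right _ hp)).1)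
        obtain ⟨p, hp, hnp⟩ := hex
        rw [Finset.prod_eq_zero hp, mul_zero]
        rcases Finset.mem_union.1 hp with h1 | h1
        · have h2 : p ∉ T := fun h => hnp ⟨h1, h⟩
          simp only [χ, h1, h2, if_true, if_false, mul_one, id]
          exact hψ0 p (hU hp)
        · have h2 : p ∉ S := fun h => hnp ⟨h, h1⟩
          simp only [χ, h1, h2, if_true, if_false, one_mul, id]
          exact hψ0 p (hU hp)
    rw [hp2] at hbox
    have hsize : ((a * ∏ p ∈ S ∪ T, id p : ℕ) : ℝ) ≤ a * (y ^ k * y ^ k) := by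
      have h1 : ∏ p ∈ S ∪ T, id p ≤ y ^ k * y ^ k := by
        refine le_trans ?_ (Nat.mul_le_mul (Finset.mem_filter.1 hSD).2 (Finset.mem_filter.1 hTD).2)
        rw [← Finset.prod_union_inter]
        exact Nat.le_mul_of_pos_right _ (Finset.prod_pos fun p hp =>
          (hP p (hSP (Finset.mem_inter.1 hp).1)).pos)
      exact_mod_cast Nat.mul_le_mul_left a h1
    have h3 := (abs_le.1 hbox).2
    have h4 : (L : ℝ) ^ 2 * (meanTwo a (e a) * ∏ p ∈ S ∪ T, meanTwo (id p) (χ p)) ≤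
        if S = T then L ^ 2 * g a * ∏ p ∈ S, h p else 0 := by
      refine (mul_le_mul_of_nonneg_left hmean (sq_nonneg _)).trans (le_of_eq ?_)
      split_ifs <;> ring
    have h5 : 4 * (L : ℝ) * ((a * ∏ p ∈ S ∪ T, id p : ℕ) : ℝ) ≤ 4 * L * a * (y ^ k * y ^ k) := by
      rw [mul_assoc _ (a : ℝ)]
      exact mul_le_mul_of_nonneg_left hsize (by positivity)
    linarith
  have hcard : (𝓓.card : ℝ) ≤ y ^ k := by exact_mod_cast card_filter_prod_primes_le hP (y ^ k)
  have hV : 0 ≤ ∏ p ∈ P, (1 - g p) := Finset.prod_nonneg fun p hp => by linarith [hg2' p hp]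
  have hinv : 1 / H ≤ 2 * ∏ p ∈ P, (1 - g p) := by
    rw [Finset.prod_congr rfl h1h, Finset.prod_inv_distrib] at hH
    have hV' : 0 < ∏ p ∈ P, (1 - g p) := Finset.prod_pos fun p hp => by linarith [hg2' p hp]
    rw [div_le_iff₀ hHpos]
    calc (1 : ℝ) = 2 * (∏ p ∈ P, (1 - g p)) * ((∏ p ∈ P, (1 - g p))⁻¹ / 2) := by field_simp
      _ ≤ _ := mul_le_mul_of_nonneg_left hH (by positivity)
  calc _ ≤ ∑ i ∈ Finset.range L, ∑ j ∈ Finset.range L,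
        (∑ S ∈ 𝓓, ∑ T ∈ 𝓓, e a (b + i) (b + j) *
          ((∏ p ∈ S, ψ p (b + i) (b + j)) * ∏ p ∈ T, ψ p (b + i) (b + j))) / H ^ 2 :=
        Finset.sum_le_sum fun i _ => Finset.sum_le_sum fun j _ => hpoint _ _
    _ = (∑ S ∈ 𝓓, ∑ T ∈ 𝓓, ∑ i ∈ Finset.range L, ∑ j ∈ Finset.range L,
        e a (b + i) (b + j) *
          ((∏ p ∈ S, ψ p (b + i) (b + j)) * ∏ p ∈ T, ψ p (b + i) (b + j))) / H ^ 2 := by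
        simp only [← Finset.sum_div]
        congr 1
        rw [Finset.sum_congr rfl fun i _ => Finset.sum_comm, Finset.sum_comm]
        refine Finset.sum_congr rfl fun S _ => ?_
        rw [Finset.sum_congr rfl fun i _ => Finset.sum_comm, Finset.sum_comm]
    _ ≤ (∑ S ∈ 𝓓, ∑ T ∈ 𝓓, ((if S = T then L ^ 2 * g a * ∏ p ∈ S, h p else 0) +
        4 * L * a * (y ^ k * y ^ k))) / H ^ 2 := by
        gcongr with S hSD T hTD
        exact hpair S hSD T hTD
    _ = (L ^ 2 * g a * H + 𝓓.card ^ 2 * (4 * L * a * (y ^ k * y ^ k))) / H ^ 2 := by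
        congr 1
        simp only [Finset.sum_add_distrib, Finset.sum_const, nsmul_eq_mul]
        rw [Finset.sum_congr rfl fun S hSD => by rw [Finset.sum_ite_eq, if_pos hSD],
          ← Finset.mul_sum]
        ring
    _ = L ^ 2 * g a * (1 / H) + 𝓓.card ^ 2 * (4 * L * a * (y ^ k * y ^ k)) / H ^ 2 := by
        field_simp
    _ ≤ L ^ 2 * g a * (2 * ∏ p ∈ P, (1 - g p)) +
          (y ^ k) ^ 2 * (4 * L * a * (y ^ k * y ^ k)) := by
        have := hm0 a
        refine add_le_add (mul_le_mul_of_nonneg_left hinv (by positivity)) ?_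
        refine (div_le_self (by positivity) (one_le_pow₀ hone)).trans ?_
        gcongr
    _ = _ := by ring

end Sieve

section RootCountPrimePow

open Polynomial

theorem exists_map_eq_C_mul (g : ℚ[X]) :
    ∃ (d : ℤ) (G : ℤ[X]), d ≠ 0 ∧ G.map (Int.castRingHom ℚ) = C (d : ℚ) * g := by
  obtain ⟨m, hm, h⟩ := IsLocalization.integerNormalization_spec (nonZeroDivisors ℤ) g
  refine ⟨m, _, nonZeroDivisors.ne_zero hm, h.trans ?_⟩
  rw [← smul_eq_C_mul, Int.cast_smul_eq_zsmul]

theorem exists_bezout_derivative {f : ℤ[X]} (hf : Squarefree (f.map (Int.castRingHom ℚ))) :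
    ∃ (A B : ℤ[X]) (R : ℤ), R ≠ 0 ∧ A * f + B * derivative f = C R := by
  obtain ⟨A, B, h⟩ := PerfectField.separable_iff_squarefree.2 hf
  obtain ⟨m, A', hm, hA⟩ := exists_map_eq_C_mul A
  obtain ⟨n, B', hn, hB⟩ := exists_map_eq_C_mul B
  refine ⟨C n * A', C m * B', n * m, mul_ne_zero hn hm, ?_⟩
  apply Polynomial.map_injective (Int.castRingHom ℚ) Int.cast_injective
  rw [Polynomial.map_add, Polynomial.map_mul, Polynomial.map_mul, Polynomial.map_mul,
    Polynomial.map_mul, Polynomial.map_C, Polynomial.map_C, Polynomial.map_C, hA, hB,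
    ← Polynomial.derivative_map, eq_intCast, eq_intCast, eq_intCast, Int.cast_mul, C_mul]
  calc _ = C (n : ℚ) * C (m : ℚ) * (A * f.map (Int.castRingHom ℚ) +
        B * derivative (f.map (Int.castRingHom ℚ))) := by ring
    _ = _ := by rw [h, mul_one]

theorem pow_dvd_mul_sub_of_roots {f A B : ℤ[X]} {R : ℤ} (h : A * f + B * derivative f = C R)
    {p : ℕ} (hp : p.Prime) {e k : ℕ} (hR : ¬ (p : ℤ) ^ (e + 1) ∣ R) {x y : ℤ}
    (hx : (p : ℤ) ^ k ∣ f.eval x) (hy : (p : ℤ) ^ k ∣ f.eval y)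
    (hxy : (p : ℤ) ^ (e + 1) ∣ y - x) : (p : ℤ) ^ k ∣ (y - x) * p ^ e := by
  rcases le_or_gt k e with hke | hke
  · exact (pow_dvd_pow _ hke).mul_left _
  obtain ⟨s, hs⟩ := Polynomial.binomExpansion f x (y - x)
  rw [add_sub_cancel] at hs
  set w := (derivative f).eval x + s * (y - x) with hw
  have h1 : (p : ℤ) ^ k ∣ (y - x) * w := by
    have : (y - x) * w = f.eval y - f.eval x := by rw [hs, hw]; ring
    rw [this]; exact dvd_sub hy hx
  have h2 : ¬ (p : ℤ) ^ (e + 1) ∣ w := fun hcon => hR (by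
    have h3 : (p : ℤ) ^ (e + 1) ∣ (derivative f).eval x := by
      have : (derivative f).eval x = w - s * (y - x) := by rw [hw]; ring
      rw [this]; exact dvd_sub hcon (hxy.mul_left _)
    have h4 := congrArg (eval x) h
    simp only [eval_add, eval_mul, eval_C] at h4
    rw [← h4]
    exact dvd_add (((pow_dvd_pow _ (by omega)).trans hx).mul_left _) (h3.mul_left _))
  have hpi : Prime (p : ℤ) := Nat.prime_iff_prime_int.1 hp
  have hw0 : w ≠ 0 := fun h0 => h2 (h0 ▸ dvd_zero _)
  have hfin : FiniteMultiplicity (p : ℤ) w := Int.finiteMultiplicity_iff.2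
    ⟨by simpa using hp.ne_one, hw0⟩
  obtain ⟨w', hw', hndvd⟩ := hfin.exists_eq_pow_mul_and_not_dvd
  set j := multiplicity (p : ℤ) w
  have hj : j ≤ e := by
    by_contra hcon
    exact h2 ((pow_dvd_pow _ (by omega)).trans ⟨w', hw'⟩)
  have h5 : (p : ℤ) ^ k ∣ (y - x) * p ^ j := by
    rw [hw', ← mul_assoc] at h1
    exact (IsCoprime.pow_left ((Prime.coprime_iff_not_dvd hpi).2 hndvd)).dvd_of_dvd_mul_right h1
  exact h5.trans (mul_dvd_mul_left _ (pow_dvd_pow _ hj))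

theorem rootCount_eq_card (f : ℤ[X]) {n : ℕ} (hn : n ≠ 0) :
    rootCount f n = ((Finset.range n).filter fun x : ℕ => (n : ℤ) ∣ f.eval (x : ℤ)).card := by
  have := NeZero.mk hn
  have key : ∀ x : ℕ, aeval (x : ZMod n) f = 0 ↔ (n : ℤ) ∣ f.eval (x : ℤ) := fun x => by
    rw [← ZMod.intCast_zmod_eq_zero_iff_dvd]
    have := Polynomial.aeval_algebraMap_apply (ZMod n) (x : ℤ) f
    simp only [algebraMap_int_eq, eq_intCast, Int.cast_natCast, coe_aeval_eq_eval] at this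
    rw [this]
  rw [rootCount, Nat.card_eq_fintype_card, Fintype.card_subtype]
  refine Finset.card_bij (fun x _ => x.val) (fun x hx => ?_)
    (fun x _ y _ hxy => ZMod.val_injective n hxy) fun y hy => ?_
  · rw [Finset.mem_filter] at hx ⊢
    rw [← key, ZMod.natCast_zmod_val]
    exact ⟨Finset.mem_range.2 (ZMod.val_lt x), hx.2⟩
  · rw [Finset.mem_filter, Finset.mem_range] at hy
    exact ⟨y, by simp [key, hy.2], ZMod.val_cast_of_lt hy.1⟩

theorem rootCount_pow_le {f A B : ℤ[X]} {R : ℤ} (h : A * f + B * derivative f = C R)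
    {p : ℕ} (hp : p.Prime) {e : ℕ} (hR : ¬ (p : ℤ) ^ (e + 1) ∣ R) (k : ℕ) :
    rootCount f (p ^ k) ≤ p ^ e * p ^ (e + 1) := by
  have hp0 := hp.ne_zero
  rw [rootCount_eq_card f (pow_ne_zero k hp0)]
  set S := (Finset.range (p ^ k)).filter fun x : ℕ => ((p ^ k : ℕ) : ℤ) ∣ f.eval (x : ℤ) with hS
  have h1 : (S.image (· % p ^ (e + 1))).card ≤ p ^ (e + 1) := by
    refine (Finset.card_le_card (t := Finset.range (p ^ (e + 1))) fun x hx => ?_).trans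
      (Finset.card_range _).le
    obtain ⟨y, -, rfl⟩ := Finset.mem_image.1 hx
    exact Finset.mem_range.2 (Nat.mod_lt _ (by positivity))
  refine (Finset.card_le_mul_card_image (f := (· % p ^ (e + 1))) S (p ^ e) fun b hb => ?_).trans
    (Nat.mul_le_mul_left _ h1)
  rcases le_or_gt k e with hke | hke
  · refine (Finset.card_le_card (t := Finset.range (p ^ k)) fun x hx => ?_).trans
      ((Finset.card_range _).le.trans (Nat.pow_le_pow_right hp.pos hke))
    exact (Finset.mem_filter.1 (Finset.mem_filter.1 hx).1).1
  · refine (Finset.card_le_card_of_injOn (t := Finset.range (p ^ e)) (· / p ^ (k - e))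
      (fun x hx => ?_) fun x hx y hy hxy => ?_).trans (Finset.card_range _).le
    · have := (Finset.mem_filter.1 (Finset.mem_filter.1 hx).1).1
      rw [Finset.mem_range] at this
      rw [Finset.coe_range, Set.mem_Iio, Nat.div_lt_iff_lt_mul (by positivity), ← pow_add]
      rwa [show e + (k - e) = k by omega]
    · obtain ⟨hx1, hx2⟩ := Finset.mem_filter.1 hx
      obtain ⟨hy1, hy2⟩ := Finset.mem_filter.1 hy
      have hx3 := (Finset.mem_filter.1 hx1).2
      have hy3 := (Finset.mem_filter.1 hy1).2
      push_cast at hx3 hy3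
      have hmod : (p : ℤ) ^ (e + 1) ∣ (y : ℤ) - x := by
        have := (Nat.modEq_iff_dvd (n := p ^ (e + 1)) (a := x) (b := y)).1 (hx2.trans hy2.symm)
        exact_mod_cast this
      have h2 := pow_dvd_mul_sub_of_roots h hp hR hx3 hy3 hmod
      have h3 : (p : ℤ) ^ (k - e) ∣ (y : ℤ) - x := by
        have h4 : (p : ℤ) ^ (k - e) * p ^ e ∣ ((y : ℤ) - x) * p ^ e := by
          rwa [← pow_add, show k - e + e = k by omega]
        exact Int.dvd_of_mul_dvd_mul_right (by positivity) h4
      have h5 : x % p ^ (k - e) = y % p ^ (k - e) :=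
        (Nat.modEq_iff_dvd (n := p ^ (k - e)) (a := x) (b := y)).2 (by exact_mod_cast h3)
      have h6 : x / p ^ (k - e) = y / p ^ (k - e) := hxy
      rw [← Nat.div_add_mod x (p ^ (k - e)), ← Nat.div_add_mod y (p ^ (k - e)), h5, h6]

theorem rootCount_pow_le_rootCount {f A B : ℤ[X]} {R : ℤ} (h : A * f + B * derivative f = C R)
    {p : ℕ} (hp : p.Prime) (hR : ¬ (p : ℤ) ∣ R) {k : ℕ} (hk : k ≠ 0) :
    rootCount f (p ^ k) ≤ rootCount f p := by
  have hp0 := hp.ne_zero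
  rw [rootCount_eq_card f (pow_ne_zero k hp0), rootCount_eq_card f hp0]
  refine Finset.card_le_card_of_injOn (· % p) (fun x hx => ?_) fun x hx y hy hxy => ?_
  · have hx3 := (Finset.mem_filter.1 hx).2
    refine Finset.mem_coe.2 (Finset.mem_filter.2 ⟨Finset.mem_range.2 (Nat.mod_lt _ hp.pos), ?_⟩)
    have h1 : (p : ℤ) ∣ f.eval (x : ℤ) :=
      (by exact_mod_cast dvd_pow_self p hk : (p : ℤ) ∣ ((p ^ k : ℕ) : ℤ)).trans hx3
    have h2 : (p : ℤ) ∣ ((x % p : ℕ) : ℤ) - x := by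
      have := (Nat.modEq_iff_dvd (n := p)).1 (Nat.mod_modEq x p).symm
      exact_mod_cast this
    have h3 := h2.trans (Polynomial.sub_dvd_eval_sub ((x % p : ℕ) : ℤ) x f)
    have := dvd_add h3 h1
    simpa using this
  · have hx3 := (Finset.mem_filter.1 hx).2
    have hy3 := (Finset.mem_filter.1 hy).2
    push_cast at hx3 hy3
    have hmod : (p : ℤ) ^ (0 + 1) ∣ (y : ℤ) - x := by
      have := (Nat.modEq_iff_dvd (n := p) (a := x) (b := y)).1 hxy
      simpa using this
    have h2 := pow_dvd_mul_sub_of_roots h hp (e := 0) (by simpa using hR) hx3 hy3 hmod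
    rw [pow_zero, mul_one] at h2
    have h5 : x ≡ y [MOD p ^ k] := Nat.modEq_iff_dvd.2 (by exact_mod_cast h2)
    exact Nat.ModEq.eq_of_lt_of_lt h5 (Finset.mem_range.1 (Finset.mem_filter.1 hx).1)
      (Finset.mem_range.1 (Finset.mem_filter.1 hy).1)

theorem rootCount_le_natDegree {f : ℤ[X]} {p : ℕ} (hp : p.Prime)
    (hf : f.map (Int.castRingHom (ZMod p)) ≠ 0) : rootCount f p ≤ f.natDegree := by
  have := Fact.mk hp
  rw [rootCount, Nat.card_eq_fintype_card, Fintype.card_subtype]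
  classical
  calc _ ≤ (f.map (Int.castRingHom (ZMod p))).roots.toFinset.card := by
        refine Finset.card_le_card fun x hx => ?_
        rw [Multiset.mem_toFinset, mem_roots hf, IsRoot, eval_map]
        exact (Finset.mem_filter.1 hx).2
    _ ≤ _ := (Multiset.toFinset_card_le _).trans ((card_roots' _).trans natDegree_map_le)

theorem map_ne_zero_of_bezout {f A B : ℤ[X]} {R : ℤ} (h : A * f + B * derivative f = C R)
    {p : ℕ} (hR : ¬ (p : ℤ) ∣ R) : f.map (Int.castRingHom (ZMod p)) ≠ 0 := fun h0 => hR (by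
  have h1 := congrArg (Polynomial.map (Int.castRingHom (ZMod p))) h
  rw [Polynomial.map_add, Polynomial.map_mul, Polynomial.map_mul, ← derivative_map, h0] at h1
  rw [mul_zero, derivative_zero, mul_zero, add_zero, Polynomial.map_C, eq_intCast] at h1
  exact (ZMod.intCast_zmod_eq_zero_iff_dvd _ _).1 (C_eq_zero.1 h1.symm))

theorem exists_rootCount_pow_le {f : ℤ[X]} (hf : Squarefree (f.map (Int.castRingHom ℚ))) :
    ∃ M : ℕ, ∀ p : ℕ, p.Prime → ∀ k, rootCount f (p ^ k) ≤ M := by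
  obtain ⟨A, B, R, hR, h⟩ := exists_bezout_derivative hf
  refine ⟨f.natDegree + 1 + R.natAbs * R.natAbs ^ 2, fun p hp k => ?_⟩
  by_cases hpR : (p : ℤ) ∣ R
  · have hfin : FiniteMultiplicity (p : ℤ) R := Int.finiteMultiplicity_iff.2
      ⟨by simpa using hp.ne_one, hR⟩
    obtain ⟨R', hR', hndvd⟩ := hfin.exists_eq_pow_mul_and_not_dvd
    set e := multiplicity (p : ℤ) R
    have hpe : p ^ e ≤ R.natAbs := Nat.le_of_dvd (Int.natAbs_pos.2 hR) (by
      have : (p : ℤ) ^ e ∣ R := ⟨R', hR'⟩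
      rw [← Int.natCast_dvd]
      exact_mod_cast this)
    have hp1 : p ≤ R.natAbs := Nat.le_of_dvd (Int.natAbs_pos.2 hR) (Int.natCast_dvd.1 hpR)
    have hne : ¬ (p : ℤ) ^ (e + 1) ∣ R := fun hcon => hndvd (by
      rw [hR', pow_succ] at hcon
      exact Int.dvd_of_mul_dvd_mul_left (pow_ne_zero _ (by exact_mod_cast hp.ne_zero)) hcon)
    have h1 := rootCount_pow_le h hp hne k
    have h2 : p ^ e * p ^ (e + 1) ≤ R.natAbs * R.natAbs ^ 2 := by
      rw [sq, pow_succ]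
      exact Nat.mul_le_mul hpe (Nat.mul_le_mul hpe hp1)
    omega
  · rcases eq_or_ne k 0 with rfl | hk
    · have : rootCount f (p ^ 0) ≤ 1 := by
        rw [pow_zero, rootCount_eq_card f one_ne_zero]
        exact (Finset.card_filter_le _ _).trans (by simp)
      omega
    · have h1 := rootCount_pow_le_rootCount h hp hpR hk
      have h2 := rootCount_le_natDegree hp (map_ne_zero_of_bezout h hpR)
      omega

end RootCountPrimePow

section LocalDensity

open Polynomial

/-- The indicator of the pairs `(u, v)` with no common prime factor with `n` at which `n` divides
the form `binQuartic f`. -/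
noncomputable def primInd (f : ℤ[X]) (n : ℕ) (u v : ℤ) : ℝ :=
  open Classical in
  if (n : ℤ) ∣ binQuartic f u v ∧ ∀ p : ℕ, p.Prime → p ∣ n → ¬ ((p : ℤ) ∣ u ∧ (p : ℤ) ∣ v) then 1
  else 0

theorem primInd_eq_ite {f : ℤ[X]} {n : ℕ} {u v : ℤ} {Q : Prop} [Decidable Q]
    (h : ((n : ℤ) ∣ binQuartic f u v ∧
      ∀ p : ℕ, p.Prime → p ∣ n → ¬ ((p : ℤ) ∣ u ∧ (p : ℤ) ∣ v)) ↔ Q) :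
    primInd f n u v = if Q then 1 else 0 := by
  classical
  unfold primInd
  exact if_congr h rfl rfl

theorem binQuartic_cast (f : ℤ[X]) (R : Type*) [CommRing R] (u v : ℤ) :
    (binQuartic f u v : R) =
      ∑ i ∈ Finset.range 5, (f.coeff i : R) * (u : R) ^ i * (v : R) ^ (4 - i) := by
  simp [binQuartic]

theorem primInd_eq_zero_or_one (f : ℤ[X]) (n : ℕ) (u v : ℤ) :
    primInd f n u v = 0 ∨ primInd f n u v = 1 := by
  unfold primInd; split_ifs <;> simp

theorem primInd_nonneg (f : ℤ[X]) (n : ℕ) (u v : ℤ) : 0 ≤ primInd f n u v := by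
  rcases primInd_eq_zero_or_one f n u v with h | h <;> simp [h]

theorem primInd_congr (f : ℤ[X]) {n : ℕ} {u v u' v' : ℤ} (hu : (u : ZMod n) = u')
    (hv : (v : ZMod n) = v') : primInd f n u v = primInd f n u' v' := by
  have h1 : ((n : ℤ) ∣ binQuartic f u v) ↔ (n : ℤ) ∣ binQuartic f u' v' := by
    rw [← ZMod.intCast_zmod_eq_zero_iff_dvd, ← ZMod.intCast_zmod_eq_zero_iff_dvd,
      binQuartic_cast, binQuartic_cast, hu, hv]
  have h2 : ∀ x y : ℤ, (x : ZMod n) = y → ∀ p : ℕ, p ∣ n → ((p : ℤ) ∣ x ↔ (p : ℤ) ∣ y) :=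
    fun x y hxy p hp => by
      have h3 : (p : ℤ) ∣ y - x := (Int.natCast_dvd_natCast.2 hp).trans
        ((ZMod.intCast_eq_intCast_iff_dvd_sub _ _ _).1 hxy)
      exact ⟨fun h => (dvd_sub_left h).1 h3, fun h => (dvd_sub_right h).1 h3⟩
  unfold primInd
  congr 1
  refine propext (and_congr h1 (forall_congr' fun p => forall_congr' fun _ =>
    forall_congr' fun hp => ?_))
  rw [h2 u u' hu p hp, h2 v v' hv p hp]

theorem periodicTwo_primInd (f : ℤ[X]) (n : ℕ) : PeriodicTwo n (primInd f n) := fun u v =>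
  ⟨primInd_congr f (by simp) rfl, primInd_congr f rfl (by simp)⟩

theorem primInd_mul (f : ℤ[X]) {m n : ℕ} (h : m.Coprime n) (u v : ℤ) :
    primInd f (m * n) u v = primInd f m u v * primInd f n u v := by
  have h1 : ((m * n : ℕ) : ℤ) ∣ binQuartic f u v ↔
      (m : ℤ) ∣ binQuartic f u v ∧ (n : ℤ) ∣ binQuartic f u v := by
    rw [Int.natCast_dvd, Int.natCast_dvd, Int.natCast_dvd]
    exact ⟨fun h => ⟨(Dvd.intro _ rfl).trans h, (Dvd.intro_left _ rfl).trans h⟩,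
      fun h' => h.mul_dvd_of_dvd_of_dvd h'.1 h'.2⟩
  have h2 : (∀ p : ℕ, p.Prime → p ∣ m * n → ¬ ((p : ℤ) ∣ u ∧ (p : ℤ) ∣ v)) ↔
      (∀ p : ℕ, p.Prime → p ∣ m → ¬ ((p : ℤ) ∣ u ∧ (p : ℤ) ∣ v)) ∧
      ∀ p : ℕ, p.Prime → p ∣ n → ¬ ((p : ℤ) ∣ u ∧ (p : ℤ) ∣ v) :=
    ⟨fun h => ⟨fun p hp hm => h p hp (hm.mul_right _), fun p hp hn => h p hp (hn.mul_left _)⟩,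
      fun h p hp hmn => (hp.dvd_mul.1 hmn).elim (h.1 p hp) (h.2 p hp)⟩
  classical
  rw [primInd_eq_ite (and_congr h1 h2), primInd_eq_ite Iff.rfl, primInd_eq_ite Iff.rfl,
    ite_zero_mul_ite_zero, mul_one]
  exact if_congr and_and_and_comm rfl rfl

theorem meanTwo_primInd_mul (f : ℤ[X]) {m n : ℕ} (hm : m ≠ 0) (hn : n ≠ 0) (h : m.Coprime n) :
    meanTwo (m * n) (primInd f (m * n)) =
      meanTwo m (primInd f m) * meanTwo n (primInd f n) := by
  rw [← meanTwo_mul_of_coprime hm hn h (periodicTwo_primInd f m) (periodicTwo_primInd f n)]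
  congr 1
  ext u v
  exact primInd_mul f h u v

theorem meanTwo_primInd_nonneg (f : ℤ[X]) (n : ℕ) : 0 ≤ meanTwo n (primInd f n) :=
  div_nonneg (Finset.sum_nonneg fun _ _ => Finset.sum_nonneg fun _ _ => primInd_nonneg _ _ _ _)
    (sq_nonneg _)

theorem sum_range_eq_sum_zmod {n : ℕ} [NeZero n] (φ : ℕ → ℝ) :
    ∑ i ∈ Finset.range n, φ i = ∑ x : ZMod n, φ x.val := by
  obtain ⟨m, rfl⟩ : ∃ m, n = m + 1 := ⟨n - 1, by have := NeZero.ne n; omega⟩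
  exact (Fin.sum_univ_eq_sum_range φ (m + 1)).symm

/-- The indicator of the zeros of the form attached to `f` over a commutative ring. -/
noncomputable def zeroInd (f : ℤ[X]) {R : Type*} [CommRing R] (x y : R) : ℝ :=
  open Classical in
  if ∑ i ∈ Finset.range 5, (f.coeff i : R) * x ^ i * y ^ (4 - i) = 0 then 1 else 0

theorem zeroInd_nonneg (f : ℤ[X]) {R : Type*} [CommRing R] (x y : R) : 0 ≤ zeroInd f x y := by
  unfold zeroInd; split_ifs <;> simp

theorem zeroInd_reflect (f : ℤ[X]) {R : Type*} [CommRing R] (x y : R) :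
    zeroInd (reflect 4 f) y x = zeroInd f x y := by
  have : ∑ i ∈ Finset.range 5, ((reflect 4 f).coeff i : R) * y ^ i * x ^ (4 - i) =
      ∑ i ∈ Finset.range 5, (f.coeff i : R) * x ^ i * y ^ (4 - i) := by
    simp only [Finset.sum_range_succ, Finset.sum_range_zero, coeff_reflect]
    simp only [revAt_le (show (0 : ℕ) ≤ 4 by norm_num), revAt_le (show (1 : ℕ) ≤ 4 by norm_num),
      revAt_le (show (2 : ℕ) ≤ 4 by norm_num), revAt_le (show (3 : ℕ) ≤ 4 by norm_num),
      revAt_le (show (4 : ℕ) ≤ 4 by norm_num)]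
    norm_num
    ring
  unfold zeroInd
  congr 1
  rw [this]

theorem sum_zeroInd (f : ℤ[X]) (hf : f.natDegree ≤ 4) {n : ℕ} [NeZero n] {y : ZMod n}
    (hy : IsUnit y) : ∑ x : ZMod n, zeroInd f x y = rootCount f n := by
  obtain ⟨w, rfl⟩ := hy
  rw [← Equiv.sum_comp (Units.mulRight w)]
  have h1 : ∀ z : ZMod n, zeroInd f (Units.mulRight w z) (w : ZMod n) =
      if aeval z f = 0 then 1 else 0 := fun z => by
    have h2 : ∑ i ∈ Finset.range 5, (f.coeff i : ZMod n) * (z * w) ^ i * (w : ZMod n) ^ (4 - i) =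
        aeval z f * ((w ^ 4 : (ZMod n)ˣ) : ZMod n) := by
      rw [aeval_eq_sum_range' (show f.natDegree < 5 by omega), Finset.sum_mul]
      refine Finset.sum_congr rfl fun i hi => ?_
      have : (w : ZMod n) ^ 4 = w ^ i * (w : ZMod n) ^ (4 - i) := by
        rw [← pow_add, Nat.add_sub_cancel' (by have := Finset.mem_range.1 hi; omega)]
      rw [mul_pow, zsmul_eq_mul, Units.val_pow_eq_pow_val, this]
      ring
    unfold zeroInd
    rw [Units.mulRight_apply, h2]
    simp only [Units.mul_left_eq_zero]
  simp only [h1]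
  rw [Finset.sum_boole, rootCount, Nat.card_eq_fintype_card, Fintype.card_subtype]

theorem sum_primInd (f : ℤ[X]) {n : ℕ} [NeZero n] :
    ∑ i ∈ Finset.range n, ∑ j ∈ Finset.range n, primInd f n i j =
      ∑ y : ZMod n, ∑ x : ZMod n, primInd f n x.val y.val := by
  rw [Finset.sum_comm, sum_range_eq_sum_zmod fun j => ∑ i ∈ Finset.range n, primInd f n i j]
  exact Finset.sum_congr rfl fun y _ =>
    sum_range_eq_sum_zmod (fun i => primInd f n i y.val)

theorem dvd_binQuartic_val (f : ℤ[X]) {n : ℕ} [NeZero n] (x y : ZMod n) :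
    (n : ℤ) ∣ binQuartic f x.val y.val ↔
      ∑ i ∈ Finset.range 5, (f.coeff i : ZMod n) * x ^ i * y ^ (4 - i) = 0 := by
  rw [← ZMod.intCast_zmod_eq_zero_iff_dvd, binQuartic_cast]
  simp

theorem meanTwo_primInd_prime_pow_le (f : ℤ[X]) (hf : f.natDegree ≤ 4) {p : ℕ} (hp : p.Prime)
    (k : ℕ) : meanTwo (p ^ k) (primInd f (p ^ k)) ≤
      (rootCount f (p ^ k) + rootCount (reflect 4 f) (p ^ k)) / p ^ k := by
  have hn := NeZero.mk (pow_ne_zero k hp.ne_zero)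
  classical
  have hpt : ∀ x y : ZMod (p ^ k), primInd f (p ^ k) x.val y.val ≤
      (if IsUnit y then zeroInd f x y else 0) + (if IsUnit x then zeroInd f x y else 0) := by
    intro x y
    unfold primInd
    split_ifs with h h1 h2
    · obtain ⟨h3, -⟩ := h
      rw [dvd_binQuartic_val] at h3
      simp only [zeroInd, h3]
      norm_num
    · obtain ⟨h3, -⟩ := h
      rw [dvd_binQuartic_val] at h3
      simp [zeroInd, h3]
    · obtain ⟨h3, -⟩ := h
      rw [dvd_binQuartic_val] at h3
      simp [zeroInd, h3]
    · rename_i hx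
      exfalso
      have key : ∀ z : ZMod (p ^ k), ¬ IsUnit z → p ∣ z.val ∧ k ≠ 0 := fun z hz => by
        rw [← ZMod.natCast_zmod_val z, ZMod.isUnit_iff_coprime] at hz
        constructor
        · by_contra hcon
          exact hz (Nat.Coprime.pow_right k ((Nat.Prime.coprime_iff_not_dvd hp).2 hcon).symm)
        · rintro rfl
          simp at hz
      exact h.2 p hp (dvd_pow_self p (key x hx).2)
        ⟨Int.natCast_dvd_natCast.2 (key x hx).1, Int.natCast_dvd_natCast.2 (key y h1).1⟩
    all_goals
      have := zeroInd_nonneg f x y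
      linarith
  unfold meanTwo
  rw [sum_primInd]
  have hn0 : (0 : ℝ) < (p ^ k : ℕ) := by exact_mod_cast pow_pos hp.pos k
  rw [← Nat.cast_pow p k, div_le_div_iff₀ (pow_pos hn0 2) hn0]
  have h1 : ∑ y : ZMod (p ^ k), ∑ x : ZMod (p ^ k), primInd f (p ^ k) x.val y.val ≤
      (p ^ k : ℕ) * rootCount f (p ^ k) + (p ^ k : ℕ) * rootCount (reflect 4 f) (p ^ k) := by
    refine (Finset.sum_le_sum fun y _ => Finset.sum_le_sum fun x _ => hpt x y).trans ?_
    simp only [Finset.sum_add_distrib]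
    refine add_le_add ?_ ?_
    · refine (Finset.sum_le_card_nsmul _ _ (rootCount f (p ^ k) : ℝ) fun y _ => ?_).trans ?_
      · by_cases hy : IsUnit y
        · simp only [hy, if_true]; rw [sum_zeroInd f hf hy]
        · simp [hy]
      · rw [Finset.card_univ, ZMod.card, nsmul_eq_mul]
    · rw [Finset.sum_comm]
      refine (Finset.sum_le_card_nsmul _ _ (rootCount (reflect 4 f) (p ^ k) : ℝ)
        fun y _ => ?_).trans ?_
      · by_cases hy : IsUnit y
        · simp only [hy, if_true]
          rw [Finset.sum_congr rfl fun x _ => (zeroInd_reflect f y x).symm,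
            sum_zeroInd (reflect 4 f) ?_ hy]
          exact (natDegree_reflect_le).trans (max_le le_rfl hf)
        · simp [hy]
      · rw [Finset.card_univ, ZMod.card, nsmul_eq_mul]
  calc _ ≤ ((p ^ k : ℕ) * rootCount f (p ^ k) + (p ^ k : ℕ) * rootCount (reflect 4 f) (p ^ k)) *
        ((p ^ k : ℕ) : ℝ) := mul_le_mul_of_nonneg_right h1 hn0.le
    _ = _ := by ring

theorem meanTwo_primInd_prime (f : ℤ[X]) (hf : f.natDegree ≤ 4) {p : ℕ} (hp : p.Prime) :
    meanTwo p (primInd f p) =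
      (p - 1) * (rootCount f p + if (p : ℤ) ∣ f.coeff 4 then 1 else 0) / p ^ 2 := by
  have := Fact.mk hp
  have hdvd : ∀ z : ZMod p, (p : ℤ) ∣ (z.val : ℤ) ↔ z = 0 := fun z => by
    rw [← ZMod.intCast_zmod_eq_zero_iff_dvd]; simp
  have hpt : ∀ x y : ZMod p, primInd f p x.val y.val =
      if y = 0 then (if x = 0 then 0 else if (p : ℤ) ∣ f.coeff 4 then 1 else 0)
      else zeroInd f x y := by
    intro x y
    have h1 : (∀ q : ℕ, q.Prime → q ∣ p → ¬ ((q : ℤ) ∣ (x.val : ℤ) ∧ (q : ℤ) ∣ (y.val : ℤ))) ↔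
        ¬ (x = 0 ∧ y = 0) := by
      rw [← hdvd x, ← hdvd y]
      exact ⟨fun h => h p hp dvd_rfl, fun h q hq hqp => by
        rwa [(Nat.prime_dvd_prime_iff_eq hq hp).1 hqp]⟩
    classical
    rw [primInd_eq_ite (and_congr (dvd_binQuartic_val f x y) h1)]
    by_cases hy : y = 0
    · subst hy
      by_cases hx : x = 0
      · simp [hx]
      · have h2 : ∑ i ∈ Finset.range 5, (f.coeff i : ZMod p) * x ^ i * (0 : ZMod p) ^ (4 - i) =
            f.coeff 4 * x ^ 4 := by simp [Finset.sum_range_succ]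
        rw [h2]
        have h3 : (f.coeff 4 : ZMod p) * x ^ 4 = 0 ↔ (p : ℤ) ∣ f.coeff 4 := by
          rw [mul_eq_zero, or_iff_left (pow_ne_zero 4 hx), ZMod.intCast_zmod_eq_zero_iff_dvd]
        simp [h3, hx]
    · simp [hy, zeroInd]
  unfold meanTwo
  rw [sum_primInd]
  simp only [hpt]
  congr 1
  rw [← Finset.add_sum_erase _ _ (Finset.mem_univ (0 : ZMod p))]
  have h4 : ∀ c : ℝ, ∑ x : ZMod p, (if x = 0 then 0 else c) = (p - 1) * c := fun c => by
    rw [← Finset.add_sum_erase _ _ (Finset.mem_univ (0 : ZMod p)), if_pos rfl, zero_add,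
      Finset.sum_congr rfl fun x hx => if_neg (Finset.ne_of_mem_erase hx), Finset.sum_const,
      Finset.card_erase_of_mem (Finset.mem_univ _), Finset.card_univ, ZMod.card, nsmul_eq_mul,
      Nat.cast_sub hp.one_le, Nat.cast_one]
  simp only [if_true, h4]
  rw [Finset.sum_congr rfl fun y hy => by
    rw [Finset.sum_congr rfl fun x _ => if_neg (Finset.ne_of_mem_erase hy),
      sum_zeroInd f hf (Ne.isUnit (Finset.ne_of_mem_erase hy))], Finset.sum_const,
      Finset.card_erase_of_mem (Finset.mem_univ _), Finset.card_univ, ZMod.card, nsmul_eq_mul,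
      Nat.cast_sub hp.one_le, Nat.cast_one]
  ring

end LocalDensity

section DensitySum

open Polynomial

theorem squarefree_reflect {K : Type*} [Field K] {f : K[X]} (hf : f.natDegree = 3 ∨ f.natDegree = 4)
    (h : Squarefree f) : Squarefree (reflect 4 f) := by
  rintro g ⟨q, hq⟩
  have hf0 : f ≠ 0 := h.ne_zero
  have hr0 : reflect 4 f ≠ 0 := fun h0 => hf0 ((reflect_eq_zero_iff).1 h0)
  have hg0 : g ≠ 0 := fun h0 => hr0 (by rw [hq, h0]; simp)
  have hq0 : q ≠ 0 := fun h0 => hr0 (by rw [hq, h0]; simp)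
  have hdeg : g.natDegree + g.natDegree + q.natDegree ≤ 4 := by
    rw [← natDegree_mul hg0 hg0, ← natDegree_mul (mul_ne_zero hg0 hg0) hq0, ← hq]
    exact natDegree_reflect_le.trans (max_le le_rfl (by omega))
  have h1 : f = reflect g.natDegree g * reflect g.natDegree g *
      reflect (4 - (g.natDegree + g.natDegree)) q := by
    rw [← reflect_mul g g le_rfl le_rfl, ← reflect_mul (g * g) q
      (natDegree_mul_le) (by omega), ← hq, Nat.add_sub_cancel' (by omega), reflect_reflect]
  have hu : IsUnit (reflect g.natDegree g) := h _ ⟨_, h1⟩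
  obtain ⟨c, hc, hcg⟩ := Polynomial.isUnit_iff.1 hu
  have hg : g = C c * X ^ g.natDegree := by
    have := congrArg (reflect g.natDegree) hcg
    rw [reflect_reflect, reflect_C] at this
    exact this.symm
  rcases eq_or_ne g.natDegree 0 with h0 | h0
  · rw [hg, h0, pow_zero, mul_one]
    exact Polynomial.isUnit_C.2 hc
  · exfalso
    have h2 : X ^ 2 ∣ reflect 4 f := by
      have h3 : X ∣ g := by
        rw [hg]; exact (dvd_pow_self X h0).mul_left _
      rw [hq, sq]
      exact (mul_dvd_mul h3 h3).mul_right _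
    rw [X_pow_dvd_iff] at h2
    have h4 := h2 0 (by norm_num)
    have h5 := h2 1 (by norm_num)
    rw [coeff_reflect, revAt_le (by norm_num)] at h4 h5
    norm_num at h4 h5
    rcases hf with hf | hf
    · rw [← hf] at h5
      exact hf0 (leadingCoeff_eq_zero.1 h5)
    · rw [← hf] at h4
      exact hf0 (leadingCoeff_eq_zero.1 h4)

theorem map_reflect {R S : Type*} [Semiring R] [Semiring S] (φ : R →+* S) (N : ℕ) (f : R[X]) :
    (reflect N f).map φ = reflect N (f.map φ) := by
  ext i
  simp [coeff_reflect]

theorem exists_rootCount_eq_sum {f : ℤ[X]} (hf : Squarefree (f.map (Int.castRingHom ℚ))) {c : ℚ}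
    {ι : Type*} [Fintype ι] {g : ι → ℚ[X]}
    (hfac : f.map (Int.castRingHom ℚ) = C c * ∏ i, g i) :
    ∃ (N : ℕ) (G : ι → ℤ[X]), N ≠ 0 ∧
      (∀ i, ∃ d : ℤ, d ≠ 0 ∧ (G i).map (Int.castRingHom ℚ) = C (d : ℚ) * g i) ∧
      ∀ p : ℕ, p.Prime → ¬ p ∣ N → rootCount f p = ∑ i, rootCount (G i) p := by
  choose d G hd hG using fun i => exists_map_eq_C_mul (g i)
  obtain ⟨A, B, R, hR, h⟩ := exists_bezout_derivative hf
  have hf0 : f ≠ 0 := fun h0 => hf.ne_zero (by rw [h0, Polynomial.map_zero])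
  have hc : c ≠ 0 := fun h0 => hf.ne_zero (by rw [hfac, h0]; simp)
  obtain ⟨D, hD⟩ : ∃ D : ℤ, D = c.den * ∏ i, d i := ⟨_, rfl⟩
  have hD0 : D ≠ 0 := hD ▸ mul_ne_zero (by exact_mod_cast c.den_nz)
    (Finset.prod_ne_zero_iff.2 fun i _ => hd i)
  have hprod : C D * f = C c.num * ∏ i, G i := by
    apply Polynomial.map_injective (Int.castRingHom ℚ) Int.cast_injective
    rw [Polynomial.map_mul, Polynomial.map_mul, Polynomial.map_prod, Finset.prod_congr rfl
      fun i _ => hG i, Finset.prod_mul_distrib, hfac, Polynomial.map_C, Polynomial.map_C,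
      ← map_prod, ← mul_assoc, ← mul_assoc, ← C_mul, ← C_mul]
    congr 2
    have : (c.num : ℚ) = c * c.den := (Rat.mul_den_eq_num c).symm
    simp only [hD, eq_intCast, Int.cast_mul, Int.cast_prod, Int.cast_natCast, this]
    ring
  refine ⟨(R * c.num * D).natAbs, G, Int.natAbs_ne_zero.2 (mul_ne_zero
    (mul_ne_zero hR (Rat.num_ne_zero.2 hc)) hD0), fun i => ⟨d i, hd i, hG i⟩,
    fun p hp hpN => ?_⟩
  have := Fact.mk hp
  rw [← Int.natCast_dvd, (Nat.prime_iff_prime_int.1 hp).dvd_mul,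
    (Nat.prime_iff_prime_int.1 hp).dvd_mul, not_or, not_or] at hpN
  obtain ⟨⟨hpR, hpc⟩, hpd⟩ := hpN
  have hcast : ∀ m : ℤ, ¬ (p : ℤ) ∣ m → (m : ZMod p) ≠ 0 := fun m hm h0 =>
    hm ((ZMod.intCast_zmod_eq_zero_iff_dvd _ _).1 h0)
  have hev : ∀ x : ZMod p, (D : ZMod p) * aeval x f =
      (c.num : ZMod p) * ∏ i, aeval x (G i) := fun x => by
    have := congrArg (aeval x) hprod
    rw [map_mul, map_mul, map_prod, aeval_C, aeval_C] at this
    simpa only [algebraMap_int_eq, eq_intCast] using this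
  have hiff : ∀ x : ZMod p, aeval x f = 0 ↔ ∃ i, aeval x (G i) = 0 := fun x => by
    have h1 := hev x
    constructor
    · intro h0
      rw [h0, mul_zero] at h1
      have := (mul_eq_zero.1 h1.symm).resolve_left (hcast _ hpc)
      obtain ⟨i, -, hi⟩ := Finset.prod_eq_zero_iff.1 this
      exact ⟨i, hi⟩
    · rintro ⟨i, hi⟩
      rw [Finset.prod_eq_zero (f := fun i => aeval x (G i)) (Finset.mem_univ i) hi, mul_zero] at h1
      exact (mul_eq_zero.1 h1).resolve_left (hcast _ hpd)
  have hdisj : ∀ x : ZMod p, ∀ i j, i ≠ j → aeval x (G i) = 0 → aeval x (G j) = 0 → False := by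
    classical
    intro x i j hij hi hj
    have h1 := congrArg (aeval x) (congrArg derivative hprod)
    have h2 : aeval x f = 0 := (hiff x).2 ⟨i, hi⟩
    have h3 : aeval x (derivative (∏ i, G i)) = 0 := by
      rw [derivative_prod_finset, map_sum]
      refine Finset.sum_eq_zero fun l _ => ?_
      rw [map_mul, map_prod]
      rcases eq_or_ne l i with rfl | hl
      · rw [Finset.prod_eq_zero (Finset.mem_erase.2 ⟨hij.symm, Finset.mem_univ j⟩) hj, zero_mul]
      · rw [Finset.prod_eq_zero (Finset.mem_erase.2 ⟨hl.symm, Finset.mem_univ i⟩) hi, zero_mul]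
    rw [derivative_C_mul, derivative_C_mul, map_mul, map_mul, h3, mul_zero, aeval_C] at h1
    have h4 : aeval x (derivative f) = 0 :=
      (mul_eq_zero.1 h1).resolve_left (by simpa only [algebraMap_int_eq, eq_intCast] using hcast _ hpd)
    have h5 := congrArg (aeval x) h
    rw [map_add, map_mul, map_mul, h2, h4, mul_zero, mul_zero, add_zero, aeval_C] at h5
    exact hcast R hpR (by simpa using h5.symm)
  classical
  simp only [rootCount, Nat.card_eq_fintype_card, Fintype.card_subtype]
  rw [← Finset.card_biUnion]
  · congr 1
    ext x
    simp [hiff]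
  · intro i _ j _ hij
    exact Finset.disjoint_left.2 fun x hx hx' => hdisj x i j hij (Finset.mem_filter.1 hx).2
      (Finset.mem_filter.1 hx').2

theorem rootCount_X {p : ℕ} : rootCount X p = 1 := by
  simp [rootCount]

theorem not_isSquare_adjoinRoot_X {a : ℤ} (ha : ¬ IsSquare a) :
    ¬ IsSquare (a : AdjoinRoot (X : ℚ[X])) := fun h => ha (by
  have h1 := h.map (AdjoinRoot.lift (RingHom.id ℚ) 0 (by simp))
  rw [map_intCast] at h1
  exact Rat.isSquare_intCast_iff.1 h1)

theorem exists_sum_sqCount_div_le {a : ℤ} (ha : ¬ IsSquare a) :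
    ∃ C : ℝ, ∀ Y : ℕ, 2 ≤ Y → ∑ p ∈ Y.primesLE, ((sqCount a p : ℝ) - 1) / p ≤ C := by
  obtain ⟨C, hC⟩ := exists_sum_sqCount_mul_rootCount_le a (G := X) (g := X) irreducible_X
    one_ne_zero (by simp)
  refine ⟨C, fun Y hY => ?_⟩
  have := hC Y hY
  rw [if_neg (not_isSquare_adjoinRoot_X ha), zero_mul, zero_add] at this
  simpa [rootCount_X] using this

theorem exists_sum_density_le {a : ℤ} (ha : ¬ IsSquare a) {f : ℤ[X]}
    (hdeg : f.natDegree = 3 ∨ f.natDegree = 4)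
    (hf : Squarefree (f.map (Int.castRingHom ℚ))) {c : ℚ} {r : ℕ} {g : Fin r → ℚ[X]}
    (hirr : ∀ i, Irreducible (g i)) (hfac : f.map (Int.castRingHom ℚ) = C c * ∏ i, g i) :
    ∃ C : ℝ, ∀ Y : ℕ, 2 ≤ Y →
      ∑ p ∈ Y.primesLE, ((sqCount a p : ℝ) - 1) * meanTwo p (primInd f p) ≤
        Nat.card {i : Fin r // IsSquare (a : AdjoinRoot (g i))} * Real.log (Real.log Y) + C := by
  classical
  obtain ⟨N, G, hN, hG, hroot⟩ := exists_rootCount_eq_sum hf hfac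
  obtain ⟨A, B, R, hR, hbez⟩ := exists_bezout_derivative hf
  have hf0 : f ≠ 0 := fun h0 => hf.ne_zero (by rw [h0, Polynomial.map_zero])
  choose d hd hGd using hG
  choose K hK using fun i => exists_sum_sqCount_mul_rootCount_le a (hirr i)
    (Int.cast_ne_zero.2 (hd i)) (hGd i)
  obtain ⟨K₁, hK₁⟩ := exists_sum_sqCount_div_le ha
  let δ : ℝ := if f.natDegree = 3 then 1 else 0
  have hδ : 0 ≤ δ := by simp only [δ]; split_ifs <;> norm_num
  obtain ⟨K₂, hK₂⟩ := exists_sum_primesLE_le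
    (b := fun p => ((sqCount a p : ℝ) - 1) * meanTwo p (primInd f p))
    (b' := fun p => ∑ i, ((sqCount a p : ℝ) - 1) * rootCount (G i) p / p +
      δ * (((sqCount a p : ℝ) - 1) / p) + 5 * (1 / (p : ℝ) ^ 2))
    (N := N * R.natAbs * f.leadingCoeff.natAbs) (mul_ne_zero (mul_ne_zero hN
      (Int.natAbs_ne_zero.2 hR)) (Int.natAbs_ne_zero.2 (leadingCoeff_ne_zero.2 hf0)))
    (fun p hp hpN => by
      rw [hp.dvd_mul, hp.dvd_mul, not_or, not_or, ← Int.natCast_dvd, ← Int.natCast_dvd] at hpN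
      obtain ⟨⟨hpN, hpR⟩, hpl⟩ := hpN
      have hp0 : (0 : ℝ) < p := by exact_mod_cast hp.pos
      have hι : (if (p : ℤ) ∣ f.coeff 4 then (1 : ℝ) else 0) = δ := by
        simp only [δ]
        rcases hdeg with h | h
        · rw [if_pos h, coeff_eq_zero_of_natDegree_lt (by omega), if_pos (dvd_zero _)]
        · rw [leadingCoeff, h] at hpl
          rw [if_neg hpl, if_neg (by omega)]
      have hν : (rootCount f p : ℝ) ≤ 4 := by
        have := rootCount_le_natDegree hp (map_ne_zero_of_bezout hbez hpR)
        exact_mod_cast this.trans (by omega)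
      have hδ1 : δ ≤ 1 := by simp only [δ]; split_ifs <;> norm_num
      have hc0 : (0 : ℝ) ≤ sqCount a p := Nat.cast_nonneg _
      rw [meanTwo_primInd_prime f (by omega) hp, hι, ← Finset.sum_div, ← Finset.mul_sum]
      have hs : (rootCount f p : ℝ) = ∑ i, (rootCount (G i) p : ℝ) := by
        rw [hroot p hp hpN]; push_cast; rfl
      rw [← hs]
      have hν0 : (0 : ℝ) ≤ rootCount f p := Nat.cast_nonneg _
      have : ((sqCount a p : ℝ) - 1) * ((p - 1) * (rootCount f p + δ) / p ^ 2) =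
          ((sqCount a p : ℝ) - 1) * rootCount f p / p + δ * (((sqCount a p : ℝ) - 1) / p) +
          (1 - sqCount a p) * (rootCount f p + δ) * (1 / p ^ 2) := by
        field_simp
        ring
      rw [this]
      gcongr
      nlinarith [mul_nonneg hc0 (add_nonneg hν0 hδ)])
  refine ⟨∑ i, K i + δ * K₁ + 5 * ∑' n : ℕ, 1 / (n : ℝ) ^ 2 + K₂, fun Y hY => ?_⟩
  have h1 := hK₂ Y
  rw [Finset.sum_add_distrib, Finset.sum_add_distrib, Finset.sum_comm, ← Finset.mul_sum,
    ← Finset.mul_sum] at h1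
  have h2 : ∑ i, ∑ p ∈ Y.primesLE, ((sqCount a p : ℝ) - 1) * rootCount (G i) p / p ≤
      Nat.card {i : Fin r // IsSquare (a : AdjoinRoot (g i))} * Real.log (Real.log Y) +
        ∑ i, K i := by
    refine (Finset.sum_le_sum fun i _ => hK i Y hY).trans (le_of_eq ?_)
    rw [Finset.sum_add_distrib, ← Finset.sum_mul, Finset.sum_boole, Nat.card_eq_fintype_card,
      Fintype.card_subtype]
  have h3 := mul_le_mul_of_nonneg_left (hK₁ Y hY) hδ
  have h4 := sum_inv_sq_le Y.primesLE
  linarith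

end DensitySum

section SmoothSum

open Finset

/-- The multiplicative function with value `φ p k` at the prime power `p ^ k`. -/
noncomputable def primeProd (φ : ℕ → ℕ → ℝ) (n : ℕ) : ℝ :=
  ∏ p ∈ n.primeFactors, φ p (n.factorization p)

theorem primeProd_one (φ : ℕ → ℕ → ℝ) : primeProd φ 1 = 1 := by simp [primeProd]

theorem primeProd_mul (φ : ℕ → ℕ → ℝ) {m n : ℕ} (h : m.Coprime n) :
    primeProd φ (m * n) = primeProd φ m * primeProd φ n := by
  classical
  unfold primeProd
  rw [h.primeFactors_mul, prod_union h.disjoint_primeFactors, Nat.factorization_mul_of_coprime h]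
  congr 1
  · refine prod_congr rfl fun p hp => ?_
    have : n.factorization p = 0 := by
      rw [← Finsupp.notMem_support_iff, Nat.support_factorization]
      exact Finset.disjoint_left.1 h.disjoint_primeFactors hp
    simp [this]
  · refine prod_congr rfl fun p hp => ?_
    have : m.factorization p = 0 := by
      rw [← Finsupp.notMem_support_iff, Nat.support_factorization]
      exact Finset.disjoint_right.1 h.disjoint_primeFactors hp
    simp [this]

theorem primeProd_prime_pow (φ : ℕ → ℕ → ℝ) {p k : ℕ} (hp : p.Prime) (hk : k ≠ 0) :
    primeProd φ (p ^ k) = φ p k := by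
  rw [primeProd, Nat.primeFactors_prime_pow hk hp, prod_singleton, hp.factorization_pow]
  simp

theorem primeProd_nonneg {φ : ℕ → ℕ → ℝ} (h : ∀ p k, 0 ≤ φ p k) (n : ℕ) : 0 ≤ primeProd φ n :=
  prod_nonneg fun _ _ => h _ _

theorem one_le_primeProd {φ : ℕ → ℕ → ℝ} (h : ∀ p k, p.Prime → 1 ≤ φ p k) (n : ℕ) :
    1 ≤ primeProd φ n := by
  rw [primeProd, ← prod_const_one (s := n.primeFactors)]
  exact prod_le_prod (fun _ _ => zero_le_one) fun p hp => h p _ (Nat.prime_of_mem_primeFactors hp)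

/-- The value at `p ^ k` of a multiplicative weight of divisor type, equal to `c p` at the primes
`p > p₀`. -/
noncomputable def locWeight (p₀ : ℕ) (M : ℝ) (c : ℕ → ℝ) (p k : ℕ) : ℝ :=
  if k = 0 then 1 else if p ≤ p₀ then M * (k + 1) else if k = 1 then c p else k + 1

theorem locWeight_nonneg {p₀ : ℕ} {M : ℝ} {c : ℕ → ℝ} (hM : 0 ≤ M) (hc : ∀ p, 0 ≤ c p) (p k : ℕ) :
    0 ≤ locWeight p₀ M c p k := by
  unfold locWeight
  have := hc p
  split_ifs <;> positivity

/-- The properties of the density of the values of a binary form divisible by `n`. -/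
structure IsFormDensity (g : ℕ → ℝ) (C₀ : ℝ) (p₀ : ℕ) : Prop where
  nonneg : ∀ n, 0 ≤ g n
  map_one : g 1 = 1
  map_mul : ∀ {m n : ℕ}, m.Coprime n → g (m * n) = g m * g n
  prime_pow_le : ∀ p k : ℕ, p.Prime → g (p ^ k) ≤ C₀ / (p : ℝ) ^ k
  prime_le : ∀ p : ℕ, p.Prime → p₀ < p → g p ≤ 1 / 2

/-- The value at `p ^ k` of the inverse of the sifting density. -/
noncomputable def locSift (p₀ : ℕ) (g : ℕ → ℝ) (p _k : ℕ) : ℝ :=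
  if p₀ < p then (1 - g p)⁻¹ else 1

theorem sum_smooth_le_prod_tsum {φ : ℕ → ℝ} (h0 : ∀ n, 0 ≤ φ n) (h1 : φ 1 = 1)
    (hmul : ∀ {m n : ℕ}, m.Coprime n → φ (m * n) = φ m * φ n)
    (hsum : ∀ {p : ℕ}, p.Prime → Summable fun k : ℕ => φ (p ^ k)) (n : ℕ) (S : Finset ℕ)
    (hS : ∀ a ∈ S, ∀ p, p.Prime → p ∣ a → p ≤ n) :
    ∑ a ∈ S, φ a ≤ ∏ p ∈ n.primesLE, ∑' k : ℕ, φ (p ^ k) := by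
  have hs : ∀ {p : ℕ}, p.Prime → Summable fun k : ℕ => ‖φ (p ^ k)‖ := fun hp => (hsum hp).norm
  obtain ⟨-, h2⟩ := EulerProduct.summable_and_hasSum_smoothNumbers_prod_primesBelow_tsum h1 hmul hs
    (n + 1)
  change _ ≤ ∏ p ∈ (n + 1).primesBelow, ∑' k : ℕ, φ (p ^ k)
  have hS' : ∀ a ∈ S, a ∈ (n + 1).smoothNumbers := fun a ha =>
    Nat.mem_smoothNumbers'.2 fun p hp hpa => Nat.lt_succ_of_le (hS a ha p hp hpa)
  have h3 := sum_le_hasSum (S.subtype (· ∈ (n + 1).smoothNumbers)) (fun i _ => h0 i) h2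
  rwa [Finset.sum_subtype_of_mem (f := φ) hS'] at h3

theorem tsum_le_of_geometric {f : ℕ → ℝ} {D x r : ℝ} (hx : 0 ≤ x) (hxr : x ≤ r) (hr : r < 1)
    (hD : 0 ≤ D) (h0 : ∀ k, 0 ≤ f k) (h : ∀ k, f k ≤ D * (k + 1) * x ^ k) :
    Summable f ∧ ∑' k, f k ≤ f 0 + f 1 + D * x ^ 2 * ∑' k : ℕ, ((k : ℝ) + 3) * r ^ k := by
  have hr0 : 0 ≤ r := hx.trans hxr
  have hrn : ‖r‖ < 1 := by rwa [Real.norm_of_nonneg hr0]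
  have hs : ∀ b : ℝ, Summable fun k : ℕ => ((k : ℝ) + b) * r ^ k := fun b => by
    have h1 := summable_pow_mul_geometric_of_norm_lt_one 1 hrn
    have h2 := (summable_geometric_of_norm_lt_one hrn).mul_left b
    refine (h1.add h2).congr fun k => by ring
  have hle : ∀ k, f k ≤ D * (((k : ℝ) + 1) * r ^ k) := fun k => by
    refine (h k).trans ?_
    rw [mul_assoc]
    gcongr
  have hsf : Summable f := Summable.of_nonneg_of_le h0 hle ((hs 1).mul_left D)
  refine ⟨hsf, ?_⟩
  rw [← hsf.sum_add_tsum_nat_add 2, sum_range_succ, sum_range_one]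
  gcongr
  rw [← tsum_mul_left]
  refine Summable.tsum_le_tsum (fun k => ?_) ((summable_nat_add_iff 2).2 hsf) ((hs 3).mul_left _)
  refine (h (k + 2)).trans ?_
  have : x ^ (k + 2) ≤ x ^ 2 * r ^ k := by
    rw [pow_add, mul_comm]; gcongr
  push_cast
  calc D * ((k : ℝ) + 2 + 1) * x ^ (k + 2) ≤ D * ((k : ℝ) + 2 + 1) * (x ^ 2 * r ^ k) := by gcongr
    _ = _ := by ring

end SmoothSum

section WeightedSum

open Finset

variable {g : ℕ → ℝ} {C₀ : ℝ} {p₀ : ℕ} {M : ℝ} {c : ℕ → ℝ}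

theorem IsFormDensity.one_le (hg : IsFormDensity g C₀ p₀) : 1 ≤ C₀ := by
  have := hg.prime_pow_le 2 0 Nat.prime_two
  simpa [hg.map_one] using this

theorem IsFormDensity.mul_rpow_le (hg : IsFormDensity g C₀ p₀) {p : ℕ} (hp : p.Prime) (k : ℕ)
    {κ : ℝ} (hκ : κ ≤ 1 / 8) :
    g (p ^ k) * ((p ^ k : ℕ) : ℝ) ^ κ ≤ C₀ * ((p : ℝ) ^ (-(7 / 8) : ℝ)) ^ k := by
  have hp0 : (0 : ℝ) < p := by exact_mod_cast hp.pos
  have hp1 : (1 : ℝ) ≤ p := by exact_mod_cast hp.one_lt.le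
  have hC := hg.one_le
  calc g (p ^ k) * ((p ^ k : ℕ) : ℝ) ^ κ ≤ C₀ / (p : ℝ) ^ k * ((p ^ k : ℕ) : ℝ) ^ κ := by
        gcongr
        exact hg.prime_pow_le p k hp
    _ = C₀ * ((p : ℝ) ^ (κ - 1)) ^ k := by
        rw [Real.rpow_sub_one hp0.ne', div_pow, Real.rpow_pow_comm hp0.le]
        push_cast
        ring
    _ ≤ _ := by
        gcongr
        linarith

/-- The summand of the weighted sums over smooth numbers. -/
noncomputable def weightTerm (p₀ : ℕ) (M : ℝ) (c g : ℕ → ℝ) (κ : ℝ) (a : ℕ) : ℝ :=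
  primeProd (locWeight p₀ M c) a * g a * primeProd (locSift p₀ g) a * (a : ℝ) ^ κ

theorem locSift_nonneg (hg : IsFormDensity g C₀ p₀) {p : ℕ} (hp : p.Prime) (k : ℕ) :
    1 ≤ locSift p₀ g p k ∧ locSift p₀ g p k ≤ 2 := by
  unfold locSift
  split_ifs with h
  · have h1 := hg.prime_le p hp h
    have h2 := hg.nonneg p
    have h3 : 0 < 1 - g p := by linarith
    refine ⟨(one_le_inv₀ h3).2 (by linarith), ?_⟩
    rw [inv_le_comm₀ h3 (by norm_num)]
    linarith
  · norm_num

theorem primeProd_locSift_nonneg (hg : IsFormDensity g C₀ p₀) (n : ℕ) :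
    0 ≤ primeProd (locSift p₀ g) n :=
  prod_nonneg fun _ hp =>
    zero_le_one.trans (locSift_nonneg hg (Nat.prime_of_mem_primeFactors hp) _).1

theorem weightTerm_nonneg (hg : IsFormDensity g C₀ p₀) (hM : 0 ≤ M) (hc : ∀ p, 0 ≤ c p) (κ : ℝ)
    (n : ℕ) : 0 ≤ weightTerm p₀ M c g κ n := by
  have h1 := primeProd_nonneg (locWeight_nonneg (p₀ := p₀) hM hc) n
  have h2 := hg.nonneg n
  have h3 := primeProd_locSift_nonneg hg n
  unfold weightTerm
  positivity

theorem weightTerm_one (hg : IsFormDensity g C₀ p₀) (κ : ℝ) : weightTerm p₀ M c g κ 1 = 1 := by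
  simp [weightTerm, primeProd_one, hg.map_one]

theorem weightTerm_mul (hg : IsFormDensity g C₀ p₀) (κ : ℝ) {m n : ℕ} (h : m.Coprime n) :
    weightTerm p₀ M c g κ (m * n) = weightTerm p₀ M c g κ m * weightTerm p₀ M c g κ n := by
  unfold weightTerm
  rw [primeProd_mul _ h, primeProd_mul _ h, hg.map_mul h, Nat.cast_mul,
    Real.mul_rpow (Nat.cast_nonneg m) (Nat.cast_nonneg n)]
  ring

theorem locWeight_le (hM : 0 ≤ M) (hc2 : ∀ p, p.Prime → c p ≤ 2) {p : ℕ} (hp : p.Prime) (k : ℕ) :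
    locWeight p₀ M c p k ≤ (M + 1) * (k + 1) := by
  have hk0 : (0 : ℝ) ≤ k := Nat.cast_nonneg k
  unfold locWeight
  split_ifs with h h' h''
  · nlinarith
  · nlinarith
  · have := hc2 p hp
    subst h''
    push_cast
    nlinarith
  · nlinarith

theorem weightTerm_prime_pow_le (hg : IsFormDensity g C₀ p₀) (hM : 0 ≤ M) (hc : ∀ p, 0 ≤ c p)
    (hc2 : ∀ p, p.Prime → c p ≤ 2) {κ : ℝ} (hκ : κ ≤ 1 / 8) {p : ℕ} (hp : p.Prime) (k : ℕ) :
    weightTerm p₀ M c g κ (p ^ k) ≤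
      (2 * (M + 1) * C₀) * (k + 1) * ((p : ℝ) ^ (-(7 / 8) : ℝ)) ^ k := by
  have hC := hg.one_le
  rcases Nat.eq_zero_or_pos k with rfl | hk
  · rw [pow_zero, weightTerm_one hg]
    simp only [pow_zero, Nat.cast_zero]
    nlinarith
  have h1 := hg.mul_rpow_le hp k hκ
  have h2 := locSift_nonneg hg hp k
  have h3 := locWeight_le (p₀ := p₀) hM hc2 hp k
  have h4 := locWeight_nonneg (p₀ := p₀) hM hc p k
  have h5 := hg.nonneg (p ^ k)
  unfold weightTerm
  rw [primeProd_prime_pow _ hp hk.ne', primeProd_prime_pow _ hp hk.ne']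
  calc locWeight p₀ M c p k * g (p ^ k) * locSift p₀ g p k * ((p ^ k : ℕ) : ℝ) ^ κ
      = locWeight p₀ M c p k * locSift p₀ g p k * (g (p ^ k) * ((p ^ k : ℕ) : ℝ) ^ κ) := by ring
    _ ≤ (M + 1) * (k + 1) * 2 * (C₀ * ((p : ℝ) ^ (-(7 / 8) : ℝ)) ^ k) := by
        gcongr
        · linarith [h2.1]
        · exact h2.2
    _ = _ := by ring

theorem weightTerm_prime_le (hg : IsFormDensity g C₀ p₀) (hc : ∀ p, 0 ≤ c p)
    (hc2 : ∀ p, p.Prime → c p ≤ 2) {κ A : ℝ} (hκ0 : 0 ≤ κ) {p : ℕ} (hp : p.Prime)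
    (hp₀ : p₀ < p) (hA : κ * Real.log p ≤ A) :
    weightTerm p₀ M c g κ p ≤ c p * g p + 4 * C₀ * Real.exp A * (κ * (Real.log p / p)) +
      4 * C₀ ^ 2 * ((p : ℝ) ^ (-(7 / 8) : ℝ)) ^ 2 := by
  have hC := hg.one_le
  have hp0 : (0 : ℝ) < p := by exact_mod_cast hp.pos
  have hp1 : (1 : ℝ) ≤ p := by exact_mod_cast hp.one_lt.le
  have hlog : 0 ≤ Real.log p := Real.log_nonneg hp1
  set G := g p with hG
  have hG0 : 0 ≤ G := hg.nonneg p
  have hG1 : G ≤ 1 / 2 := hg.prime_le p hp hp₀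
  have hG2 : G ≤ C₀ * (1 / p) := by
    have := hg.prime_pow_le p 1 hp
    simpa [div_eq_mul_inv] using this
  have hx : (1 : ℝ) / p ^ 2 ≤ ((p : ℝ) ^ (-(7 / 8) : ℝ)) ^ 2 := by
    have : (1 : ℝ) / p ≤ (p : ℝ) ^ (-(7 / 8) : ℝ) := by
      rw [one_div, ← Real.rpow_neg_one]
      exact Real.rpow_le_rpow_of_exponent_le hp1 (by norm_num)
    calc (1 : ℝ) / p ^ 2 = (1 / p) ^ 2 := by ring
      _ ≤ _ := by gcongr
  have hsift : (1 - G)⁻¹ ≤ 1 + 2 * G := by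
    rw [inv_le_iff_one_le_mul₀ (by linarith)]
    nlinarith
  have hsift0 : 0 ≤ (1 - G)⁻¹ := inv_nonneg.2 (by linarith)
  have hpow : (p : ℝ) ^ κ ≤ 1 + κ * Real.log p * Real.exp A := by
    rw [Real.rpow_def_of_pos hp0, mul_comm (Real.log p)]
    set x := κ * Real.log p with hxd
    have hx0 : 0 ≤ x := by positivity
    have h1 : Real.exp x ≤ 1 + x * Real.exp x := by
      have h2 := Real.add_one_le_exp (-x)
      rw [Real.exp_neg] at h2
      have h3 := Real.exp_pos x
      have h4 := mul_le_mul_of_nonneg_right h2 h3.le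
      rw [inv_mul_cancel₀ h3.ne'] at h4
      linarith
    have h5 : Real.exp x ≤ Real.exp A := Real.exp_le_exp.2 hA
    nlinarith
  have hW : weightTerm p₀ M c g κ p = c p * G * (1 - G)⁻¹ * (p : ℝ) ^ κ := by
    have h1 := primeProd_prime_pow (locWeight p₀ M c) hp one_ne_zero
    have h2 := primeProd_prime_pow (locSift p₀ g) hp one_ne_zero
    rw [pow_one] at h1 h2
    rw [weightTerm, h1, h2]
    simp [locWeight, locSift, hp₀, Nat.not_le.2 hp₀, hG]
  have hcp := hc p
  have hcp2 := hc2 p hp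
  set E := Real.exp A
  have hE : 0 < E := Real.exp_pos A
  rw [hW]
  calc c p * G * (1 - G)⁻¹ * (p : ℝ) ^ κ
      ≤ c p * G * (1 + 2 * G) * (1 + κ * Real.log p * E) := by gcongr
    _ = c p * G + c p * 2 * G ^ 2 + c p * (1 + 2 * G) * (κ * Real.log p * E) * G := by ring
    _ ≤ c p * G + 2 * 2 * (C₀ * (1 / p)) ^ 2 +
          2 * (1 + 2 * (1 / 2)) * (κ * Real.log p * E) * (C₀ * (1 / p)) := by gcongr
    _ = c p * G + 4 * C₀ * E * (κ * (Real.log p / p)) + 4 * C₀ ^ 2 * (1 / p ^ 2) := by ring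
    _ ≤ _ := by gcongr

end WeightedSum

section WeightedSumBound

open Finset

variable {g : ℕ → ℝ} {C₀ : ℝ} {p₀ : ℕ} {M : ℝ} {c : ℕ → ℝ}

theorem sum_weightTerm_le_exp (hg : IsFormDensity g C₀ p₀) (hM : 0 ≤ M) (hc : ∀ p, 0 ≤ c p)
    (hc2 : ∀ p, p.Prime → c p ≤ 2) {A : ℝ} (hA : 0 ≤ A) :
    ∃ C, 0 ≤ C ∧ ∀ n : ℕ, 1 ≤ n → ∀ κ : ℝ, 0 ≤ κ → κ ≤ 1 / 8 → κ * Real.log n ≤ A →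
      ∀ S : Finset ℕ, (∀ a ∈ S, ∀ p, p.Prime → p ∣ a → p ≤ n) →
      ∑ a ∈ S, weightTerm p₀ M c g κ a ≤
        Real.exp (∑ p ∈ n.primesLE with p₀ < p, c p * g p + C) := by
  have hC := hg.one_le
  obtain ⟨C₁, hC₁, hlog⟩ := sum_log_div_prime_le
  set r : ℝ := (2 : ℝ) ^ (-(7 / 8) : ℝ) with hr
  have hr1 : r < 1 := Real.rpow_lt_one_of_one_lt_of_neg (by norm_num) (by norm_num)
  have hr0 : 0 ≤ r := by positivity
  set T : ℝ := ∑' k : ℕ, ((k : ℝ) + 3) * r ^ k with hT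
  have hT0 : 0 ≤ T := tsum_nonneg fun k => by positivity
  set D : ℝ := 2 * (M + 1) * C₀ with hD
  have hD0 : 0 ≤ D := by positivity
  set Z : ℝ := ∑' n : ℕ, 1 / (n : ℝ) ^ (7 / 4 : ℝ) with hZ
  have hZs : Summable fun n : ℕ => 1 / (n : ℝ) ^ (7 / 4 : ℝ) :=
    Real.summable_one_div_nat_rpow.2 (by norm_num)
  set E := Real.exp A
  have hE : 0 < E := Real.exp_pos A
  set B : ℕ → ℝ := fun p => if p ≤ p₀ then 2 * D + D * T else 0 with hB
  set K₁ := 4 * C₀ * E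
  have hK₁ : 0 ≤ K₁ := by positivity
  set K₂ := 4 * C₀ ^ 2 + D * T
  have hK₂ : 0 ≤ K₂ := by positivity
  refine ⟨(p₀ + 1) * (2 * D + D * T) + K₁ * (A + C₁ / 8) + K₂ * Z, by
    have : 0 ≤ Z := tsum_nonneg fun k => by positivity
    positivity, fun n hn κ hκ0 hκ hκA S hS => ?_⟩
  have hx : ∀ p : ℕ, p.Prime → (p : ℝ) ^ (-(7 / 8) : ℝ) ≤ r := fun p hp => by
    have h2 : (2 : ℝ) ≤ p := by exact_mod_cast hp.two_le
    exact Real.rpow_le_rpow_of_nonpos (by norm_num) h2 (by norm_num)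
  have hx2 : ∀ p : ℕ, ((p : ℝ) ^ (-(7 / 8) : ℝ)) ^ 2 = 1 / (p : ℝ) ^ (7 / 4 : ℝ) := fun p => by
    rw [← Real.rpow_natCast, ← Real.rpow_mul (Nat.cast_nonneg p), one_div,
      ← Real.rpow_neg (Nat.cast_nonneg p)]
    norm_num
  have hloc : ∀ p : ℕ, p.Prime → (Summable fun k => weightTerm p₀ M c g κ (p ^ k)) ∧
      ∑' k, weightTerm p₀ M c g κ (p ^ k) ≤ 1 + weightTerm p₀ M c g κ p +
        D * ((p : ℝ) ^ (-(7 / 8) : ℝ)) ^ 2 * T := fun p hp => by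
    have h1 := tsum_le_of_geometric (f := fun k => weightTerm p₀ M c g κ (p ^ k)) (by positivity)
      (hx p hp) hr1 hD0 (fun k => weightTerm_nonneg hg hM hc κ _)
      (fun k => weightTerm_prime_pow_le hg hM hc hc2 hκ hp k)
    simpa only [pow_zero, pow_one, weightTerm_one hg] using h1
  have h1 := sum_smooth_le_prod_tsum (weightTerm_nonneg hg hM hc κ) (weightTerm_one hg κ)
    (fun h => weightTerm_mul hg κ h) (fun hp => (hloc _ hp).1) n S hS
  refine h1.trans ?_
  have h2 : ∀ p ∈ n.primesLE, ∑' k, weightTerm p₀ M c g κ (p ^ k) ≤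
      Real.exp ((if p₀ < p then c p * g p else 0) + B p + K₁ * (κ * (Real.log p / p)) +
        K₂ * (1 / (p : ℝ) ^ (7 / 4 : ℝ))) := fun p hp => by
    rw [Nat.mem_primesLE] at hp
    have hp1 : (1 : ℝ) ≤ p := by exact_mod_cast hp.2.one_lt.le
    have hlogp : 0 ≤ Real.log p := Real.log_nonneg hp1
    refine le_trans ?_ (Real.add_one_le_exp _)
    refine (hloc p hp.2).2.trans ?_
    have h3 := hx2 p
    simp only [hB]
    rcases lt_or_ge p₀ p with h | h
    · have h4 := weightTerm_prime_le (M := M) hg hc hc2 hκ0 hp.2 h (A := A) (by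
        refine le_trans ?_ hκA
        gcongr
        exact hp.1)
      rw [if_pos h, if_neg (by omega)]
      rw [h3] at h4 ⊢
      simp only [K₂, K₁, E]
      linarith
    · rw [if_neg (by omega), if_pos h]
      have h4 := weightTerm_prime_pow_le hg hM hc hc2 hκ hp.2 1
      have h5 := (hx p hp.2).trans hr1.le
      have h6 : ((p : ℝ) ^ (-(7 / 8) : ℝ)) ^ 2 ≤ 1 := pow_le_one₀ (by positivity) h5
      rw [pow_one, pow_one, ← hD] at h4
      have h7 : 0 ≤ K₁ * (κ * (Real.log p / p)) := by positivity
      have h8 : 0 ≤ K₂ * (1 / (p : ℝ) ^ (7 / 4 : ℝ)) := by positivity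
      have h9 : D * ((p : ℝ) ^ (-(7 / 8) : ℝ)) ^ 2 * T ≤ D * 1 * T := by gcongr
      have h10 : D * ((1 : ℕ) + 1) * (p : ℝ) ^ (-(7 / 8) : ℝ) ≤ D * ((1 : ℕ) + 1) * 1 := by gcongr
      push_cast at h10 h4
      linarith
  refine (prod_le_prod (fun p _ => tsum_nonneg fun k => weightTerm_nonneg hg hM hc κ _) h2).trans ?_
  rw [← Real.exp_sum, Real.exp_le_exp, sum_add_distrib, sum_add_distrib, sum_add_distrib,
    ← sum_filter, ← mul_sum, ← mul_sum, ← mul_sum]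
  have h3 : ∑ p ∈ n.primesLE, B p ≤ (p₀ + 1) * (2 * D + D * T) := by
    simp only [hB]
    rw [← sum_filter, sum_const, nsmul_eq_mul]
    gcongr
    have : #{p ∈ n.primesLE | p ≤ p₀} ≤ #(range (p₀ + 1)) := card_le_card fun p hp => by
      simp only [mem_filter] at hp
      simp only [mem_range]; omega
    rw [card_range] at this
    exact_mod_cast this
  have h4 : κ * ∑ p ∈ n.primesLE, Real.log p / p ≤ A + C₁ / 8 := by
    calc κ * ∑ p ∈ n.primesLE, Real.log p / p ≤ κ * (Real.log n + C₁) := by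
          gcongr
          exact hlog n hn
      _ = κ * Real.log n + κ * C₁ := by ring
      _ ≤ A + 1 / 8 * C₁ := by gcongr
      _ = _ := by ring
  have h5 : ∑ p ∈ n.primesLE, 1 / (p : ℝ) ^ (7 / 4 : ℝ) ≤ Z :=
    hZs.sum_le_tsum _ fun p _ => by positivity
  have h6 := mul_le_mul_of_nonneg_left h4 hK₁
  have h7 := mul_le_mul_of_nonneg_left h5 hK₂
  linarith

theorem prod_one_sub_mul_sum_weightTerm_le (hg : IsFormDensity g C₀ p₀) (hM : 0 ≤ M)
    (hc : ∀ p, 0 ≤ c p) (hc2 : ∀ p, p.Prime → c p ≤ 2) {m : ℕ}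
    (hm : ∃ C : ℝ, ∀ Y : ℕ, 2 ≤ Y → ∑ p ∈ Y.primesLE with p₀ < p, (c p - 1) * g p ≤
      m * Real.log (Real.log Y) + C) {A : ℝ} (hA : 0 ≤ A) :
    ∃ C, 0 ≤ C ∧ ∀ y : ℕ, 2 ≤ y → ∀ κ : ℝ, 0 ≤ κ → κ ≤ 1 / 8 → κ * Real.log y ≤ A →
      ∀ S : Finset ℕ, (∀ a ∈ S, ∀ p, p.Prime → p ∣ a → p ≤ y ^ 2) →
      (∏ p ∈ y.primesLE with p₀ < p, (1 - g p)) * ∑ a ∈ S, weightTerm p₀ M c g κ a ≤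
        C * Real.log y ^ m := by
  obtain ⟨C₁, hC₁, h1⟩ := sum_weightTerm_le_exp hg hM hc hc2 (A := 2 * A) (by positivity)
  obtain ⟨C₂, hC₂, h2⟩ := sum_inv_prime_Ioc_le
  obtain ⟨C₃, hm⟩ := hm
  have hC := hg.one_le
  refine ⟨Real.exp (C₁ + C₃ + 2 * C₀ * (2 + C₂ / Real.log 2)), (Real.exp_pos _).le,
    fun y hy κ hκ0 hκ hκA S hS => ?_⟩
  have hy1 : (1 : ℝ) < y := by exact_mod_cast hy
  have hl2 : 0 < Real.log 2 := Real.log_pos (by norm_num)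
  have hlog : 0 < Real.log y := Real.log_pos hy1
  have hl2y : Real.log 2 ≤ Real.log y := Real.log_le_log (by norm_num) (by exact_mod_cast hy)
  have hly : Real.log ((y ^ 2 : ℕ) : ℝ) = 2 * Real.log y := by push_cast; rw [Real.log_pow]; simp
  have h3 := h1 (y ^ 2) (Nat.one_le_pow _ _ (by omega)) κ hκ0 hκ (by rw [hly]; linarith) S hS
  have hV : ∏ p ∈ y.primesLE with p₀ < p, (1 - g p) ≤
      Real.exp (-∑ p ∈ y.primesLE with p₀ < p, g p) := by
    rw [← sum_neg_distrib, Real.exp_sum]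
    refine prod_le_prod (fun p hp => ?_) fun p hp => ?_
    · simp only [mem_filter, Nat.mem_primesLE] at hp
      linarith [hg.prime_le p hp.1.2 hp.2]
    · linarith [Real.add_one_le_exp (-g p)]
  have h4 : ∑ p ∈ (y ^ 2).primesLE with p₀ < p, c p * g p ≤
      ∑ p ∈ y.primesLE with p₀ < p, c p * g p + 2 * C₀ * (2 + C₂ / Real.log 2) := by
    have h5 : ∑ p ∈ (y ^ 2).primesLE with y < p, 2 * (C₀ * ((1 : ℝ) / p)) ≤
        2 * C₀ * (2 + C₂ / Real.log 2) := by
      rw [← mul_sum, ← mul_sum, ← mul_assoc]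
      gcongr
      refine (h2 y (y ^ 2) hy (Nat.one_le_pow _ _ (by omega))).trans ?_
      rw [hly, add_div, mul_div_assoc, div_self hlog.ne', mul_one]
      gcongr
    refine le_trans ?_ (add_le_add_right h5 _)
    have hnn : ∀ p, 0 ≤ c p * g p := fun p => mul_nonneg (hc p) (hg.nonneg p)
    calc ∑ p ∈ (y ^ 2).primesLE with p₀ < p, c p * g p
        ≤ ∑ p ∈ (y.primesLE.filter (p₀ < ·)) ∪ ((y ^ 2).primesLE.filter (y < ·)), c p * g p := by
          refine sum_le_sum_of_subset_of_nonneg (fun p hp => ?_) fun p _ _ => hnn p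
          simp only [mem_filter, Nat.mem_primesLE, mem_union] at hp ⊢
          rcases le_or_gt p y with h | h
          · exact Or.inl ⟨⟨h, hp.1.2⟩, hp.2⟩
          · exact Or.inr ⟨hp.1, h⟩
      _ ≤ ∑ p ∈ y.primesLE with p₀ < p, c p * g p + ∑ p ∈ (y ^ 2).primesLE with y < p, c p * g p :=
          sum_union_le_add _ _ fun p => hnn p
      _ ≤ _ := by
          gcongr with p hp
          · simp only [mem_filter, Nat.mem_primesLE] at hp
            have := hg.prime_pow_le p 1 hp.1.2
            exact hg.nonneg p
          · simp only [mem_filter, Nat.mem_primesLE] at hp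
            exact hc2 p hp.1.2
          · simp only [mem_filter, Nat.mem_primesLE] at hp
            have := hg.prime_pow_le p 1 hp.1.2
            simpa [div_eq_mul_inv] using this
  have h5 := hm y hy
  have h6 : ∑ p ∈ y.primesLE with p₀ < p, (c p - 1) * g p =
      ∑ p ∈ y.primesLE with p₀ < p, c p * g p - ∑ p ∈ y.primesLE with p₀ < p, g p := by
    rw [← sum_sub_distrib]
    exact sum_congr rfl fun p _ => by ring
  have hpos : 0 ≤ ∑ a ∈ S, weightTerm p₀ M c g κ a :=
    sum_nonneg fun a _ => weightTerm_nonneg hg hM hc κ a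
  refine (mul_le_mul hV h3 hpos (Real.exp_pos _).le).trans ?_
  rw [← Real.exp_add]
  have h7 : Real.log y ^ m = Real.exp (m * Real.log (Real.log y)) := by
    rw [Real.exp_nat_mul, Real.exp_log hlog]
  rw [h7, ← Real.exp_add, Real.exp_le_exp]
  linarith

end WeightedSumBound

section WeightBounds

open Finset

variable {p₀ : ℕ} {M : ℝ} {c : ℕ → ℝ}

theorem primeProd_eq_prod_of_subset {φ : ℕ → ℕ → ℝ} (h0 : ∀ p, φ p 0 = 1) {n : ℕ} {s : Finset ℕ}
    (hs : n.primeFactors ⊆ s) : primeProd φ n = ∏ p ∈ s, φ p (n.factorization p) := by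
  refine prod_subset hs fun p _ hp => ?_
  rw [← Nat.support_factorization, Finsupp.notMem_support_iff] at hp
  rw [hp, h0]

theorem locWeight_add_le (hc2 : ∀ p, p.Prime → c p ≤ 2) {p : ℕ} (hp : p.Prime)
    (hp₀ : p₀ < p) {j : ℕ} (hj : j ≠ 1) (k : ℕ) :
    locWeight p₀ M c p (j + k) ≤ locWeight p₀ M c p j * 2 ^ k := by
  have h2 : ∀ k : ℕ, (k : ℝ) + 1 ≤ 2 ^ k := fun k => by
    exact_mod_cast Nat.succ_le_of_lt Nat.lt_two_pow_self
  rcases Nat.eq_zero_or_pos k with rfl | hk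
  · simp
  have h3 : locWeight p₀ M c p (j + k) ≤ j + k + 1 := by
    unfold locWeight
    rw [if_neg (by omega), if_neg (by omega)]
    split_ifs with h
    · have : j = 0 ∧ k = 1 := by omega
      rw [this.1, this.2]
      have := hc2 p hp
      norm_num
      linarith
    · push_cast; linarith
  have h4 : locWeight p₀ M c p j = j + 1 := by
    unfold locWeight
    split_ifs with h h'
    · simp [h]
    · omega
    · rfl
  rw [h4]
  have h5 := h2 k
  have h6 : (1 : ℝ) ≤ 2 ^ k := one_le_pow₀ (by norm_num)
  have h7 : (0 : ℝ) ≤ j := Nat.cast_nonneg j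
  have h8 : (1 : ℝ) ≤ k := by exact_mod_cast hk
  nlinarith

theorem exists_primeProd_locWeight_mul_le (hM : 0 ≤ M) (hc : ∀ p, 0 ≤ c p)
    (hc2 : ∀ p, p.Prime → c p ≤ 2) {a b y : ℕ} (ha : a ≠ 0) (hb : b ≠ 0)
    (h : ∀ p, p.Prime → p ∣ b → p₀ < p ∧ y ≤ p ∧ a.factorization p ≠ 1) :
    ∃ n : ℕ, y ^ n ≤ b ∧
      primeProd (locWeight p₀ M c) (a * b) ≤ primeProd (locWeight p₀ M c) a * 2 ^ n := by
  have h0 : ∀ p, locWeight p₀ M c p 0 = 1 := fun p => by simp [locWeight]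
  refine ⟨∑ p ∈ b.primeFactors, b.factorization p, ?_, ?_⟩
  · conv_rhs => rw [← Nat.prod_factorization_pow_eq_self hb]
    rw [← prod_pow_eq_pow_sum, Finsupp.prod, Nat.support_factorization]
    exact prod_le_prod' fun p hp => Nat.pow_le_pow_left
      (h p (Nat.prime_of_mem_primeFactors hp) (Nat.dvd_of_mem_primeFactors hp)).2.1 _
  · have hab : (a * b).primeFactors = a.primeFactors ∪ b.primeFactors := Nat.primeFactors_mul ha hb
    have h1 : ∑ p ∈ b.primeFactors, b.factorization p =
        ∑ p ∈ a.primeFactors ∪ b.primeFactors, b.factorization p :=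
      sum_subset subset_union_right fun p _ hp => by
        rwa [← Nat.support_factorization, Finsupp.notMem_support_iff] at hp
    rw [primeProd_eq_prod_of_subset h0 hab.subset,
      primeProd_eq_prod_of_subset h0 (subset_union_left (s₂ := b.primeFactors)), h1,
      ← prod_pow_eq_pow_sum, ← prod_mul_distrib]
    refine prod_le_prod (fun p _ => locWeight_nonneg hM hc _ _) fun p hp => ?_
    rw [Nat.factorization_mul ha hb, Finsupp.add_apply]
    by_cases hpb : p ∈ b.primeFactors
    · have h2 := h p (Nat.prime_of_mem_primeFactors hpb) (Nat.dvd_of_mem_primeFactors hpb)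
      exact locWeight_add_le hc2 (Nat.prime_of_mem_primeFactors hpb) h2.1 h2.2.2 _
    · rw [← Nat.support_factorization, Finsupp.notMem_support_iff] at hpb
      simp [hpb]

theorem exists_primeProd_locWeight_le_rpow (hM : 0 ≤ M) (hc : ∀ p, 0 ≤ c p)
    (hc2 : ∀ p, p.Prime → c p ≤ 2) {ε : ℝ} (hε : 0 < ε) :
    ∃ C, 1 ≤ C ∧ ∀ n : ℕ, n ≠ 0 → primeProd (locWeight p₀ M c) n ≤ C * (n : ℝ) ^ ε := by
  obtain ⟨P, hP⟩ := exists_nat_ge (max (p₀ : ℝ) (2 ^ (1 / ε)))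
  have hl2 : 0 < Real.log 2 := Real.log_pos (by norm_num)
  set K : ℝ := (M + 1) * (1 / (ε * Real.log 2) + 1) with hK
  have hK1 : 1 ≤ K := by
    have h1 : 0 ≤ 1 / (ε * Real.log 2) := by positivity
    nlinarith
  refine ⟨K ^ (P + 1), one_le_pow₀ hK1, fun n hn => ?_⟩
  have hloc : ∀ p : ℕ, p.Prime → ∀ k : ℕ, k ≠ 0 → locWeight p₀ M c p k ≤
      (if p ≤ P then K else 1) * ((p : ℝ) ^ ε) ^ k := fun p hp k hk => by
    have hp2 : (2 : ℝ) ≤ p := by exact_mod_cast hp.two_le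
    have hk1 : (1 : ℝ) ≤ k := by exact_mod_cast Nat.one_le_iff_ne_zero.2 hk
    split_ifs with h
    · have h3 := locWeight_le (p₀ := p₀) hM hc2 hp k
      have h4 : (k : ℝ) + 1 ≤ (1 / (ε * Real.log 2) + 1) * ((2 : ℝ) ^ ε) ^ k := by
        have h5 : ((2 : ℝ) ^ ε) ^ k = Real.exp (k * (ε * Real.log 2)) := by
          rw [Real.rpow_def_of_pos (by norm_num), Real.exp_nat_mul, mul_comm ε]
        rw [h5]
        set x := ε * Real.log 2 with hx
        have hx0 : 0 < x := by positivity
        have h6 := Real.add_one_le_exp (k * x)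
        have h7 : (k : ℝ) ≤ 1 / x * Real.exp (k * x) := by
          rw [one_div, ← div_eq_inv_mul, le_div_iff₀ hx0]
          linarith
        have h8 : 1 ≤ Real.exp (k * x) := Real.one_le_exp (by positivity)
        linarith
      calc locWeight p₀ M c p k ≤ (M + 1) * (k + 1) := h3
        _ ≤ (M + 1) * ((1 / (ε * Real.log 2) + 1) * ((2 : ℝ) ^ ε) ^ k) := by gcongr
        _ = K * ((2 : ℝ) ^ ε) ^ k := by rw [hK]; ring
        _ ≤ _ := by gcongr
    · have hPp : (P : ℝ) < p := by exact_mod_cast not_le.1 h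
      have h3 : p₀ < p := by
        have : (p₀ : ℝ) < p := ((le_max_left _ _).trans hP).trans_lt hPp
        exact_mod_cast this
      have h4 : (2 : ℝ) ≤ (p : ℝ) ^ ε := by
        calc (2 : ℝ) = ((2 : ℝ) ^ (1 / ε)) ^ ε := by
              rw [← Real.rpow_mul (by norm_num), one_div, inv_mul_cancel₀ hε.ne', Real.rpow_one]
          _ ≤ _ := by
              gcongr
              exact ((le_max_right _ _).trans hP).trans hPp.le
      have h5 := locWeight_add_le (M := M) hc2 hp h3 zero_ne_one k
      rw [zero_add] at h5
      refine h5.trans ?_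
      simp only [locWeight, if_true]
      gcongr
  unfold primeProd
  calc ∏ p ∈ n.primeFactors, locWeight p₀ M c p (n.factorization p)
      ≤ ∏ p ∈ n.primeFactors, (if p ≤ P then K else 1) * ((p : ℝ) ^ ε) ^ n.factorization p :=
        prod_le_prod (fun p _ => locWeight_nonneg hM hc _ _) fun p hp =>
          hloc p (Nat.prime_of_mem_primeFactors hp) _ (by
            rwa [← Finsupp.mem_support_iff, Nat.support_factorization])
    _ = K ^ #{p ∈ n.primeFactors | p ≤ P} * (n : ℝ) ^ ε := by
        rw [prod_mul_distrib, ← prod_filter, prod_const]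
        congr 1
        conv_rhs => rw [← Nat.prod_factorization_pow_eq_self hn]
        rw [Finsupp.prod, Nat.support_factorization]
        push_cast
        rw [← Real.finsetProd_rpow _ _ fun i _ => by positivity]
        exact prod_congr rfl fun p _ => Real.rpow_pow_comm (Nat.cast_nonneg p) _ _
    _ ≤ _ := by
        gcongr
        have : #{p ∈ n.primeFactors | p ≤ P} ≤ #(range (P + 1)) := card_le_card fun p hp => by
          simp only [mem_filter] at hp
          simp only [mem_range]; omega
        rwa [card_range] at this

/-- The part of `n` composed of primes at most `y`. -/
noncomputable def smoothPart (y n : ℕ) : ℕ := ∏ p ∈ y.primesLE, p ^ n.factorization p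

theorem smoothPart_zero (n : ℕ) : smoothPart 0 n = 1 := by
  have : Nat.primesLE 0 = ∅ := by
    ext p; simp
  simp [smoothPart, this]

theorem smoothPart_succ (y n : ℕ) : smoothPart (y + 1) n =
    smoothPart y n * if (y + 1).Prime then (y + 1) ^ n.factorization (y + 1) else 1 := by
  unfold smoothPart
  split_ifs with h
  · have : (y + 1).primesLE = insert (y + 1) y.primesLE := by
      ext p
      simp only [Nat.mem_primesLE, mem_insert]
      constructor
      · rintro ⟨h1, h2⟩
        rcases Nat.lt_or_ge y p with h3 | h3
        · left; omega
        · right; exact ⟨h3, h2⟩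
      · rintro (rfl | ⟨h1, h2⟩)
        · exact ⟨le_rfl, h⟩
        · exact ⟨by omega, h2⟩
    rw [this, prod_insert (by simp [Nat.mem_primesLE]), mul_comm]
  · have : (y + 1).primesLE = y.primesLE := by
      ext p
      simp only [Nat.mem_primesLE]
      constructor
      · rintro ⟨h1, h2⟩
        refine ⟨?_, h2⟩
        rcases Nat.lt_or_ge y p with h3 | h3
        · have : p = y + 1 := by omega
          exact absurd (this ▸ h2) h
        · exact h3
      · rintro ⟨h1, h2⟩
        exact ⟨by omega, h2⟩
    rw [this, mul_one]

theorem smoothPart_ne_zero (y n : ℕ) : smoothPart y n ≠ 0 :=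
  prod_ne_zero_iff.2 fun _ hp => pow_ne_zero _ (Nat.mem_primesLE.1 hp).2.ne_zero

theorem factorization_prod_pow (s : Finset ℕ) (hs : ∀ p ∈ s, p.Prime) (e : ℕ → ℕ) (p : ℕ) :
    (∏ q ∈ s, q ^ e q).factorization p = if p ∈ s then e p else 0 := by
  rw [Nat.factorization_prod fun q hq => pow_ne_zero _ (hs q hq).ne_zero, Finsupp.finsetSum_apply,
    ← sum_ite_eq' s p e]
  refine sum_congr rfl fun q hq => ?_
  rw [(hs q hq).factorization_pow, Finsupp.single_apply]

theorem factorization_smoothPart (y n : ℕ) {p : ℕ} (hp : p.Prime) :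
    (smoothPart y n).factorization p = if p ≤ y then n.factorization p else 0 := by
  rw [smoothPart, factorization_prod_pow _ fun q hq => (Nat.mem_primesLE.1 hq).2]
  simp [Nat.mem_primesLE, hp]

end WeightBounds

section Decomposition

open Finset

theorem exists_smooth_decomposition {Z : ℕ} (hZ : 1 ≤ Z) {N : ℕ} (hN : N ≠ 0) :
    (∃ a b, N = a * b ∧ a ≤ Z ∧ (∀ p, p.Prime → p ∣ a → p ≤ Z) ∧
      ∀ p, p.Prime → p ∣ b → Z < p ∧ a.factorization p ≠ 1) ∨
    ∃ q a b, q.Prime ∧ q ≤ Z ∧ N = a * b ∧ Z < a ∧ a ≤ Z ^ 4 ∧ (∀ p, p.Prime → p ∣ a → p ≤ q) ∧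
      ∀ p, p.Prime → p ∣ b → q ≤ p ∧ a.factorization p ≠ 1 := by
  have hdvd : ∀ a, a ≠ 0 → (∀ p, p.Prime → a.factorization p ≤ N.factorization p) → ∃ b, N = a * b ∧
      ∀ p, p.Prime → p ∣ b → a.factorization p ≠ N.factorization p := fun a ha h => by
    obtain ⟨b, hb⟩ := (Nat.factorization_prime_le_iff_dvd ha hN).1 h
    refine ⟨b, hb, fun p hp hpb h1 => ?_⟩
    have hb0 : b ≠ 0 := by rintro rfl; exact hN (by simpa using hb)
    rw [hb, Nat.factorization_mul ha hb0, Finsupp.add_apply] at h1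
    have := hp.factorization_pos_of_dvd hb0 hpb
    omega
  have hprime : ∀ y a, a ≠ 0 → (∀ p, p.Prime → y < p → a.factorization p = 0) →
      ∀ p, p.Prime → p ∣ a → p ≤ y := fun y a ha h p hp hpa => by
    by_contra h1
    have := hp.factorization_pos_of_dvd ha hpa
    have := h p hp (by omega)
    omega
  rcases le_or_gt (smoothPart Z N) Z with hA | hB
  · left
    have h0 := smoothPart_ne_zero Z N
    obtain ⟨b, hb, h1⟩ := hdvd _ h0 fun p hp => by
      rw [factorization_smoothPart _ _ hp]; split_ifs <;> simp
    refine ⟨_, b, hb, hA, hprime Z _ h0 fun p hp hZp => ?_, fun p hp hpb => ?_⟩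
    · rw [factorization_smoothPart _ _ hp, if_neg (by omega)]
    · have h2 := h1 p hp hpb
      rw [factorization_smoothPart _ _ hp] at h2 ⊢
      have h3 : ¬ p ≤ Z := fun h => h2 (if_pos h)
      rw [if_neg h3]
      omega
  · right
    have hex : ∃ n, Z < smoothPart n N := ⟨Z, hB⟩
    classical
    obtain ⟨q, hq⟩ : ∃ q, q = Nat.find hex := ⟨_, rfl⟩
    have hqs : Z < smoothPart q N := hq ▸ Nat.find_spec hex
    have hqZ : q ≤ Z := hq ▸ Nat.find_min' hex hB
    have hmin : ∀ m, m < q → smoothPart m N ≤ Z := fun m hm => not_lt.1 (Nat.find_min hex (hq ▸ hm))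
    have hq0 : q ≠ 0 := by
      rintro rfl
      rw [smoothPart_zero] at hqs
      omega
    obtain ⟨r, rfl⟩ := Nat.exists_eq_succ_of_ne_zero hq0
    rw [Nat.succ_eq_add_one] at *
    have hr : smoothPart r N ≤ Z := hmin r (Nat.lt_succ_self r)
    have hqp : (r + 1).Prime := by
      by_contra h
      rw [smoothPart_succ, if_neg h, mul_one] at hqs
      omega
    rw [smoothPart_succ, if_pos hqp] at hqs
    set e := N.factorization (r + 1) with he
    set l := Nat.log (r + 1) Z + 2 with hl
    have hlZ : Z < (r + 1) ^ (l - 1) := Nat.lt_pow_succ_log_self hqp.one_lt Z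
    have hlZ' : (r + 1) ^ l ≤ Z ^ 3 := by
      rw [hl, pow_add, pow_succ' Z]
      gcongr
      exact Nat.pow_log_le_self _ (by omega)
    set a := smoothPart r N * (r + 1) ^ min e l with ha
    have hs0 := smoothPart_ne_zero r N
    have ha0 : a ≠ 0 := mul_ne_zero hs0 (pow_ne_zero _ hqp.ne_zero)
    have haf : ∀ p, p.Prime → a.factorization p =
        if p ≤ r then N.factorization p else if p = r + 1 then min e l else 0 := fun p hp => by
      rw [ha, Nat.factorization_mul hs0 (pow_ne_zero _ hqp.ne_zero), Finsupp.add_apply,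
        factorization_smoothPart _ _ hp, hqp.factorization_pow, Finsupp.single_apply]
      split_ifs <;> omega
    obtain ⟨b, hb, h1⟩ := hdvd a ha0 fun p hp => by
      rw [haf p hp]
      split_ifs with h2 h3
      · exact le_rfl
      · rw [h3]; exact min_le_left _ _
      · exact Nat.zero_le _
    refine ⟨r + 1, a, b, hqp, hqZ, hb, ?_, ?_, hprime _ _ ha0 fun p hp h2 => ?_,
      fun p hp hpb => ?_⟩
    · rcases le_total e l with h | h
      · rwa [ha, min_eq_left h]
      · rw [ha, min_eq_right h]
        calc Z < (r + 1) ^ (l - 1) := hlZ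
          _ ≤ (r + 1) ^ l := Nat.pow_le_pow_right hqp.pos (by omega)
          _ ≤ _ := Nat.le_mul_of_pos_left _ (Nat.pos_of_ne_zero hs0)
    · calc a ≤ Z * (r + 1) ^ l := by
            rw [ha]; gcongr
            · exact hqp.one_lt.le
            · exact min_le_right _ _
        _ ≤ Z * Z ^ 3 := by gcongr
        _ = Z ^ 4 := by ring
    · rw [haf p hp, if_neg (by omega), if_neg (by omega)]
    · have h2 := h1 p hp hpb
      rw [haf p hp] at h2 ⊢
      have h3 : ¬ p ≤ r := fun h => h2 (if_pos h)
      refine ⟨by omega, ?_⟩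
      rw [if_neg h3] at h2 ⊢
      split_ifs with h4
      · rw [if_pos h4, h4] at h2
        omega
      · omega

end Decomposition

section ClassSum

open Finset

variable {g : ℕ → ℝ} {C₀ : ℝ} {p₀ : ℕ} {M : ℝ} {c : ℕ → ℝ}

/-- The sieve bound for the number of values of `N` on `Ω` divisible by `a` and by no prime
of `P`. -/
def SieveBound (g : ℕ → ℝ) (p₀ : ℕ) (K : ℝ) (k X : ℕ) {ι : Type*} (Ω : Finset ι) (N : ι → ℕ) :
    Prop :=
  ∀ y : ℕ, 2 ≤ y → ∀ a : ℕ, a ≠ 0 → ∀ P ⊆ y.primesLE, (∀ p ∈ P, p₀ < p ∧ ¬ p ∣ a) →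
    (#{ω ∈ Ω | a ∣ N ω ∧ ∀ p ∈ P, ¬ p ∣ N ω} : ℝ) ≤
      K * ((X : ℝ) ^ 2 * g a * ∏ p ∈ P, (1 - g p) + X * a * (y : ℝ) ^ k)

theorem prod_one_sub_le_mul_primeProd (hg : IsFormDensity g C₀ p₀) {y a : ℕ} (ha : a ≠ 0) :
    ∏ p ∈ y.primesLE with p₀ < p ∧ ¬ p ∣ a, (1 - g p) ≤
      (∏ p ∈ y.primesLE with p₀ < p, (1 - g p)) * primeProd (locSift p₀ g) a := by
  have hpos : ∀ p ∈ y.primesLE.filter (p₀ < ·), 0 < 1 - g p := fun p hp => by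
    simp only [mem_filter, Nat.mem_primesLE] at hp
    linarith [hg.prime_le p hp.1.2 hp.2]
  have h1 : ∏ p ∈ y.primesLE with p₀ < p, (1 - g p) =
      (∏ p ∈ y.primesLE with p₀ < p ∧ p ∣ a, (1 - g p)) *
      ∏ p ∈ y.primesLE with p₀ < p ∧ ¬ p ∣ a, (1 - g p) := by
    rw [← filter_filter, ← filter_filter]
    exact (prod_filter_mul_prod_filter_not _ _ _).symm
  have h2 : (∏ p ∈ y.primesLE with p₀ < p ∧ p ∣ a, (1 - g p))⁻¹ ≤ primeProd (locSift p₀ g) a := by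
    rw [← prod_inv_distrib, primeProd]
    calc ∏ p ∈ y.primesLE with p₀ < p ∧ p ∣ a, (1 - g p)⁻¹
        = ∏ p ∈ y.primesLE with p₀ < p ∧ p ∣ a, locSift p₀ g p (a.factorization p) := by
          refine prod_congr rfl fun p hp => ?_
          rw [locSift, if_pos (mem_filter.1 hp).2.1]
      _ ≤ _ := by
          refine Finset.prod_le_prod_of_subset_of_one_le (fun p hp => ?_) (fun p hp => ?_)
            fun p hp _ => ?_
          · simp only [mem_filter, Nat.mem_primesLE] at hp
            exact Nat.mem_primeFactors.2 ⟨hp.1.2, hp.2.2, ha⟩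
          · simp only [mem_filter, Nat.mem_primesLE] at hp
            exact zero_le_one.trans (locSift_nonneg hg hp.1.2 _).1
          · exact (locSift_nonneg hg (Nat.prime_of_mem_primeFactors hp) _).1
  have h3 : 0 < ∏ p ∈ y.primesLE with p₀ < p ∧ p ∣ a, (1 - g p) := prod_pos fun p hp =>
    hpos p (by simp only [mem_filter] at hp ⊢; exact ⟨hp.1, hp.2.1⟩)
  have h4 : 0 ≤ ∏ p ∈ y.primesLE with p₀ < p ∧ ¬ p ∣ a, (1 - g p) := prod_nonneg fun p hp =>
    (hpos p (by simp only [mem_filter] at hp ⊢; exact ⟨hp.1, hp.2.1⟩)).le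
  rw [inv_le_iff_one_le_mul₀ h3] at h2
  rw [h1]
  nlinarith

theorem sum_le_sum_of_exists_mem {ι : Type*} {Ω : Finset ι} {S : Finset ℕ} {Q : ι → ℕ → Prop}
    {F : ι → ℝ} {G : ℕ → ℝ} {H : ℕ → ℝ} (hG : ∀ a, 0 ≤ G a)
    (h : ∀ ω ∈ Ω, ∃ a ∈ S, Q ω a ∧ F ω ≤ G a)
    (hH : ∀ a ∈ S, ∀ T ⊆ Ω, (∀ ω ∈ T, Q ω a) → (#T : ℝ) ≤ H a) :
    ∑ ω ∈ Ω, F ω ≤ ∑ a ∈ S, G a * H a := by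
  classical
  choose! α hα using h
  rw [← sum_fiberwise_of_maps_to (t := S) (g := α) fun ω hω => (hα ω hω).1]
  refine sum_le_sum fun a ha => ?_
  have h1 := hH a ha {ω ∈ Ω | α ω = a} (filter_subset _ _) fun ω hω => by
    simp only [mem_filter] at hω
    exact hω.2 ▸ (hα ω hω.1).2.1
  calc ∑ ω ∈ Ω with α ω = a, F ω ≤ ∑ ω ∈ Ω with α ω = a, G a := sum_le_sum fun ω hω => by
        simp only [mem_filter] at hω
        exact hω.2 ▸ (hα ω hω.1).2.2
    _ = #{ω ∈ Ω | α ω = a} * G a := by rw [sum_const, nsmul_eq_mul]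
    _ ≤ H a * G a := mul_le_mul_of_nonneg_right h1 (hG a)
    _ = _ := mul_comm _ _

theorem SieveBound.sum_class_le (hg : IsFormDensity g C₀ p₀) (hM : 0 ≤ M) (hc : ∀ p, 0 ≤ c p)
    (hc2 : ∀ p, p.Prime → c p ≤ 2) {K : ℝ} (hK : 0 ≤ K) {k X : ℕ} {ι : Type*} {Ω Ω' : Finset ι}
    {N : ι → ℕ} (hs : SieveBound g p₀ K k X Ω N) (hΩ : Ω' ⊆ Ω) {y l : ℕ} (hy : 2 ≤ y)
    (hp₀ : p₀ ≤ y) {S : Finset ℕ}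
    (hN : ∀ ω ∈ Ω', N ω ≠ 0 ∧ N ω ≤ y ^ l ∧ ∃ a ∈ S, ∃ b, N ω = a * b ∧
      ∀ p, p.Prime → p ∣ b → y < p ∧ a.factorization p ≠ 1) :
    ∑ ω ∈ Ω', primeProd (locWeight p₀ M c) (N ω) ≤
      2 ^ l * K * ((X : ℝ) ^ 2 * ((∏ p ∈ y.primesLE with p₀ < p, (1 - g p)) *
        ∑ a ∈ S, weightTerm p₀ M c g 0 a) +
        X * (y : ℝ) ^ k * ∑ a ∈ S, primeProd (locWeight p₀ M c) a * a) := by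
  classical
  have hR := primeProd_nonneg (locWeight_nonneg (p₀ := p₀) hM hc)
  set V := ∏ p ∈ y.primesLE with p₀ < p, (1 - g p) with hV
  refine (sum_le_sum_of_exists_mem (S := S)
    (Q := fun ω a => a ≠ 0 ∧ a ∣ N ω ∧ ∀ p ∈ y.primesLE.filter (fun p => p₀ < p ∧ ¬ p ∣ a), ¬ p ∣ N ω)
    (G := fun a => primeProd (locWeight p₀ M c) a * 2 ^ l)
    (H := fun a => K * ((X : ℝ) ^ 2 * g a * (V * primeProd (locSift p₀ g) a) + X * a * (y : ℝ) ^ k))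
    (fun a => mul_nonneg (hR a) (by positivity)) (fun ω hω => ?_) fun a _ T hT hQ => ?_).trans ?_
  · obtain ⟨h0, h1, a, ha, b, hb, h2⟩ := hN ω hω
    have ha0 : a ≠ 0 := by rintro rfl; exact h0 (by rw [hb, zero_mul])
    have hb0 : b ≠ 0 := by rintro rfl; exact h0 (by rw [hb, mul_zero])
    refine ⟨a, ha, ⟨ha0, ⟨b, hb⟩, fun p hp hpN => ?_⟩, ?_⟩
    · simp only [mem_filter, Nat.mem_primesLE] at hp
      rw [hb, hp.1.2.dvd_mul] at hpN
      have := h2 p hp.1.2 (hpN.resolve_left hp.2.2)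
      omega
    · obtain ⟨n, hn, h3⟩ := exists_primeProd_locWeight_mul_le hM hc hc2 ha0 hb0 (p₀ := p₀) (y := y)
        fun p hp hpb => by
          have := h2 p hp hpb
          exact ⟨by omega, by omega, this.2⟩
      rw [hb]
      refine h3.trans ?_
      have hbN : b ≤ N ω := hb ▸ Nat.le_mul_of_pos_left _ (Nat.pos_of_ne_zero ha0)
      have hnl : n ≤ l := (Nat.pow_le_pow_iff_right (by omega)).1 ((hn.trans hbN).trans h1)
      have := hR a
      gcongr
      norm_num
  · rcases T.eq_empty_or_nonempty with rfl | ⟨ω₀, hω₀⟩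
    · have := hR a
      have h2 : 0 ≤ V := prod_nonneg fun p hp => by
        simp only [mem_filter, Nat.mem_primesLE] at hp
        linarith [hg.prime_le p hp.1.2 hp.2]
      have h3 := hg.nonneg a
      have h4 := primeProd_locSift_nonneg hg a
      simp only [card_empty, Nat.cast_zero]
      positivity
    · have ha := (hQ ω₀ hω₀).1
      have h1 := hs y hy a ha (y.primesLE.filter (fun p => p₀ < p ∧ ¬ p ∣ a)) (filter_subset _ _)
        fun p hp => (mem_filter.1 hp).2
      have h2 : #T ≤ #{ω ∈ Ω | a ∣ N ω ∧
          ∀ p ∈ y.primesLE.filter (fun p => p₀ < p ∧ ¬ p ∣ a), ¬ p ∣ N ω} :=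
        card_le_card fun ω hω => mem_filter.2 ⟨hΩ (hT hω), (hQ ω hω).2⟩
      refine (Nat.cast_le.2 h2).trans (h1.trans ?_)
      have h3 := prod_one_sub_le_mul_primeProd hg (y := y) ha
      have h4 := hg.nonneg a
      gcongr
  · rw [mul_sum, mul_sum, mul_sum, ← sum_add_distrib, mul_sum]
    refine le_of_eq (sum_congr rfl fun a _ => ?_)
    rw [weightTerm, Real.rpow_zero]
    ring

end ClassSum

section NairBound

open Finset

variable {g : ℕ → ℝ} {C₀ : ℝ} {p₀ : ℕ} {M : ℝ} {c : ℕ → ℝ}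

theorem exists_pow_two_pow_mul_le {w D X : ℕ} (hw : 2 ≤ w) (hD : D ≠ 0) (h : w ^ D ≤ X) :
    ∃ J : ℕ, (w ^ 2 ^ J) ^ D ≤ X ∧ X < (w ^ 2 ^ J) ^ (2 * D) := by
  classical
  have hex : ∃ J : ℕ, X < (w ^ 2 ^ J) ^ (2 * D) := by
    refine ⟨X, ?_⟩
    calc X < 2 ^ X := Nat.lt_two_pow_self
      _ ≤ w ^ X := Nat.pow_le_pow_left hw _
      _ ≤ w ^ 2 ^ X := Nat.pow_le_pow_right (by omega) Nat.lt_two_pow_self.le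
      _ ≤ _ := Nat.le_self_pow (by omega) _
  refine ⟨Nat.find hex, ?_, Nat.find_spec hex⟩
  rcases Nat.eq_zero_or_pos (Nat.find hex) with h0 | h0
  · rw [h0]; simpa using h
  · have h1 := Nat.find_min hex (Nat.sub_lt h0 one_pos)
    obtain ⟨j, hj⟩ := Nat.exists_eq_succ_of_ne_zero h0.ne'
    rw [hj] at h1 ⊢
    rw [Nat.succ_sub_one, not_lt] at h1
    rw [pow_succ, pow_mul]
    rwa [pow_mul] at h1

theorem sum_half_pow_sub_le (J : ℕ) : ∑ i ∈ range J, (1 / 2 : ℝ) ^ (J - i) ≤ 1 := by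
  have h : ∀ J : ℕ, ∑ i ∈ range J, (1 / 2 : ℝ) ^ (J - i) = 1 - (1 / 2) ^ J := fun J => by
    induction J with
    | zero => simp
    | succ n ih =>
      rw [sum_range_succ']
      simp only [Nat.add_sub_add_right, Nat.sub_zero, ih]
      ring
  rw [h]
  have : (0 : ℝ) ≤ (1 / 2) ^ J := by positivity
  linarith

/-- Sums of weights over the numbers of `(Z, Z ^ 4]` without prime factors exceeding `n`, by
Rankin's trick. -/
theorem sum_weightTerm_zero_le (hg : IsFormDensity g C₀ p₀) (hM : 0 ≤ M) (hc : ∀ p, 0 ≤ c p)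
    {κ : ℝ} (hκ : 0 ≤ κ) {Z : ℕ} (hZ : 1 ≤ Z) {S : Finset ℕ} (hS : ∀ a ∈ S, Z ≤ a) :
    ∑ a ∈ S, weightTerm p₀ M c g 0 a ≤
      Real.exp (-(κ * Real.log Z)) * ∑ a ∈ S, weightTerm p₀ M c g κ a := by
  have hZ0 : (0 : ℝ) < Z := by exact_mod_cast hZ
  rw [mul_sum]
  refine sum_le_sum fun a ha => ?_
  have h1 := weightTerm_nonneg (p₀ := p₀) hg hM hc 0 a
  have h2 : weightTerm p₀ M c g κ a = weightTerm p₀ M c g 0 a * (a : ℝ) ^ κ := by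
    simp [weightTerm]
  have h3 : 1 ≤ Real.exp (-(κ * Real.log Z)) * (a : ℝ) ^ κ := by
    have h4 : (Z : ℝ) ^ κ ≤ (a : ℝ) ^ κ := by
      gcongr
      exact hS a ha
    rw [Real.exp_neg, ← div_eq_inv_mul, le_div_iff₀ (Real.exp_pos _), one_mul]
    rwa [Real.rpow_def_of_pos hZ0, mul_comm (Real.log _)] at h4
  rw [h2]
  calc weightTerm p₀ M c g 0 a ≤
        weightTerm p₀ M c g 0 a * (Real.exp (-(κ * Real.log Z)) * (a : ℝ) ^ κ) :=
      le_mul_of_one_le_right h1 h3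
    _ = _ := by ring

theorem sum_primeProd_locWeight_mul_le {R : ℕ → ℝ} {C : ℝ} (hC : 0 ≤ C)
    (hR : ∀ n : ℕ, n ≠ 0 → R n ≤ C * n) {Z : ℕ} {S : Finset ℕ} (hS : S ⊆ Icc 1 (Z ^ 4)) :
    ∑ a ∈ S, R a * a ≤ C * (Z : ℝ) ^ 12 := by
  have h1 : ∀ a ∈ S, R a * a ≤ C * (Z : ℝ) ^ 8 := fun a ha => by
    have h2 := mem_Icc.1 (hS ha)
    have h3 : (a : ℝ) ≤ (Z : ℝ) ^ 4 := by exact_mod_cast h2.2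
    calc R a * a ≤ C * a * a := by
          gcongr
          exact hR a (by omega)
      _ ≤ C * (Z : ℝ) ^ 4 * (Z : ℝ) ^ 4 := by gcongr
      _ = _ := by ring
  have h4 : (#S : ℝ) ≤ (Z : ℝ) ^ 4 := by
    have := card_le_card hS
    rw [Nat.card_Icc, Nat.add_sub_cancel] at this
    exact_mod_cast this
  calc ∑ a ∈ S, R a * a ≤ #S • (C * (Z : ℝ) ^ 8) := sum_le_card_nsmul _ _ _ h1
    _ = #S * (C * (Z : ℝ) ^ 8) := nsmul_eq_mul _ _
    _ ≤ (Z : ℝ) ^ 4 * (C * (Z : ℝ) ^ 8) := by gcongr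
    _ = _ := by ring

/-- The contribution of the values with a large divisor all of whose prime factors are at
most `w`. -/
theorem SieveBound.exists_sum_smooth_le (hg : IsFormDensity g C₀ p₀) (hM : 0 ≤ M)
    (hc : ∀ p, 0 ≤ c p) (hc2 : ∀ p, p.Prime → c p ≤ 2) {K : ℝ} (hK : 0 ≤ K) (k c₁ : ℕ)
    {w : ℕ} (hw : 1 ≤ w) : ∃ C, 0 ≤ C ∧ ∀ X Z : ℕ, 1 ≤ Z → Z ^ (k + 15) ≤ X →
      ∀ (ι : Type) (Ω Ω' : Finset ι) (N : ι → ℕ), SieveBound g p₀ K k X Ω N → Ω' ⊆ Ω →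
      (∀ ω ∈ Ω', N ω ≠ 0 ∧ N ω ≤ Z ^ c₁ ∧ ∃ a ∈ Icc (Z + 1) (Z ^ 4),
        (∀ p, p.Prime → p ∣ a → p ≤ w) ∧ a ∣ N ω) →
      ∑ ω ∈ Ω', primeProd (locWeight p₀ M c) (N ω) ≤ C * (X : ℝ) ^ 2 := by
  classical
  obtain ⟨Cε, hCε, hR⟩ := exists_primeProd_locWeight_le_rpow (p₀ := p₀) hM hc hc2
    (ε := 1 / (8 * (c₁ + 1))) (by positivity)
  have hlw : 0 ≤ Real.log w := Real.log_nonneg (by exact_mod_cast hw)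
  obtain ⟨C₁, hC₁, h1⟩ := sum_weightTerm_le_exp (M := 1) (c := fun _ => 1) hg zero_le_one
    (fun _ => zero_le_one) (fun _ _ => by norm_num) (A := 1 / 8 * Real.log w) (by positivity)
  set E := Real.exp (∑ p ∈ w.primesLE with p₀ < p, 1 * g p + C₁) with hE
  have hE0 : 0 < E := Real.exp_pos _
  refine ⟨Cε * K * (E + 2 ^ k), by positivity, fun X Z hZ hX ι Ω Ω' N hs hΩ hN => ?_⟩
  have hZ1 : (1 : ℝ) ≤ Z := by exact_mod_cast hZ
  have hZ0 : (0 : ℝ) < Z := by linarith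
  set S := (Icc (Z + 1) (Z ^ 4)).filter fun a => ∀ p, p.Prime → p ∣ a → p ≤ w with hS
  have h2 : ∑ a ∈ S, g a ≤ (Z : ℝ) ^ (-(1 / 8) : ℝ) * E := by
    have h3 := h1 w hw (1 / 8) (by norm_num) le_rfl le_rfl S fun a ha => (mem_filter.1 ha).2
    have h4 : ∑ a ∈ S, g a ≤ ∑ a ∈ S, weightTerm p₀ 1 (fun _ => 1) g 0 a :=
      sum_le_sum fun a _ => by
        have h5 : 1 ≤ primeProd (locWeight p₀ 1 fun _ => 1) a := one_le_primeProd (fun p k _ => by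
          unfold locWeight
          have : (0 : ℝ) ≤ k := Nat.cast_nonneg k
          split_ifs <;> linarith) a
        have h6 : 1 ≤ primeProd (locSift p₀ g) a :=
          one_le_primeProd (fun p k hp => (locSift_nonneg hg hp k).1) a
        have h7 := hg.nonneg a
        rw [weightTerm, Real.rpow_zero, mul_one]
        calc g a = 1 * g a * 1 := by ring
          _ ≤ _ := by gcongr
    have h5 := sum_weightTerm_zero_le (p₀ := p₀) (M := 1) (c := fun _ => 1) hg zero_le_one
      (fun _ => zero_le_one) (κ := 1 / 8) (by norm_num) hZ (S := S) fun a ha => by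
        have := mem_Icc.1 (mem_filter.1 ha).1
        omega
    refine h4.trans (h5.trans ?_)
    rw [Real.rpow_def_of_pos hZ0]
    have h6 : -(1 / 8 * Real.log Z) = Real.log Z * -(1 / 8) := by ring
    rw [h6]
    gcongr
  set r : ℝ := (Z : ℝ) ^ (1 / 8 : ℝ) with hr
  have hr1 : 1 ≤ r := Real.one_le_rpow hZ1 (by norm_num)
  have hrZ : r ≤ Z := by
    calc r ≤ (Z : ℝ) ^ (1 : ℝ) := Real.rpow_le_rpow_of_exponent_le hZ1 (by norm_num)
      _ = Z := Real.rpow_one _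
  have h3 : ∑ ω ∈ Ω', primeProd (locWeight p₀ M c) (N ω) ≤
      ∑ a ∈ S, (Cε * r) * (K * ((X : ℝ) ^ 2 * g a + X * a * (2 : ℝ) ^ k)) := by
    refine sum_le_sum_of_exists_mem (Q := fun ω a => a ∣ N ω) (G := fun _ => Cε * r)
      (fun a => by positivity) (fun ω hω => ?_) fun a ha T hT hQ => ?_
    · obtain ⟨h0, h4, a, ha, h5, h6⟩ := hN ω hω
      refine ⟨a, mem_filter.2 ⟨ha, h5⟩, h6, (hR _ h0).trans ?_⟩
      gcongr
      calc (N ω : ℝ) ^ (1 / (8 * (c₁ + 1)) : ℝ) ≤ ((Z : ℝ) ^ c₁) ^ (1 / (8 * (c₁ + 1)) : ℝ) := by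
            gcongr
            exact_mod_cast h4
        _ = (Z : ℝ) ^ (c₁ * (1 / (8 * (c₁ + 1))) : ℝ) := by
            rw [← Real.rpow_natCast, ← Real.rpow_mul hZ0.le]
        _ ≤ _ := by
            refine Real.rpow_le_rpow_of_exponent_le hZ1 ?_
            rw [mul_one_div, div_le_div_iff₀ (by positivity) (by norm_num)]
            linarith
    · have h4 := hs 2 le_rfl a (by have := mem_Icc.1 (mem_filter.1 ha).1; omega) ∅ (by simp)
        (by simp)
      simp only [notMem_empty, IsEmpty.forall_iff, implies_true, and_true, prod_empty, mul_one,
        Nat.cast_ofNat] at h4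
      refine le_trans ?_ h4
      exact_mod_cast card_le_card fun ω hω => mem_filter.2 ⟨hΩ (hT hω), hQ ω hω⟩
  refine h3.trans ?_
  have h4 := sum_primeProd_locWeight_mul_le (R := fun n => n) (C := 1) zero_le_one
    (fun n _ => by simp) (Z := Z) (S := S) fun a ha => by
      have := mem_Icc.1 (mem_filter.1 ha).1
      exact mem_Icc.2 ⟨by omega, this.2⟩
  have h5 : ∑ a ∈ S, (a : ℝ) ≤ (Z : ℝ) ^ 12 := by
    rw [one_mul] at h4
    refine le_trans (sum_le_sum fun a ha => ?_) h4
    have := mem_Icc.1 (mem_filter.1 ha).1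
    have h6 : (1 : ℝ) ≤ a := by exact_mod_cast (show 1 ≤ a by omega)
    nlinarith
  have h6 : r * (Z : ℝ) ^ (-(1 / 8) : ℝ) = 1 := by
    rw [hr, ← Real.rpow_add hZ0]; norm_num
  have h7 : r * (Z : ℝ) ^ 12 ≤ X := by
    calc r * (Z : ℝ) ^ 12 ≤ Z * (Z : ℝ) ^ 12 := by gcongr
      _ = (Z : ℝ) ^ 13 := by ring
      _ ≤ (Z : ℝ) ^ (k + 15) := pow_le_pow_right₀ hZ1 (by omega)
      _ ≤ X := by exact_mod_cast hX
  rw [← mul_sum, ← mul_sum, sum_add_distrib, ← mul_sum, ← sum_mul, ← mul_sum]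
  calc Cε * r * (K * ((X : ℝ) ^ 2 * ∑ a ∈ S, g a + (X * ∑ a ∈ S, (a : ℝ)) * 2 ^ k))
      ≤ Cε * r * (K * ((X : ℝ) ^ 2 * ((Z : ℝ) ^ (-(1 / 8) : ℝ) * E) +
          (X * (Z : ℝ) ^ 12) * 2 ^ k)) := by gcongr
    _ = Cε * K * (X ^ 2 * ((r * (Z : ℝ) ^ (-(1 / 8) : ℝ)) * E) +
          X * (r * (Z : ℝ) ^ 12) * 2 ^ k) := by ring
    _ ≤ Cε * K * (X ^ 2 * (1 * E) + X * X * 2 ^ k) := by rw [h6]; gcongr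
    _ = _ := by ring

end NairBound

section NairBound

open Finset

variable {g : ℕ → ℝ} {C₀ : ℝ} {p₀ : ℕ} {M : ℝ} {c : ℕ → ℝ}

theorem exists_class {w J Z a b q N : ℕ} (hZ : Z = w ^ 2 ^ J) (hwq : w < q) (hqZ : q ≤ Z)
    (hN : N = a * b) (ha : Z < a) (ha4 : a ≤ Z ^ 4) (hp : ∀ p, p.Prime → p ∣ a → p ≤ q)
    (hb : ∀ p, p.Prime → p ∣ b → q ≤ p ∧ a.factorization p ≠ 1) :
    ∃ i ∈ range J, ∃ a, (a ∈ Icc (Z + 1) (Z ^ 4) ∧ ∀ p, p.Prime → p ∣ a → p ≤ (w ^ 2 ^ i) ^ 2) ∧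
      ∃ b, N = a * b ∧ ∀ p, p.Prime → p ∣ b → w ^ 2 ^ i < p ∧ a.factorization p ≠ 1 := by
  classical
  have hex : ∃ i, q ≤ w ^ 2 ^ i := ⟨J, hZ ▸ hqZ⟩
  have h1 := Nat.find_spec hex
  have h2 : Nat.find hex ≤ J := Nat.find_min' hex (hZ ▸ hqZ)
  have h0 : Nat.find hex ≠ 0 := fun h => by
    rw [h, pow_zero, pow_one] at h1
    omega
  obtain ⟨i, hi⟩ := Nat.exists_eq_succ_of_ne_zero h0
  have h3 : w ^ 2 ^ i < q := not_le.1 (Nat.find_min hex (m := i) (by omega))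
  rw [hi, Nat.succ_eq_add_one, pow_succ, pow_mul] at h1
  refine ⟨i, mem_range.2 (by omega), a, ⟨mem_Icc.2 ⟨ha, ha4⟩, fun p hpp hpa =>
    (hp p hpp hpa).trans h1⟩, b, hN, fun p hpp hpb => ?_⟩
  have := hb p hpp hpb
  exact ⟨by omega, this.2⟩

theorem sum_le_sum_filter_add {ι : Type*} (Ω : Finset ι) {F : ι → ℝ} (hF : ∀ ω, 0 ≤ F ω) (J : ℕ)
    (P Q : ι → Prop) (T : ℕ → ι → Prop) [DecidablePred P] [DecidablePred Q]
    [∀ i, DecidablePred (T i)] (h : ∀ ω ∈ Ω, P ω ∨ (∃ i ∈ range J, T i ω) ∨ Q ω) :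
    ∑ ω ∈ Ω, F ω ≤ ∑ ω ∈ Ω with P ω, F ω + ∑ i ∈ range J, ∑ ω ∈ Ω with T i ω, F ω +
      ∑ ω ∈ Ω with Q ω, F ω := by
  simp only [sum_filter]
  rw [sum_comm, ← sum_add_distrib, ← sum_add_distrib]
  refine sum_le_sum fun ω hω => ?_
  have h0 := hF ω
  have h1 : 0 ≤ if P ω then F ω else 0 := by split_ifs <;> simp [h0]
  have h2 : 0 ≤ if Q ω then F ω else 0 := by split_ifs <;> simp [h0]
  have h3 : ∀ i ∈ range J, 0 ≤ if T i ω then F ω else 0 := fun i _ => by split_ifs <;> simp [h0]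
  have h4 := sum_nonneg h3
  rcases h ω hω with h | ⟨i, hi, hT⟩ | h
  · rw [if_pos h]; linarith
  · have h5 := single_le_sum h3 hi
    rw [if_pos hT] at h5
    linarith
  · rw [if_pos h]; linarith

theorem two_pow_mul_exp_neg_le (c j : ℕ) :
    (2 : ℝ) ^ (c * 2 ^ j) * Real.exp (-((c + 1) * Real.log 2 * 2 ^ j)) ≤ (1 / 2) ^ j := by
  have h1 : Real.exp (-((c + 1) * Real.log 2 * 2 ^ j)) = (1 / 2 : ℝ) ^ ((c + 1) * 2 ^ j) := by
    rw [one_div, inv_pow, Real.exp_neg, show ((c : ℝ) + 1) * Real.log 2 * 2 ^ j =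
      (((c + 1) * 2 ^ j : ℕ) : ℝ) * Real.log 2 by push_cast; ring, Real.exp_nat_mul,
      Real.exp_log two_pos]
  rw [h1, add_mul, pow_add, ← mul_assoc, ← mul_pow, show (2 : ℝ) * (1 / 2) = 1 by norm_num,
    one_pow, one_mul, one_mul]
  exact pow_le_pow_of_le_one (by norm_num) (by norm_num) Nat.lt_two_pow_self.le

theorem SieveBound.exists_sum_le (hg : IsFormDensity g C₀ p₀) (hM : 0 ≤ M)
    (hc : ∀ p, 0 ≤ c p) (hc2 : ∀ p, p.Prime → c p ≤ 2) {m : ℕ}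
    (hm : ∃ C : ℝ, ∀ Y : ℕ, 2 ≤ Y → ∑ p ∈ Y.primesLE with p₀ < p, (c p - 1) * g p ≤
      m * Real.log (Real.log Y) + C) {K : ℝ} (hK : 0 ≤ K) (k C₁ : ℕ) :
    ∃ C, 0 ≤ C ∧ ∀ X : ℕ, 2 ≤ X → ∀ (ι : Type) (Ω : Finset ι) (N : ι → ℕ),
      SieveBound g p₀ K k X Ω N → (∀ ω ∈ Ω, N ω ≠ 0 ∧ N ω ≤ C₁ * X ^ 4) →
      ∑ ω ∈ Ω, primeProd (locWeight p₀ M c) (N ω) ≤ C * ((X : ℝ) ^ 2 * Real.log X ^ m) := by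
  classical
  have hR0 := primeProd_nonneg (locWeight_nonneg (p₀ := p₀) hM hc)
  obtain ⟨D, hD⟩ : ∃ D, D = k + 15 := ⟨_, rfl⟩
  obtain ⟨c₁, hc₁⟩ : ∃ c₁, c₁ = 8 * D + 1 := ⟨_, rfl⟩
  have hl2 : 0 < Real.log 2 := Real.log_pos (by norm_num)
  set A : ℝ := (c₁ + 1) * Real.log 2 with hA
  have hA0 : 0 < A := by positivity
  obtain ⟨CE, hCE, hE⟩ := prod_one_sub_mul_sum_weightTerm_le hg hM hc hc2 hm hA0.le
  obtain ⟨C', hC', hR'⟩ := exists_primeProd_locWeight_le_rpow (p₀ := p₀) hM hc hc2 one_pos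
  simp only [Real.rpow_one] at hR'
  set w := max (max p₀ C₁) (2 ^ (8 * (c₁ + 1))) with hw
  have hw2 : 2 ≤ w := (Nat.le_self_pow (by omega) 2).trans (le_max_right _ _)
  have hwp : p₀ ≤ w := (le_max_left _ _).trans (le_max_left _ _)
  have hwC : C₁ ≤ w := (le_max_right _ _).trans (le_max_left _ _)
  have hwc : 2 ^ (8 * (c₁ + 1)) ≤ w := le_max_right _ _
  have hlogw : 8 * A ≤ Real.log w := by
    have h1 : Real.log ((2 : ℝ) ^ (8 * (c₁ + 1))) ≤ Real.log w :=
      Real.log_le_log (by positivity) (by exact_mod_cast hwc)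
    rw [Real.log_pow] at h1
    push_cast at h1
    rw [hA]
    linarith
  clear_value w
  obtain ⟨Cf, hCf, hf⟩ := SieveBound.exists_sum_smooth_le hg hM hc hc2 hK k c₁
    (show 1 ≤ w by omega)
  set Cs : ℝ := K * (1 + 2 ^ k) * C' * C₁ * ((w ^ D : ℕ) : ℝ) ^ 4 with hCs
  have hCs0 : 0 ≤ Cs := by positivity
  refine ⟨(2 ^ c₁ + 1) * K * CE + (K * C' + Cf + Cs) * (1 / Real.log 2 ^ m), by positivity,
    fun X hX ι Ω N hs hN => ?_⟩
  have hX2 : (2 : ℝ) ≤ X := by exact_mod_cast hX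
  have hlX2 : Real.log 2 ≤ Real.log X := Real.log_le_log (by norm_num) hX2
  have hlX : 0 < Real.log X := hl2.trans_le hlX2
  set L := Real.log X ^ m with hL
  have hL0 : 0 < L := by positivity
  have hL1 : 1 ≤ 1 / Real.log 2 ^ m * L := by
    rw [one_div, ← div_eq_inv_mul, le_div_iff₀ (by positivity), one_mul]
    exact pow_le_pow_left₀ hl2.le hlX2 m
  suffices h : ∑ ω ∈ Ω, primeProd (locWeight p₀ M c) (N ω) ≤
      (2 ^ c₁ + 1) * K * CE * ((X : ℝ) ^ 2 * L) + (K * C' + Cf + Cs) * (X : ℝ) ^ 2 by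
    refine h.trans ?_
    have h1 := mul_le_mul_of_nonneg_left hL1
      (show 0 ≤ (K * C' + Cf + Cs) * (X : ℝ) ^ 2 by positivity)
    linarith
  rcases lt_or_ge X (w ^ D) with hXs | hXl
  · have h1 : (#Ω : ℝ) ≤ K * (X ^ 2 + X * 2 ^ k) := by
      have h2 := hs 2 le_rfl 1 one_ne_zero ∅ (by simp) (by simp)
      simpa [hg.map_one] using h2
    have h2 : ∀ ω ∈ Ω, primeProd (locWeight p₀ M c) (N ω) ≤ C' * (C₁ * (X : ℝ) ^ 4) :=
      fun ω hω => by
        refine (hR' _ (hN ω hω).1).trans ?_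
        gcongr
        exact_mod_cast (hN ω hω).2
    have h3 : ∑ ω ∈ Ω, primeProd (locWeight p₀ M c) (N ω) ≤ Cs * (X : ℝ) ^ 2 := by
      calc ∑ ω ∈ Ω, primeProd (locWeight p₀ M c) (N ω) ≤ #Ω • (C' * (C₁ * (X : ℝ) ^ 4)) :=
            sum_le_card_nsmul _ _ _ h2
        _ = #Ω * (C' * (C₁ * (X : ℝ) ^ 4)) := nsmul_eq_mul _ _
        _ ≤ (K * (X ^ 2 + X * 2 ^ k)) * (C' * (C₁ * (X : ℝ) ^ 4)) := by gcongr
        _ ≤ (K * (X ^ 2 + X ^ 2 * 2 ^ k)) * (C' * (C₁ * ((w ^ D : ℕ) : ℝ) ^ 4)) := by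
            gcongr
            exact le_self_pow₀ (by linarith) two_ne_zero
        _ = _ := by rw [hCs]; ring
    refine h3.trans ?_
    have h4 : 0 ≤ (2 ^ c₁ + 1) * K * CE * ((X : ℝ) ^ 2 * L) := by positivity
    have h5 : 0 ≤ (K * C' + Cf) * (X : ℝ) ^ 2 := by positivity
    linarith
  obtain ⟨J, hJ1, hJ2⟩ := exists_pow_two_pow_mul_le hw2 (by omega) hXl
  obtain ⟨Z, hZ⟩ : ∃ Z, Z = w ^ 2 ^ J := ⟨_, rfl⟩
  rw [← hZ] at hJ1 hJ2
  have hwZ : w ≤ Z := hZ ▸ Nat.le_self_pow (by positivity) w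
  have hZ2 : 2 ≤ Z := hw2.trans hwZ
  have hZ1' : (1 : ℝ) ≤ Z := by exact_mod_cast (show 1 ≤ Z by omega)
  have hNZ : ∀ ω ∈ Ω, N ω ≤ Z ^ c₁ := fun ω hω => by
    calc N ω ≤ C₁ * X ^ 4 := (hN ω hω).2
      _ ≤ Z * (Z ^ (2 * D)) ^ 4 := by gcongr; omega
      _ = Z ^ c₁ := by rw [hc₁]; ring
  have hZX : Z ≤ X := (Nat.le_self_pow (by omega) Z).trans hJ1
  have hlogy : ∀ y : ℕ, 1 ≤ y → y ≤ Z → Real.log y ^ m ≤ L := fun y hy hyZ => by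
    have h1 : (1 : ℝ) ≤ y := by exact_mod_cast hy
    have : 0 ≤ Real.log y := Real.log_nonneg h1
    rw [hL]
    gcongr
    exact hyZ.trans hZX
  have hyi : ∀ i ∈ range J, w ≤ w ^ 2 ^ i ∧ w ^ 2 ^ i ≤ Z ∧ (w ^ 2 ^ i) ^ 2 ^ (J - i) = Z :=
    fun i hi => by
      have hiJ := mem_range.1 hi
      refine ⟨Nat.le_self_pow (by positivity) w, hZ ▸ Nat.pow_le_pow_right (by omega)
        (Nat.pow_le_pow_right (by omega) hiJ.le), ?_⟩
      rw [hZ, ← pow_mul, ← pow_add]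
      congr 2
      omega
  have h2c : ∀ i ≤ J, 2 ^ (c₁ * 2 ^ (J - i)) ≤ Z := fun i _ => by
    calc 2 ^ (c₁ * 2 ^ (J - i)) ≤ 2 ^ (8 * (c₁ + 1) * 2 ^ J) :=
          Nat.pow_le_pow_right (by omega) (Nat.mul_le_mul (by omega)
            (Nat.pow_le_pow_right (by omega) (by omega)))
      _ = (2 ^ (8 * (c₁ + 1))) ^ 2 ^ J := pow_mul _ _ _
      _ ≤ Z := by rw [hZ]; gcongr
  have herr : ∀ (y l : ℕ), y ≤ Z → 2 ^ l ≤ Z → ∀ S ⊆ Icc 1 (Z ^ 4),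
      2 ^ l * K * (X * (y : ℝ) ^ k * ∑ a ∈ S, primeProd (locWeight p₀ M c) a * a) ≤
        K * C' * X * (Z : ℝ) ^ (k + 13) := fun y l hy hl S hS => by
    have h1 := sum_primeProd_locWeight_mul_le (zero_le_one.trans hC') hR' hS
    have h2 : ((2 : ℝ) ^ l) ≤ Z := by exact_mod_cast hl
    calc 2 ^ l * K * (X * (y : ℝ) ^ k * ∑ a ∈ S, primeProd (locWeight p₀ M c) a * a)
        ≤ Z * K * (X * (Z : ℝ) ^ k * (C' * (Z : ℝ) ^ 12)) := by
          have : 0 ≤ ∑ a ∈ S, primeProd (locWeight p₀ M c) a * a :=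
            sum_nonneg fun a _ => mul_nonneg (hR0 a) (Nat.cast_nonneg a)
          gcongr
      _ = _ := by ring
  set SA := (Icc 1 (Z ^ 4)).filter fun a => ∀ p, p.Prime → p ∣ a → p ≤ Z ^ 2
  set SI : ℕ → Finset ℕ := fun i => (Icc (Z + 1) (Z ^ 4)).filter
    fun a => ∀ p, p.Prime → p ∣ a → p ≤ (w ^ 2 ^ i) ^ 2 with hSI
  have hsplit := sum_le_sum_filter_add Ω (fun ω => hR0 (N ω)) J
    (fun ω => ∃ a ∈ SA, ∃ b, N ω = a * b ∧ ∀ p, p.Prime → p ∣ b → Z < p ∧ a.factorization p ≠ 1)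
    (fun ω => ∃ a ∈ Icc (Z + 1) (Z ^ 4), (∀ p, p.Prime → p ∣ a → p ≤ w) ∧ a ∣ N ω)
    (fun i ω => ∃ a ∈ SI i, ∃ b, N ω = a * b ∧
      ∀ p, p.Prime → p ∣ b → w ^ 2 ^ i < p ∧ a.factorization p ≠ 1) fun ω hω => by
    rcases exists_smooth_decomposition (show 1 ≤ Z by omega) (hN ω hω).1 with
      ⟨a, b, h1, h2, h3, h4⟩ | ⟨q, a, b, -, h2, h3, h4, h5, h6, h7⟩
    · refine Or.inl ⟨a, mem_filter.2 ⟨mem_Icc.2 ⟨Nat.one_le_iff_ne_zero.2 fun h => ?_, ?_⟩,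
        fun p hp hpa => (h3 p hp hpa).trans (Nat.le_self_pow two_ne_zero Z)⟩, b, h1, h4⟩
      · exact (hN ω hω).1 (by rw [h1, h, zero_mul])
      · exact h2.trans (Nat.le_self_pow (by norm_num) Z)
    · rcases le_or_gt q w with hq | hq
      · exact Or.inr (Or.inr ⟨a, mem_Icc.2 ⟨h4, h5⟩, fun p hp hpa => (h6 p hp hpa).trans hq,
          ⟨b, h3⟩⟩)
      · obtain ⟨i, hi, a, ha, hb⟩ := exists_class hZ hq h2 h3 h4 h5 h6 h7
        exact Or.inr (Or.inl ⟨i, hi, a, mem_filter.2 ha, hb⟩)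
  have hPart1 := hs.sum_class_le hg hM hc hc2 hK (filter_subset (fun ω => ∃ a ∈ SA, ∃ b,
    N ω = a * b ∧ ∀ p, p.Prime → p ∣ b → Z < p ∧ a.factorization p ≠ 1) Ω) (y := Z) (l := c₁) hZ2
    (hwp.trans hwZ) (S := SA) fun ω hω => by
      have := mem_filter.1 hω
      exact ⟨(hN ω this.1).1, hNZ ω this.1, this.2⟩
  have hPart2 : ∀ i ∈ range J, ∑ ω ∈ Ω with (∃ a ∈ SI i, ∃ b, N ω = a * b ∧
      ∀ p, p.Prime → p ∣ b → w ^ 2 ^ i < p ∧ a.factorization p ≠ 1),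
        primeProd (locWeight p₀ M c) (N ω) ≤
      K * CE * ((X : ℝ) ^ 2 * L) * (1 / 2) ^ (J - i) + K * C' * X * (Z : ℝ) ^ (k + 13) :=
    fun i hi => by
    obtain ⟨hy1, hy2, hy3⟩ := hyi i hi
    set y := w ^ 2 ^ i with hy
    have h1 := hs.sum_class_le hg hM hc hc2 hK (filter_subset (fun ω => ∃ a ∈ SI i, ∃ b,
      N ω = a * b ∧ ∀ p, p.Prime → p ∣ b → y < p ∧ a.factorization p ≠ 1) Ω) (y := y)
      (l := c₁ * 2 ^ (J - i)) (by omega) (hwp.trans hy1) (S := SI i) fun ω hω => by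
        have := mem_filter.1 hω
        refine ⟨(hN ω this.1).1, ?_, this.2⟩
        rw [mul_comm c₁, pow_mul, hy3]
        exact hNZ ω this.1
    refine h1.trans ?_
    rw [mul_add]
    have hlyw : Real.log w ≤ Real.log y :=
      Real.log_le_log (by exact_mod_cast (show 0 < w by omega)) (by exact_mod_cast hy1)
    have hly : 0 < Real.log y := by linarith
    have hlZ : Real.log Z = 2 ^ (J - i) * Real.log y := by
      rw [← hy3]; push_cast; rw [Real.log_pow]; push_cast; ring
    have hκA : A / Real.log y * Real.log y = A := div_mul_cancel₀ _ hly.ne'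
    refine add_le_add ?_ (herr _ _ hy2 (h2c i (mem_range.1 hi).le) _ fun a ha => ?_)
    · have h2 := hE y (by omega) (A / Real.log y) (by positivity)
        (by rw [div_le_div_iff₀ hly (by norm_num)]; linarith) hκA.le (SI i)
        fun a ha => (mem_filter.1 ha).2
      have h3 := sum_weightTerm_zero_le (M := M) (c := c) hg hM hc (κ := A / Real.log y)
        (by positivity) (show 1 ≤ Z by omega) (S := SI i) fun a ha => by
          have := mem_Icc.1 (mem_filter.1 ha).1
          omega
      have h4 : A / Real.log y * Real.log Z = (c₁ + 1) * Real.log 2 * 2 ^ (J - i) := by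
        rw [hlZ, ← hA]
        field_simp
      rw [h4] at h3
      set e := Real.exp (-((c₁ + 1) * Real.log 2 * 2 ^ (J - i))) with he
      have he0 : 0 < e := Real.exp_pos _
      have h5 := two_pow_mul_exp_neg_le c₁ (J - i)
      set V := ∏ p ∈ y.primesLE with p₀ < p, (1 - g p)
      have hV : 0 ≤ V := prod_nonneg fun p hp => by
        simp only [mem_filter, Nat.mem_primesLE] at hp
        linarith [hg.prime_le p hp.1.2 hp.2]
      calc 2 ^ (c₁ * 2 ^ (J - i)) * K * ((X : ℝ) ^ 2 * (V * ∑ a ∈ SI i, weightTerm p₀ M c g 0 a))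
          ≤ 2 ^ (c₁ * 2 ^ (J - i)) * K * ((X : ℝ) ^ 2 *
              (V * (e * ∑ a ∈ SI i, weightTerm p₀ M c g (A / Real.log y) a))) := by gcongr
        _ = (2 ^ (c₁ * 2 ^ (J - i)) * e) * K * ((X : ℝ) ^ 2 *
              (V * ∑ a ∈ SI i, weightTerm p₀ M c g (A / Real.log y) a)) := by ring
        _ ≤ (1 / 2) ^ (J - i) * K * ((X : ℝ) ^ 2 * (CE * L)) := by
            have h6 := h2.trans (mul_le_mul_of_nonneg_left (hlogy y (by omega) hy2) hCE)
            have h7 : 0 ≤ ∑ a ∈ SI i, weightTerm p₀ M c g (A / Real.log y) a :=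
              sum_nonneg fun a _ => weightTerm_nonneg hg hM hc _ a
            gcongr
        _ = _ := by ring
    · have := mem_Icc.1 (mem_filter.1 ha).1
      exact mem_Icc.2 ⟨by omega, this.2⟩
  have hPart3 := hf X Z (by omega) (hD ▸ hJ1) ι Ω _ N hs (filter_subset (fun ω =>
    ∃ a ∈ Icc (Z + 1) (Z ^ 4), (∀ p, p.Prime → p ∣ a → p ≤ w) ∧ a ∣ N ω) Ω) fun ω hω => by
      have := (@mem_filter _ _ (_) _ _).1 hω
      exact ⟨(hN ω this.1).1, hNZ ω this.1, this.2⟩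
  have hPart1' : 2 ^ c₁ * K * ((X : ℝ) ^ 2 * ((∏ p ∈ Z.primesLE with p₀ < p, (1 - g p)) *
        ∑ a ∈ SA, weightTerm p₀ M c g 0 a) +
        X * (Z : ℝ) ^ k * ∑ a ∈ SA, primeProd (locWeight p₀ M c) a * a) ≤
      2 ^ c₁ * K * CE * ((X : ℝ) ^ 2 * L) + K * C' * X * (Z : ℝ) ^ (k + 13) := by
    rw [mul_add]
    have h3 := h2c J le_rfl
    rw [Nat.sub_self, pow_zero, mul_one] at h3
    refine add_le_add ?_ (herr Z c₁ le_rfl h3 _ (filter_subset _ _))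
    have h1 := hE Z hZ2 0 le_rfl (by norm_num) (by simpa using hA0.le) SA
      fun a ha => (mem_filter.1 ha).2
    have h2 := h1.trans (mul_le_mul_of_nonneg_left (hlogy Z (by omega) le_rfl) hCE)
    calc _ ≤ 2 ^ c₁ * K * ((X : ℝ) ^ 2 * (CE * L)) := by gcongr
      _ = _ := by ring
  have hsum2 := sum_le_sum hPart2
  rw [sum_add_distrib, ← mul_sum, sum_const, card_range, nsmul_eq_mul] at hsum2
  have hhalf := mul_le_mul_of_nonneg_left (sum_half_pow_sub_le J)
    (show 0 ≤ K * CE * ((X : ℝ) ^ 2 * L) by positivity)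
  have hJZ : (J : ℝ) + 1 ≤ Z := by
    have : J + 1 ≤ Z := by
      calc J + 1 ≤ 2 ^ J := Nat.lt_two_pow_self
        _ ≤ 2 ^ 2 ^ J := Nat.lt_two_pow_self.le
        _ ≤ Z := by rw [hZ]; gcongr
    exact_mod_cast this
  have herrs : ((J : ℝ) + 1) * (K * C' * X * (Z : ℝ) ^ (k + 13)) ≤ K * C' * (X : ℝ) ^ 2 := by
    calc ((J : ℝ) + 1) * (K * C' * X * (Z : ℝ) ^ (k + 13))
        ≤ Z * (K * C' * X * (Z : ℝ) ^ (k + 13)) := by gcongr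
      _ = K * C' * X * (Z : ℝ) ^ (k + 14) := by ring
      _ ≤ K * C' * X * X := by
          gcongr
          calc (Z : ℝ) ^ (k + 14) ≤ (Z : ℝ) ^ D := pow_le_pow_right₀ hZ1' (by omega)
            _ ≤ X := by exact_mod_cast hJ1
      _ = _ := by ring
  have hCsX : 0 ≤ Cs * (X : ℝ) ^ 2 := by positivity
  refine hsplit.trans ?_
  linarith [hPart1.trans hPart1']

end NairBound

section FormApplication

open Polynomial Finset

theorem primInd_one (f : ℤ[X]) (u v : ℤ) : primInd f 1 u v = 1 := by
  rw [primInd_eq_ite (Q := True) (by simpa using fun p hp h => absurd h hp.ne_one), if_pos trivial]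

theorem exists_isFormDensity_primInd {f : ℤ[X]} (hdeg : f.natDegree = 3 ∨ f.natDegree = 4)
    (hf : Squarefree (f.map (Int.castRingHom ℚ))) :
    ∃ C₀ : ℝ, 0 ≤ C₀ ∧ ∃ p₁ : ℕ, ∀ p₀ ≥ p₁,
      IsFormDensity (fun n => meanTwo n (primInd f n)) C₀ p₀ := by
  obtain ⟨M₁, hM₁⟩ := exists_rootCount_pow_le hf
  have hdeg' : (f.map (Int.castRingHom ℚ)).natDegree = 3 ∨
      (f.map (Int.castRingHom ℚ)).natDegree = 4 := by
    rwa [natDegree_map_eq_of_injective (RingHom.injective_int _)]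
  obtain ⟨M₂, hM₂⟩ := exists_rootCount_pow_le (f := reflect 4 f)
    (by rw [map_reflect]; exact squarefree_reflect hdeg' hf)
  have hpp : ∀ p k : ℕ, p.Prime → meanTwo (p ^ k) (primInd f (p ^ k)) ≤
      ((M₁ + M₂ : ℕ) : ℝ) / (p : ℝ) ^ k := fun p k hp => by
    refine (meanTwo_primInd_prime_pow_le f (by omega) hp k).trans ?_
    gcongr
    push_cast
    exact add_le_add (by exact_mod_cast hM₁ p hp k) (by exact_mod_cast hM₂ p hp k)
  refine ⟨(M₁ + M₂ : ℕ), Nat.cast_nonneg _, 2 * (M₁ + M₂), fun p₀ hp₀ =>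
    ⟨meanTwo_primInd_nonneg f, by simp [meanTwo, primInd_one], fun {m n} h => ?_, hpp,
      fun p hp hlt => ?_⟩⟩
  · rcases eq_or_ne m 0 with rfl | hm
    · simp [meanTwo]
    rcases eq_or_ne n 0 with rfl | hn
    · simp [meanTwo]
    exact meanTwo_primInd_mul f hm hn h
  · have h1 := hpp p 1 hp
    simp only [pow_one] at h1
    refine h1.trans ?_
    rw [div_le_div_iff₀ (by exact_mod_cast hp.pos) (by norm_num)]
    exact_mod_cast (show (M₁ + M₂) * 2 ≤ 1 * p by omega)

/-- The coprime pairs in the box of size `X` at which the form attached to `f` does not vanish. -/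
noncomputable def coprimeBox (f : ℤ[X]) (X : ℕ) : Finset (ℤ × ℤ) :=
  {ω ∈ Icc (-X : ℤ) X ×ˢ Icc (-X : ℤ) X | Int.gcd ω.1 ω.2 = 1 ∧ binQuartic f ω.1 ω.2 ≠ 0}

theorem sum_Icc_neg_eq_sum_range (X : ℕ) (φ : ℤ → ℝ) :
    ∑ u ∈ Icc (-X : ℤ) X, φ u = ∑ i ∈ range (2 * X + 1), φ (-X + i) := by
  refine sum_nbij' (fun u => (u + X).toNat) (fun i => -X + i) (fun u hu => ?_) (fun i hi => ?_)
    (fun u hu => ?_) (fun i hi => ?_) fun u hu => ?_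
  · rw [mem_Icc] at hu; rw [mem_range]; omega
  · rw [mem_range] at hi; rw [mem_Icc]; omega
  · rw [mem_Icc] at hu; omega
  · rw [mem_range] at hi; omega
  · rw [mem_Icc] at hu; congr 1; omega

theorem exists_sieveBound_coprimeBox {f : ℤ[X]} {C₀ : ℝ} {p₀ : ℕ} (hC₀ : 0 ≤ C₀)
    (hg : IsFormDensity (fun n => meanTwo n (primInd f n)) C₀ p₀) :
    ∃ k : ℕ, ∀ X : ℕ, 1 ≤ X → SieveBound (fun n => meanTwo n (primInd f n)) p₀ 18 k X
      (coprimeBox f X) (fun ω => (binQuartic f ω.1 ω.2).natAbs) := by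
  obtain ⟨k, hk⟩ := sum_box_sifted_le hC₀
  refine ⟨k, fun X hX y hy a ha P hP hPa => ?_⟩
  have hprime : ∀ p ∈ P, p.Prime := fun p hp => (Nat.mem_primesLE.1 (hP hp)).2
  have h1 := hk (primInd f) (periodicTwo_primInd f) (primInd_eq_zero_or_one f) y hy P hP
    (fun p hp => by simpa using hg.prime_pow_le p 1 (hprime p hp))
    (fun p hp => hg.prime_le p (hprime p hp) (hPa p hp).1) a ha (fun p hp => (hPa p hp).2)
    (2 * X + 1) (-X)
  have hX1 : (1 : ℝ) ≤ X := by exact_mod_cast hX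
  have hterm : ∀ u v : ℤ, 0 ≤ primInd f a u v * ∏ p ∈ P, (1 - primInd f p u v) := fun u v =>
    mul_nonneg (primInd_nonneg _ _ _ _) (prod_nonneg fun p _ => by
      rcases primInd_eq_zero_or_one f p u v with h | h <;> simp [h])
  have h2 : (#{ω ∈ coprimeBox f X | a ∣ (binQuartic f ω.1 ω.2).natAbs ∧
      ∀ p ∈ P, ¬ p ∣ (binQuartic f ω.1 ω.2).natAbs} : ℝ) ≤
      ∑ ω ∈ Icc (-X : ℤ) X ×ˢ Icc (-X : ℤ) X,
        primInd f a ω.1 ω.2 * ∏ p ∈ P, (1 - primInd f p ω.1 ω.2) := by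
    rw [card_eq_sum_ones, Nat.cast_sum]
    refine (sum_le_sum fun ω hω => ?_).trans (sum_le_sum_of_subset_of_nonneg
      ((filter_subset _ _).trans (filter_subset _ _)) fun ω _ _ => hterm _ _)
    obtain ⟨h3, h4, h5⟩ := mem_filter.1 hω
    obtain ⟨-, h6, -⟩ := mem_filter.1 h3
    have h7 : ∀ p : ℕ, p.Prime → ¬ ((p : ℤ) ∣ ω.1 ∧ (p : ℤ) ∣ ω.2) := fun p hp h => by
      have := Int.dvd_coe_gcd h.1 h.2
      rw [h6] at this
      exact hp.one_lt.ne' (by exact_mod_cast Int.eq_one_of_dvd_one (by positivity) this)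
    rw [primInd_eq_ite (Q := True) (by simpa using ⟨Int.natCast_dvd.2 h4, fun p hp _ => by
      simpa using h7 p hp⟩), if_pos trivial, prod_eq_one fun p hp => ?_]
    · simp
    · rw [primInd_eq_ite (Q := False) (by
        simpa using fun h => absurd (Int.natCast_dvd.1 h) (h5 p hp)), if_neg not_false, sub_zero]
  rw [sum_product] at h2
  simp only [sum_Icc_neg_eq_sum_range] at h2
  refine (h2.trans h1).trans ?_
  have hV : 0 ≤ ∏ p ∈ P, (1 - meanTwo p (primInd f p)) := prod_nonneg fun p hp => by
    linarith [hg.prime_le p (hprime p hp) (hPa p hp).1]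
  have hga := hg.nonneg a
  set V := ∏ p ∈ P, (1 - meanTwo p (primInd f p))
  have hL : ((2 * X + 1 : ℕ) : ℝ) ≤ 3 * X := by push_cast; linarith
  calc 2 * ((2 * X + 1 : ℕ) : ℝ) ^ 2 * meanTwo a (primInd f a) * V +
        4 * ((2 * X + 1 : ℕ) : ℝ) * a * (y : ℝ) ^ k
      ≤ 2 * (3 * X : ℝ) ^ 2 * meanTwo a (primInd f a) * V + 4 * (3 * X) * a * (y : ℝ) ^ k := by
        gcongr
    _ ≤ _ := by
        have : 0 ≤ (X : ℝ) * a * (y : ℝ) ^ k := by positivity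
        dsimp only
        linarith

theorem natAbs_binQuartic_le (f : ℤ[X]) {u v : ℤ} {X : ℕ} (hu : |u| ≤ X) (hv : |v| ≤ X) :
    (binQuartic f u v).natAbs ≤ (∑ i ∈ range 5, (f.coeff i).natAbs) * X ^ 4 := by
  zify
  rw [binQuartic, sum_mul]
  refine (abs_sum_le_sum_abs _ _).trans (sum_le_sum fun i hi => ?_)
  have hi4 : i ≤ 4 := by have := mem_range.1 hi; omega
  rw [abs_mul, abs_mul, abs_pow, abs_pow, mul_assoc]
  refine mul_le_mul_of_nonneg_left ?_ (abs_nonneg _)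
  calc |u| ^ i * |v| ^ (4 - i) ≤ (X : ℤ) ^ i * X ^ (4 - i) := by gcongr
    _ = X ^ 4 := by rw [← pow_add]; congr 1; omega

theorem exists_sum_primeProd_binQuartic_le {a : ℤ} (ha : ¬ IsSquare a) {f : ℤ[X]}
    (hdeg : f.natDegree = 3 ∨ f.natDegree = 4)
    (hf : Squarefree (f.map (Int.castRingHom ℚ))) {c : ℚ} {r : ℕ} {g : Fin r → ℚ[X]}
    (hirr : ∀ i, Irreducible (g i)) (hfac : f.map (Int.castRingHom ℚ) = C c * ∏ i, g i)
    {M : ℝ} (hM : 0 ≤ M) (q₀ : ℕ) :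
    ∃ p₀ ≥ q₀, ∃ C : ℝ, 0 ≤ C ∧ ∀ X : ℕ, 2 ≤ X → ∑ ω ∈ coprimeBox f X,
      primeProd (locWeight p₀ M fun p => sqCount a p) (binQuartic f ω.1 ω.2).natAbs ≤
        C * ((X : ℝ) ^ 2 *
          Real.log X ^ Nat.card {i : Fin r // IsSquare (a : AdjoinRoot (g i))}) := by
  obtain ⟨C₀, hC₀, p₁, hp₁⟩ := exists_isFormDensity_primInd hdeg hf
  set p₀ := max p₁ q₀
  have hg := hp₁ p₀ (le_max_left _ _)
  obtain ⟨K₁, hK₁⟩ := exists_sum_density_le ha hdeg hf hirr hfac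
  obtain ⟨K₂, hK₂⟩ := exists_sum_primesLE_le (Nat.factorial_ne_zero p₀)
    (b := fun p => if p₀ < p then ((sqCount a p : ℝ) - 1) * meanTwo p (primInd f p) else 0)
    (b' := fun p => ((sqCount a p : ℝ) - 1) * meanTwo p (primInd f p)) fun p hp hpd => by
      rw [hp.dvd_factorial, not_le] at hpd
      simp [hpd]
  obtain ⟨k, hk⟩ := exists_sieveBound_coprimeBox hC₀ hg
  obtain ⟨K, hK, h⟩ := SieveBound.exists_sum_le hg hM (c := fun p => (sqCount a p : ℝ))
    (fun p => Nat.cast_nonneg _) (fun p hp => by exact_mod_cast sqCount_le_two a hp)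
    (m := Nat.card {i : Fin r // IsSquare (a : AdjoinRoot (g i))})
    ⟨K₁ + K₂, fun Y hY => by
      rw [sum_filter]
      have h1 := hK₁ Y hY
      have h2 := hK₂ Y
      linarith⟩ (show (0 : ℝ) ≤ 18 by norm_num) k (∑ i ∈ range 5, (f.coeff i).natAbs)
  refine ⟨p₀, le_max_right _ _, K, hK, fun X hX => h X hX _ _ _ (hk X (by omega)) fun ω hω => ?_⟩
  obtain ⟨h1, -, h2⟩ := mem_filter.1 hω
  rw [mem_product, mem_Icc, mem_Icc] at h1
  exact ⟨Int.natAbs_ne_zero.2 h2, natAbs_binQuartic_le f (abs_le.2 h1.1) (abs_le.2 h1.2)⟩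

end FormApplication

section Representations

open Polynomial Finset

theorem card_fiber_rep_le {a : ℤ} (ha : a < 0) {n : ℕ} (hn : n ≠ 0) (S : Finset (ℤ × ℤ))
    (hS : ∀ q ∈ S, q.1 ^ 2 - a * q.2 ^ 2 = n)
    (hmod : ∀ q ∈ S, ∀ q' ∈ S, (n : ℤ) ∣ q.1 * q'.1 - a * (q.2 * q'.2) ∧
      (n : ℤ) ∣ q.1 * q'.2 - q'.1 * q.2) : #S ≤ 9 := by
  have hn' : (n : ℤ) ≠ 0 := by exact_mod_cast hn
  rcases S.eq_empty_or_nonempty with rfl | ⟨q₀, hq₀⟩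
  · simp
  have h9 : #(Icc (-1 : ℤ) 1 ×ˢ Icc (-1 : ℤ) 1) = 9 := by rfl
  rw [← h9]
  refine card_le_card_of_injOn (fun q => ((q.1 * q₀.1 - a * (q.2 * q₀.2)) / n,
    (q.1 * q₀.2 - q₀.1 * q.2) / n)) (fun q hq => ?_) fun q hq q' hq' h => ?_
  · obtain ⟨⟨U, hU⟩, ⟨W, hW⟩⟩ := hmod q hq q₀ hq₀
    have h1 : (n : ℤ) ^ 2 * (U ^ 2 - a * W ^ 2) = n ^ 2 * 1 := by
      calc (n : ℤ) ^ 2 * (U ^ 2 - a * W ^ 2) = (n * U) ^ 2 - a * (n * W) ^ 2 := by ring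
        _ = (q.1 ^ 2 - a * q.2 ^ 2) * (q₀.1 ^ 2 - a * q₀.2 ^ 2) := by rw [← hU, ← hW]; ring
        _ = n ^ 2 * 1 := by rw [hS q hq, hS q₀ hq₀]; ring
    have h2 := mul_left_cancel₀ (pow_ne_zero 2 hn') h1
    have h3 : U ^ 2 ≤ 1 := by nlinarith [sq_nonneg W]
    have h4 : W ^ 2 ≤ 1 := by nlinarith [sq_nonneg U, sq_nonneg W]
    simp only [coe_product, Set.mem_prod, coe_Icc, Set.mem_Icc, hU, hW,
      Int.mul_ediv_cancel_left _ hn']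
    exact ⟨⟨by nlinarith, by nlinarith⟩, ⟨by nlinarith, by nlinarith⟩⟩
  · obtain ⟨⟨U, hU⟩, ⟨W, hW⟩⟩ := hmod q hq q₀ hq₀
    obtain ⟨⟨U', hU'⟩, ⟨W', hW'⟩⟩ := hmod q' hq' q₀ hq₀
    simp only [hU, hW, hU', hW', Int.mul_ediv_cancel_left _ hn', Prod.mk.injEq] at h
    obtain ⟨rfl, rfl⟩ := h
    have h0 := hS q₀ hq₀
    ext
    · refine mul_left_cancel₀ hn' ?_
      rw [← h0]
      linear_combination q₀.1 * (hU - hU') - a * q₀.2 * (hW - hW')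
    · refine mul_left_cancel₀ hn' ?_
      rw [← h0]
      linear_combination q₀.2 * (hU - hU') - q₀.1 * (hW - hW')

theorem card_coprime_rep_le {a : ℤ} (ha : a < 0) {n : ℕ} (hn : n ≠ 0) (S : Finset (ℤ × ℤ))
    (hS : ∀ q ∈ S, Int.gcd q.1 q.2 = 1 ∧ q.1 ^ 2 - a * q.2 ^ 2 = n) :
    #S ≤ 9 * sqCount a n := by
  classical
  have := NeZero.mk hn
  have hz : ∀ q ∈ S, (q.2 : ZMod n) * (q.2 : ZMod n)⁻¹ = 1 := fun q hq => by
    refine ZMod.mul_inv_of_unit _ ((ZMod.coe_int_isUnit_iff_isCoprime _ _).2 ?_)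
    have h1 : IsCoprime q.1 q.2 := Int.isCoprime_iff_gcd_eq_one.2 (hS q hq).1
    have h2 : IsCoprime (q.1 ^ 2 + q.2 * (-a * q.2)) q.2 := (h1.pow_left (m := 2)).add_mul_left_left _
    rw [show q.1 ^ 2 + q.2 * (-a * q.2) = n by rw [← (hS q hq).2]; ring] at h2
    exact h2
  have hyz : ∀ q ∈ S, (q.1 : ZMod n) ^ 2 = a * (q.2 : ZMod n) ^ 2 := fun q hq => by
    have h1 := congrArg (Int.cast : ℤ → ZMod n) (hS q hq).2
    push_cast at h1
    rw [ZMod.natCast_self] at h1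
    linear_combination h1
  set φ : ℤ × ℤ → ZMod n := fun q => q.1 * (q.2 : ZMod n)⁻¹ with hφ
  have hy : ∀ q ∈ S, (q.1 : ZMod n) = φ q * q.2 := fun q hq => by
    simp only [hφ]; linear_combination -(q.1 : ZMod n) * hz q hq
  refine (card_le_mul_card_image (f := φ) S 9 fun ω _ => ?_).trans ?_
  · refine card_fiber_rep_le ha hn _ (fun q hq => (hS q (mem_filter.1 hq).1).2)
      fun q hq q' hq' => ?_
    obtain ⟨h1, h2⟩ := mem_filter.1 hq
    obtain ⟨h1', h2'⟩ := mem_filter.1 hq'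
    have h3 := hy q h1
    have h3' := hy q' h1'
    rw [h2] at h3
    rw [h2'] at h3'
    rw [← ZMod.intCast_zmod_eq_zero_iff_dvd, ← ZMod.intCast_zmod_eq_zero_iff_dvd]
    have h4 : ω ^ 2 = a := by
      have h5 := hyz q h1
      rw [h3] at h5
      have h6 := hz q h1
      linear_combination (q.2 : ZMod n)⁻¹ ^ 2 * h5 +
        (a - ω ^ 2) * ((q.2 : ZMod n) * (q.2 : ZMod n)⁻¹ + 1) * h6
    push_cast
    constructor
    · rw [h3, h3', ← h4]; ring
    · rw [h3, h3']; ring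
  · refine Nat.mul_le_mul_left _ ?_
    rw [sqCount, Nat.card_eq_fintype_card, Fintype.card_subtype]
    refine card_le_card fun x hx => ?_
    obtain ⟨q, hq, rfl⟩ := mem_image.1 hx
    simp only [mem_filter, mem_univ, true_and, hφ]
    have h5 := hyz q hq
    have h6 := hz q hq
    linear_combination (q.2 : ZMod n)⁻¹ ^ 2 * h5 +
        a * ((q.2 : ZMod n) * (q.2 : ZMod n)⁻¹ + 1) * h6

theorem sqCount_mul_le (a : ℤ) {m n : ℕ} (hm : m ≠ 0) (hn : n ≠ 0) (h : m.Coprime n) :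
    sqCount a (m * n) ≤ sqCount a m * sqCount a n := by
  have := NeZero.mk hm
  have := NeZero.mk hn
  unfold sqCount
  rw [← Nat.card_prod]
  have key : ∀ x : ZMod (m * n), x ^ 2 = a → (ZMod.chineseRemainder h x).1 ^ 2 = a ∧
      (ZMod.chineseRemainder h x).2 ^ 2 = a := fun x hx => by
    have h1 := congrArg (ZMod.chineseRemainder h) hx
    rw [map_pow, map_intCast] at h1
    exact ⟨congrArg Prod.fst h1, congrArg Prod.snd h1⟩
  refine Nat.card_le_card_of_injective (fun x => (⟨_, (key x.1 x.2).1⟩, ⟨_, (key x.1 x.2).2⟩))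
    fun x y hxy => ?_
  simp only [Prod.mk.injEq, Subtype.mk.injEq] at hxy
  exact Subtype.ext ((ZMod.chineseRemainder h).injective (Prod.ext hxy.1 hxy.2))

/-- The product of `c p` over the primes `p` dividing `n`. -/
noncomputable def radProd (c : ℕ → ℕ) (n : ℕ) : ℕ := ∏ p ∈ n.primeFactors, c p

theorem radProd_mul_le (c : ℕ → ℕ) {m n : ℕ} (hm : m ≠ 0) (hn : n ≠ 0) :
    radProd c (m * n) ≤ radProd c m * radProd c n := by
  classical
  unfold radProd
  rw [Nat.primeFactors_mul hm hn, ← prod_union_inter]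
  rcases Nat.eq_zero_or_pos (∏ p ∈ m.primeFactors ∪ n.primeFactors, c p) with h | h
  · simp [h]
  · refine Nat.le_mul_of_pos_right _ (prod_pos fun p hp => ?_)
    exact Nat.pos_of_ne_zero fun h0 => h.ne' (prod_eq_zero (mem_union_left _ (mem_inter.1 hp).1) h0)

theorem sqCount_le_radProd (a : ℤ) {c : ℕ → ℕ}
    (hc : ∀ p k : ℕ, p.Prime → k ≠ 0 → sqCount a (p ^ k) ≤ c p) :
    ∀ n : ℕ, n ≠ 0 → sqCount a n ≤ radProd c n := by
  intro n
  induction n using Nat.recOnPosPrimePosCoprime with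
  | prime_pow p k hp hk =>
    intro _
    rw [radProd, Nat.primeFactors_prime_pow hk.ne' hp, prod_singleton]
    exact hc p k hp hk.ne'
  | zero => simp
  | one =>
    intro _
    simp only [radProd, Nat.primeFactors_one, prod_empty, sqCount]
    exact (Nat.card_le_card_of_injective _ Subtype.val_injective).trans (by simp)
  | coprime m n hm hn h ihm ihn =>
    intro _
    have h1 := ihm (by omega)
    have h2 := ihn (by omega)
    refine (sqCount_mul_le a (by omega) (by omega) h).trans ?_
    rw [radProd, h.primeFactors_mul, prod_union h.disjoint_primeFactors]
    exact Nat.mul_le_mul h1 h2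

theorem exists_sqCount_pow_le {a : ℤ} (ha : a ≠ 0) : ∃ q₀ M : ℕ, 1 ≤ M ∧
    (∀ p k : ℕ, p.Prime → sqCount a (p ^ k) ≤ M) ∧
    ∀ p k : ℕ, p.Prime → q₀ < p → k ≠ 0 → sqCount a (p ^ k) ≤ sqCount a p := by
  have hrc : ∀ n, rootCount (X ^ 2 - C a) n = sqCount a n := fun n => by
    simp [rootCount, sqCount, sub_eq_zero]
  have hsf : Squarefree ((X ^ 2 - C a : ℤ[X]).map (Int.castRingHom ℚ)) := by
    refine Separable.squarefree ?_
    simp only [Polynomial.map_sub, Polynomial.map_pow, map_X, map_C]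
    exact separable_X_pow_sub_C _ (by norm_num) (by simpa using ha)
  obtain ⟨M, hM⟩ := exists_rootCount_pow_le hsf
  obtain ⟨A, B, R, hR, h⟩ := exists_bezout_derivative hsf
  refine ⟨R.natAbs, M + 1, by omega, fun p k hp => ?_, fun p k hp hlt hk => ?_⟩
  · rw [← hrc]; exact (hM p hp k).trans (Nat.le_succ _)
  · rw [← hrc, ← hrc]
    refine rootCount_pow_le_rootCount h hp (fun hd => ?_) hk
    have := Nat.le_of_dvd (Int.natAbs_pos.2 hR) (Int.natCast_dvd.1 hd)
    omega

end Representations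

section RepresentationCount

open Finset

theorem sum_radProd_div_sq_le_prod (c : ℕ → ℕ) {N : ℕ} (hN : N ≠ 0) :
    ∑ d ∈ N.divisors with d ^ 2 ∣ N, (radProd c (N / d ^ 2) : ℝ) ≤
      ∏ p ∈ N.primeFactors, ∑ j ∈ range (N.factorization p / 2 + 1),
        if N.factorization p - 2 * j = 0 then (1 : ℝ) else c p := by
  classical
  rw [prod_sum]
  have hd0 : ∀ d ∈ {d ∈ N.divisors | d ^ 2 ∣ N}, d ≠ 0 ∧ d ^ 2 ∣ N := fun d hd => by
    obtain ⟨h1, h2⟩ := mem_filter.1 hd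
    exact ⟨(Nat.pos_of_mem_divisors h1).ne', h2⟩
  have hval : ∀ d ∈ {d ∈ N.divisors | d ^ 2 ∣ N}, (radProd c (N / d ^ 2) : ℝ) =
      ∏ x ∈ N.primeFactors.attach,
        if N.factorization x.1 - 2 * d.factorization x.1 = 0 then (1 : ℝ) else c x.1 := by
    intro d hd
    obtain ⟨h1, h2⟩ := hd0 d hd
    have h3 : N / d ^ 2 ≠ 0 := (Nat.div_pos (Nat.le_of_dvd (Nat.pos_of_ne_zero hN) h2)
      (by positivity)).ne'
    rw [prod_attach N.primeFactors fun p =>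
      if N.factorization p - 2 * d.factorization p = 0 then (1 : ℝ) else c p]
    rw [radProd, Nat.cast_prod]
    have hsub : (N / d ^ 2).primeFactors ⊆ N.primeFactors :=
      Nat.primeFactors_mono (Nat.div_dvd_of_dvd h2) hN
    have hf : ∀ p, (N / d ^ 2).factorization p = N.factorization p - 2 * d.factorization p :=
      fun p => by rw [Nat.factorization_div h2, Nat.factorization_pow]; simp
    rw [← prod_subset hsub fun p hp hp' => ?_]
    · refine prod_congr rfl fun p hp => (if_neg ?_).symm
      rw [← hf]
      exact Finsupp.mem_support_iff.1 hp
    · rw [if_pos]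
      rw [← hf, ← Finsupp.notMem_support_iff]
      exact hp'
  rw [sum_congr rfl hval]
  set e : ℕ → (p : ℕ) → p ∈ N.primeFactors → ℕ := fun d p _ => d.factorization p with he
  have hinj : Set.InjOn e ({d ∈ N.divisors | d ^ 2 ∣ N} : Finset ℕ) := fun d hd d' hd' h => by
    obtain ⟨h1, h2⟩ := hd0 d hd
    obtain ⟨h1', h2'⟩ := hd0 d' hd'
    refine Nat.eq_of_factorization_eq h1 h1' fun p => ?_
    by_cases hp : p ∈ N.primeFactors
    · exact congrFun (congrFun h p) hp
    · have key : ∀ d, d ^ 2 ∣ N → d.factorization p = 0 := fun d hd => by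
        rw [← Finsupp.notMem_support_iff]
        exact fun h => hp (Nat.primeFactors_mono ((dvd_pow_self d two_ne_zero).trans hd) hN h)
      rw [key d h2, key d' h2']
  rw [← sum_image (g := e) (f := fun x => ∏ y ∈ N.primeFactors.attach,
    if N.factorization y.1 - 2 * x y.1 y.2 = 0 then (1 : ℝ) else c y.1) hinj]
  refine sum_le_sum_of_subset_of_nonneg (fun x hx => ?_) fun x _ _ => prod_nonneg fun _ _ => ?_
  · obtain ⟨d, hd, rfl⟩ := mem_image.1 hx
    obtain ⟨h1, h2⟩ := hd0 d hd
    refine mem_pi.2 fun p _ => mem_range.2 ?_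
    have h3 := (Nat.factorization_le_iff_dvd (by positivity) hN).2 h2 p
    rw [Nat.factorization_pow] at h3
    simp only [Finsupp.coe_smul, Pi.smul_apply, smul_eq_mul] at h3
    simp only [he]
    omega
  · split_ifs <;> positivity

theorem sum_radProd_div_sq_le {c : ℕ → ℕ} {p₀ M : ℕ} (hM : 1 ≤ M)
    (hc : ∀ p, p.Prime → c p ≤ 2) {N : ℕ} (hN : N ≠ 0) :
    ∑ d ∈ N.divisors with d ^ 2 ∣ N,
        (radProd (fun p => if p ≤ p₀ then M else c p) (N / d ^ 2) : ℝ) ≤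
      primeProd (locWeight p₀ M fun p => c p) N := by
  refine (sum_radProd_div_sq_le_prod _ hN).trans ?_
  unfold primeProd
  refine prod_le_prod (fun p _ => sum_nonneg fun j _ => by split_ifs <;> positivity)
    fun p hp => ?_
  have hk : N.factorization p ≠ 0 := Finsupp.mem_support_iff.1 hp
  generalize N.factorization p = k at hk
  have hc2 : (c p : ℝ) ≤ 2 := by exact_mod_cast hc p (Nat.prime_of_mem_primeFactors hp)
  have hM1 : (1 : ℝ) ≤ M := by exact_mod_cast hM
  rw [locWeight, if_neg hk]
  by_cases hpp : p ≤ p₀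
  · simp only [if_pos hpp]
    calc ∑ j ∈ range (k / 2 + 1), (if k - 2 * j = 0 then (1 : ℝ) else (M : ℝ))
        ≤ ∑ j ∈ range (k / 2 + 1), (M : ℝ) := sum_le_sum fun j _ => by split_ifs <;> linarith
      _ = M * ((k / 2 + 1 : ℕ) : ℝ) := by simp [mul_comm]
      _ ≤ M * (k + 1) := by
          gcongr
          exact_mod_cast (show k / 2 + 1 ≤ k + 1 by omega)
  · simp only [if_neg hpp]
    split_ifs with h1
    · simp [h1]
    · rw [sum_range_succ]
      have h2 : ∑ j ∈ range (k / 2), (if k - 2 * j = 0 then (1 : ℝ) else (c p : ℝ)) ≤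
          ∑ j ∈ range (k / 2), (2 : ℝ) := sum_le_sum fun j _ => by split_ifs <;> linarith
      rw [sum_const, card_range, nsmul_eq_mul] at h2
      refine (add_le_add h2 le_rfl).trans ?_
      obtain ⟨l, rfl | rfl⟩ : ∃ l, k = 2 * l ∨ k = 2 * l + 1 := ⟨k / 2, by omega⟩
      · rw [show 2 * l / 2 = l by omega, if_pos (by omega)]
        push_cast; linarith
      · rw [show (2 * l + 1) / 2 = l by omega, if_neg (by omega)]
        push_cast; linarith

theorem card_rep_le {a : ℤ} (ha : a < 0) {c : ℕ → ℕ} {p₀ M : ℕ} (hM : 1 ≤ M)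
    (hc : ∀ p, p.Prime → c p ≤ 2)
    (hη : ∀ p k : ℕ, p.Prime → k ≠ 0 → sqCount a (p ^ k) ≤ if p ≤ p₀ then M else c p)
    {t : ℤ} (ht : t ≠ 0) {N : ℕ} (hN : N ≠ 0) (S : Finset (ℤ × ℤ))
    (hS : ∀ q ∈ S, Int.gcd q.1 (Int.gcd q.2 t) = 1 ∧ q.1 ^ 2 - a * q.2 ^ 2 = t ^ 2 * N) :
    (#S : ℝ) ≤ 9 * radProd (fun p => if p ≤ p₀ then M else c p) t.natAbs *
      primeProd (locWeight p₀ M fun p => c p) N := by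
  classical
  set η := radProd fun p => if p ≤ p₀ then M else c p with hηdef
  have ht' : t.natAbs ≠ 0 := Int.natAbs_ne_zero.2 ht
  have hD : ∀ q ∈ S, Int.gcd q.1 q.2 ∈ {d ∈ N.divisors | d ^ 2 ∣ N} := fun q hq => by
    obtain ⟨h1, h2⟩ := hS q hq
    have h3 : (Int.gcd q.1 q.2 : ℤ) ^ 2 ∣ t ^ 2 * N := by
      rw [← h2]
      exact dvd_sub (pow_dvd_pow_of_dvd (Int.gcd_dvd_left _ _) 2)
        ((pow_dvd_pow_of_dvd (Int.gcd_dvd_right _ _) 2).mul_left _)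
    have h4 : IsCoprime ((Int.gcd q.1 q.2 : ℤ) ^ 2) (t ^ 2) := by
      refine IsCoprime.pow (Int.isCoprime_iff_gcd_eq_one.2 ?_)
      rw [← Int.gcd_assoc] at h1
      exact h1
    have h5 : (Int.gcd q.1 q.2) ^ 2 ∣ N := by exact_mod_cast h4.dvd_of_dvd_mul_left h3
    exact mem_filter.2 ⟨Nat.mem_divisors.2 ⟨(dvd_pow_self _ two_ne_zero).trans h5, hN⟩, h5⟩
  have hfib : ∀ d ∈ {d ∈ N.divisors | d ^ 2 ∣ N}, #{q ∈ S | Int.gcd q.1 q.2 = d} ≤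
      9 * (η t.natAbs * η (N / d ^ 2)) := fun d hd => by
    obtain ⟨h1, h2⟩ := mem_filter.1 hd
    have hd0 : 0 < d := Nat.pos_of_mem_divisors h1
    have hd0' : (d : ℤ) ≠ 0 := by exact_mod_cast hd0.ne'
    obtain ⟨N', rfl⟩ := h2
    have hN' : N' ≠ 0 := right_ne_zero_of_mul hN
    rw [Nat.mul_div_cancel_left _ (by positivity)]
    have hdq : ∀ q ∈ {q ∈ S | Int.gcd q.1 q.2 = d}, ∃ y z : ℤ, q = (d * y, d * z) :=
      fun q hq => by
        obtain ⟨h3, h4⟩ := mem_filter.1 hq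
        obtain ⟨y, hy⟩ := h4 ▸ Int.gcd_dvd_left q.1 q.2
        obtain ⟨z, hz⟩ := h4 ▸ Int.gcd_dvd_right q.1 q.2
        exact ⟨y, z, Prod.ext hy hz⟩
    have hinj : Set.InjOn (fun q : ℤ × ℤ => (q.1 / (d : ℤ), q.2 / (d : ℤ)))
        ({q ∈ S | Int.gcd q.1 q.2 = d} : Finset (ℤ × ℤ)) := fun q hq q' hq' h => by
      obtain ⟨y, z, rfl⟩ := hdq q hq
      obtain ⟨y', z', rfl⟩ := hdq q' hq'
      simp only [Int.mul_ediv_cancel_left _ hd0', Prod.mk.injEq] at h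
      rw [h.1, h.2]
    rw [← card_image_of_injOn hinj]
    refine (card_coprime_rep_le ha (n := t.natAbs ^ 2 * N') (by positivity) _
      fun q hq => ?_).trans (Nat.mul_le_mul_left 9 ?_)
    · obtain ⟨q', hq', rfl⟩ := mem_image.1 hq
      obtain ⟨h3, h4⟩ := mem_filter.1 hq'
      obtain ⟨y, z, rfl⟩ := hdq q' hq'
      have h5 := (hS _ h3).2
      simp only [Int.mul_ediv_cancel_left _ hd0'] at h4 h5 ⊢
      rw [Int.gcd_mul_left, Int.natAbs_natCast] at h4
      refine ⟨Nat.eq_of_mul_eq_mul_left hd0 (h4.trans (mul_one d).symm), ?_⟩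
      push_cast at h5 ⊢
      rw [sq_abs]
      refine mul_left_cancel₀ (pow_ne_zero 2 hd0') ?_
      linear_combination h5
    · refine (sqCount_le_radProd a hη _ (by positivity)).trans ?_
      refine (radProd_mul_le _ (by positivity) hN').trans (le_of_eq ?_)
      congr 1
      rw [hηdef, radProd, Nat.primeFactors_pow _ two_ne_zero, radProd]
  rw [card_eq_sum_card_fiberwise hD]
  push_cast
  refine (sum_le_sum fun d hd => (Nat.cast_le (α := ℝ)).2 (hfib d hd)).trans ?_
  push_cast
  rw [← mul_sum, ← mul_sum, ← mul_assoc]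
  exact mul_le_mul_of_nonneg_left (sum_radProd_div_sq_le hM hc hN) (by positivity)

end RepresentationCount

section MultiplicativeMean

open Finset

theorem exists_sum_inv_primesLE_le : ∃ C : ℝ, ∀ Y : ℕ, 2 ≤ Y →
    ∑ p ∈ Y.primesLE, (1 : ℝ) / p ≤ Real.log (Real.log Y) + C := by
  obtain ⟨C₁, h₁⟩ := exists_sum_sqCount_mul_rootCount_le 1 (G := Polynomial.X) (g := Polynomial.X)
    Polynomial.irreducible_X one_ne_zero (by simp)
  obtain ⟨C₂, h₂⟩ := exists_sum_primesLE_le two_ne_zero (b := fun p => (1 : ℝ) / p)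
    (b' := fun p => ((sqCount 1 p : ℝ) - 1) * rootCount Polynomial.X p / p) fun p hp hp2 => by
      have := Fact.mk hp
      have : Fact (2 < p) := ⟨lt_of_le_of_ne hp.two_le fun h => hp2 (h ▸ dvd_rfl)⟩
      have h1 : 2 ≤ sqCount 1 p := by
        rw [sqCount]
        refine Finite.one_lt_card_iff_nontrivial.2 ⟨⟨⟨1, by simp⟩, ⟨-1, by simp⟩, fun h => ?_⟩⟩
        exact ZMod.neg_one_ne_one (congrArg Subtype.val h).symm
      have h2 : (2 : ℝ) ≤ sqCount 1 p := by exact_mod_cast h1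
      rw [rootCount_X]
      gcongr
      push_cast
      linarith
  refine ⟨C₁ + C₂, fun Y hY => ?_⟩
  have h3 := h₁ Y hY
  rw [if_pos ⟨1, by simp⟩, one_mul] at h3
  linarith [h₂ Y]

theorem radProd_one (c : ℕ → ℕ) : radProd c 1 = 1 := by simp [radProd]

theorem radProd_mul (c : ℕ → ℕ) {m n : ℕ} (h : m.Coprime n) :
    radProd c (m * n) = radProd c m * radProd c n := by
  rw [radProd, h.primeFactors_mul, prod_union h.disjoint_primeFactors]
  rfl

theorem radProd_prime_pow (c : ℕ → ℕ) {p k : ℕ} (hp : p.Prime) (hk : k ≠ 0) :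
    radProd c (p ^ k) = c p := by
  rw [radProd, Nat.primeFactors_prime_pow hk hp, prod_singleton]

theorem sum_radProd_mul_log_le {c : ℕ → ℕ} {M : ℕ} (hc : ∀ p, p.Prime → c p ≤ M) (T : ℕ) :
    (∑ t ∈ Ioc 0 T, (radProd c t : ℝ)) * Real.log T ≤
      ((Real.log 4 + 4) * M + 1) * T * ∑ t ∈ Ioc 0 T, (radProd c t : ℝ) / t := by
  rcases Nat.eq_zero_or_pos T with rfl | hT
  · simp
  have hl4 : 0 ≤ Real.log 4 + 4 := by have := Real.log_nonneg (show (1 : ℝ) ≤ 4 by norm_num); linarith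
  have hpt : ∀ t ∈ Ioc 0 T, (radProd c t : ℝ) * Real.log T ≤
      radProd c t * Real.log t + T * (radProd c t / t) := fun t ht => by
    rw [mem_Ioc] at ht
    have ht' : (0 : ℝ) < t := by exact_mod_cast ht.1
    have hT' : (0 : ℝ) < T := by exact_mod_cast hT
    have h1 : Real.log T = Real.log t + Real.log (T / t) := by
      rw [Real.log_div hT'.ne' ht'.ne']; ring
    have h2 : Real.log (T / t) ≤ T / t := by
      have := Real.log_le_sub_one_of_pos (show (0 : ℝ) < T / t by positivity)
      linarith
    rw [h1, mul_add, show (T : ℝ) * (radProd c t / t) = radProd c t * (T / t) by ring]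
    gcongr
  set h : ArithmeticFunction ℝ := ⟨fun n => if n = 0 then 0 else (radProd c n : ℝ), by simp⟩
  have hh : ∀ n, n ≠ 0 → h n = radProd c n := fun n hn => if_neg hn
  have hlog : ∀ t ∈ Ioc 0 T, (radProd c t : ℝ) * Real.log t ≤
      M * (h * ArithmeticFunction.vonMangoldt) t := fun t ht => by
    have ht0 : t ≠ 0 := by have := mem_Ioc.1 ht; omega
    rw [← ArithmeticFunction.vonMangoldt_sum, ArithmeticFunction.mul_apply, mul_sum, mul_sum,
      ← Nat.sum_divisorsAntidiagonal' fun _ d => (radProd c t : ℝ) * ArithmeticFunction.vonMangoldt d]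
    refine sum_le_sum fun x hx => ?_
    obtain ⟨hx1, -⟩ := Nat.mem_divisorsAntidiagonal.1 hx
    have hx2 : x.1 ≠ 0 ∧ x.2 ≠ 0 := by
      constructor <;> (intro h0; simp [h0] at hx1; omega)
    rw [hh _ hx2.1]
    by_cases hp : IsPrimePow x.2
    · obtain ⟨p, k, hp, hk, hpk⟩ := hp
      have h1 := radProd_mul_le c hx2.1 hx2.2
      rw [hx1, ← hpk, radProd_prime_pow c hp.nat_prime hk.ne'] at h1
      have h2 : (radProd c t : ℝ) ≤ M * radProd c x.1 := by
        have h3 := Nat.mul_le_mul_left (radProd c x.1) (hc p hp.nat_prime)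
        rw [mul_comm (M : ℝ)]
        exact_mod_cast h1.trans h3
      rw [← mul_assoc]
      exact mul_le_mul_of_nonneg_right h2 ArithmeticFunction.vonMangoldt_nonneg
    · rw [ArithmeticFunction.vonMangoldt_eq_zero_iff.2 hp]
      simp
  have hψ : ∀ t ∈ Ioc 0 T, h t * ∑ m ∈ Ioc 0 (T / t), ArithmeticFunction.vonMangoldt m ≤
      (Real.log 4 + 4) * T * (radProd c t / t) := fun t ht => by
    have ht0 : t ≠ 0 := by have := mem_Ioc.1 ht; omega
    have h1 := Chebyshev.psi_le_const_mul_self (show (0 : ℝ) ≤ T / t by positivity)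
    rw [Chebyshev.psi, Nat.floor_div_natCast, Nat.floor_natCast] at h1
    rw [hh _ ht0]
    calc _ ≤ (radProd c t : ℝ) * ((Real.log 4 + 4) * (T / t)) := by gcongr
      _ = _ := by ring
  rw [sum_mul]
  refine (sum_le_sum hpt).trans ?_
  rw [sum_add_distrib, ← mul_sum]
  have h1 := sum_le_sum hlog
  rw [← mul_sum, ArithmeticFunction.sum_Ioc_mul_eq_sum_sum] at h1
  have h2 := mul_le_mul_of_nonneg_left (sum_le_sum hψ) (Nat.cast_nonneg (α := ℝ) M)
  rw [← mul_sum] at h2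
  linarith

theorem exists_sum_radProd_le {c : ℕ → ℕ} {M : ℕ} (hc : ∀ p, p.Prime → c p ≤ M) {K : ℝ}
    (hK : ∀ Y : ℕ, 2 ≤ Y → ∑ p ∈ Y.primesLE, ((c p : ℝ) - 1) / p ≤ K) :
    ∃ C : ℝ, 0 ≤ C ∧ ∀ T : ℕ, ∑ t ∈ Ioc 0 T, (radProd c t : ℝ) ≤ C * T := by
  obtain ⟨C₁, h₁⟩ := exists_sum_inv_primesLE_le
  set Z := ∑' k : ℕ, ((k : ℝ) + 3) * (1 / 2 : ℝ) ^ k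
  have hZ : 0 ≤ Z := tsum_nonneg fun k => by positivity
  set S := ∑' n : ℕ, (1 : ℝ) / (n : ℝ) ^ 2
  set E := Real.exp (K + C₁ + (M + 1) * Z * S)
  have hl4 : 0 ≤ Real.log 4 + 4 := by have := Real.log_nonneg (show (1 : ℝ) ≤ 4 by norm_num); linarith
  refine ⟨((Real.log 4 + 4) * M + 1) * E + 1, by positivity, fun T => ?_⟩
  have hE : 0 < E := Real.exp_pos _
  rcases Nat.lt_or_ge T 2 with hT | hT
  · have h0 : 0 ≤ ((Real.log 4 + 4) * M + 1) * E := by positivity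
    interval_cases T
    · simp
    · have : Ioc 0 1 = {1} := by rfl
      rw [this, sum_singleton, radProd_one]
      push_cast
      linarith
  have hlT : 0 < Real.log T := Real.log_pos (by exact_mod_cast hT)
  set φ : ℕ → ℝ := fun n => radProd c n / n with hφ
  have hloc : ∀ p : ℕ, p.Prime → (Summable fun k => φ (p ^ k)) ∧
      ∑' k, φ (p ^ k) ≤ 1 + (c p : ℝ) / p + (M + 1) * (1 / (p : ℝ)) ^ 2 * Z := fun p hp => by
    have hp2 : (2 : ℝ) ≤ p := by exact_mod_cast hp.two_le
    have h1 := tsum_le_of_geometric (f := fun k => φ (p ^ k)) (x := 1 / (p : ℝ)) (r := 1 / 2)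
      (D := M + 1) (by positivity) (by gcongr) (by norm_num) (by positivity)
      (fun k => by positivity) fun k => by
        have hcM : (c p : ℝ) ≤ M := by exact_mod_cast hc p hp
        rcases eq_or_ne k 0 with rfl | hk
        · simp [hφ, radProd_one]
        · simp only [hφ]
          rw [radProd_prime_pow c hp hk, one_div, inv_pow, Nat.cast_pow, div_eq_mul_inv]
          gcongr
          have : (0 : ℝ) ≤ M := Nat.cast_nonneg M
          have : (0 : ℝ) ≤ k := Nat.cast_nonneg k
          nlinarith
    simpa [hφ, radProd_one, hp.ne_zero, radProd_prime_pow c hp one_ne_zero, ← one_div,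
      show radProd c p = c p by simpa using radProd_prime_pow c hp one_ne_zero] using h1
  have h2 := sum_smooth_le_prod_tsum (φ := φ) (fun n => by positivity) (by simp [hφ, radProd_one])
    (fun {m n} h => by simp only [hφ]; rw [radProd_mul c h]; push_cast; exact mul_div_mul_comm _ _ _ _)
    (fun hp => (hloc _ hp).1) T (Ioc 0 T) fun a ha p _ hpa => by
      rw [mem_Ioc] at ha
      exact (Nat.le_of_dvd ha.1 hpa).trans ha.2
  have h3 : ∏ p ∈ T.primesLE, ∑' k, φ (p ^ k) ≤ E * Real.log T := by
    calc ∏ p ∈ T.primesLE, ∑' k, φ (p ^ k)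
        ≤ ∏ p ∈ T.primesLE, Real.exp (((c p : ℝ) - 1) / p + 1 / p +
            (M + 1) * Z * (1 / (p : ℝ) ^ 2)) := by
          refine prod_le_prod (fun p _ => tsum_nonneg fun k => by positivity) fun p hp => ?_
          refine ((hloc p (Nat.mem_primesLE.1 hp).2).2).trans ?_
          refine le_trans (le_of_eq ?_) (Real.add_one_le_exp _)
          rw [one_div_pow]
          ring
      _ = Real.exp (∑ p ∈ T.primesLE, ((c p : ℝ) - 1) / p + ∑ p ∈ T.primesLE, (1 : ℝ) / p +
            (M + 1) * Z * ∑ p ∈ T.primesLE, 1 / (p : ℝ) ^ 2) := by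
          rw [← Real.exp_sum, sum_add_distrib, sum_add_distrib, mul_sum]
      _ ≤ Real.exp (K + (Real.log (Real.log T) + C₁) + (M + 1) * Z * S) := by
          have := sum_inv_sq_le T.primesLE
          have h4 := hK T hT
          have h5 := h₁ T hT
          gcongr
      _ = E * Real.log T := by
          rw [show K + (Real.log (Real.log T) + C₁) + (M + 1) * Z * S =
            K + C₁ + (M + 1) * Z * S + Real.log (Real.log T) by ring, Real.exp_add,
            Real.exp_log hlT]
  have h4 := sum_radProd_mul_log_le hc T
  have h5 : (∑ t ∈ Ioc 0 T, (radProd c t : ℝ)) * Real.log T ≤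
      (((Real.log 4 + 4) * M + 1) * E * T) * Real.log T := by
    refine h4.trans ?_
    calc _ ≤ ((Real.log 4 + 4) * M + 1) * T * (E * Real.log T) := by
          gcongr
          exact h2.trans h3
      _ = _ := by ring
  have h6 := le_of_mul_le_mul_right h5 hlT
  have : (0 : ℝ) ≤ T := Nat.cast_nonneg T
  linarith

end MultiplicativeMean

section Assembly

open Finset Polynomial

theorem exists_abs_apply_le_seminorm {n : ℕ} (nrm : Seminorm ℝ (Fin n → ℝ))
    (hnrm : ∀ x, nrm x = 0 → x = 0) : ∃ K : ℝ, 1 ≤ K ∧ ∀ x i, |x i| ≤ K * nrm x := by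
  have hcont : Continuous nrm := by
    simpa [continuousOn_univ] using nrm.convexOn.continuousOn isOpen_univ
  rcases (Metric.sphere (0 : Fin n → ℝ) 1).eq_empty_or_nonempty with h0 | hne
  · refine ⟨1, le_rfl, fun x i => ?_⟩
    rcases eq_or_ne x 0 with rfl | hx
    · simp
    have h1 : ‖x‖⁻¹ • x ∈ Metric.sphere (0 : Fin n → ℝ) 1 := by simp [norm_smul, hx]
    simp [h0] at h1
  obtain ⟨x₀, hx₀, hmin⟩ := (isCompact_sphere (0 : Fin n → ℝ) 1).exists_isMinOn hne
    hcont.continuousOn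
  have hpos : 0 < nrm x₀ := (apply_nonneg nrm x₀).lt_of_ne fun h => by
    simp [hnrm x₀ h.symm] at hx₀
  refine ⟨max 1 (nrm x₀)⁻¹, le_max_left _ _, fun x i => ?_⟩
  rcases eq_or_ne x 0 with rfl | hx
  · simp
  have hx' : 0 < ‖x‖ := norm_pos_iff.2 hx
  have h1 : nrm x₀ ≤ nrm (‖x‖⁻¹ • x) := hmin (by simp [norm_smul, hx])
  rw [map_smul_eq_mul, norm_inv, norm_norm, inv_mul_eq_div, le_div_iff₀ hx'] at h1
  calc |x i| ≤ ‖x‖ := norm_le_pi_norm x i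
    _ ≤ (nrm x₀)⁻¹ * nrm x := by rwa [inv_mul_eq_div, le_div_iff₀ hpos, mul_comm]
    _ ≤ _ := by
      gcongr
      exact le_max_right _ _

theorem pow_mul_eval_div_eq_binQuartic {f : ℤ[X]} (hdeg : f.natDegree ≤ 4) (u : ℤ) {v : ℤ}
    (hv : v ≠ 0) : (v : ℚ) ^ 4 * (f.map (Int.castRingHom ℚ)).eval ((u : ℚ) / v) =
      binQuartic f u v := by
  have hv' : (v : ℚ) ≠ 0 := by exact_mod_cast hv
  rw [eval_eq_sum_range' (n := 5) (natDegree_map_le.trans_lt (by omega)), binQuartic, mul_sum]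
  push_cast
  refine sum_congr rfl fun i hi => ?_
  have : (v : ℚ) ^ 4 = (v : ℚ) ^ i * (v : ℚ) ^ (4 - i) := by
    rw [← pow_add]; congr 1; have := mem_range.1 hi; omega
  rw [this, div_pow, coeff_map]
  simp only [eq_intCast]
  field_simp

theorem finite_binQuartic_eq_zero {f : ℤ[X]} (hdeg : f.natDegree ≤ 4) (hf : f ≠ 0) :
    {ω : ℤ × ℤ | Int.gcd ω.1 ω.2 = 1 ∧ binQuartic f ω.1 ω.2 = 0}.Finite := by
  classical
  have hf' : f.map (Int.castRingHom ℚ) ≠ 0 :=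
    (Polynomial.map_ne_zero_iff (RingHom.injective_int _)).2 hf
  let Z : Finset ℚ := (f.map (Int.castRingHom ℚ)).roots.toFinset
  refine Set.Finite.subset (({(1, 0), (-1, 0)} ∪ Z.image (fun q => (q.num, (q.den : ℤ))) ∪
    Z.image (fun q => (-q.num, -(q.den : ℤ))) : Finset (ℤ × ℤ)).finite_toSet) ?_
  have key : ∀ u v : ℤ, 0 < v → Int.gcd u v = 1 → binQuartic f u v = 0 →
      ∃ q ∈ Z, q.num = u ∧ (q.den : ℤ) = v := fun u v hv h h0 => by
    have h1 := pow_mul_eval_div_eq_binQuartic hdeg u hv.ne'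
    rw [h0, Int.cast_zero, mul_eq_zero, or_iff_right (by positivity)] at h1
    exact ⟨u / v, by simpa [Z, hf'] using h1, Rat.num_div_eq_of_coprime hv h,
      Rat.den_div_eq_of_coprime hv h⟩
  rintro ⟨u, v⟩ ⟨h1, h2⟩
  simp only [coe_union, coe_insert, coe_singleton, coe_image, Set.mem_union, Set.mem_insert_iff,
    Set.mem_singleton_iff, Set.mem_image, mem_coe, Prod.mk.injEq]
  dsimp only at h1 h2
  rcases lt_trichotomy v 0 with hv | rfl | hv
  · obtain ⟨q, hq, h3, h4⟩ := key (-u) (-v) (by omega) (by simpa using h1) (by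
      rw [← h2, binQuartic, binQuartic]
      refine sum_congr rfl fun i hi => ?_
      have := mem_range.1 hi
      interval_cases i <;> ring)
    exact Or.inr ⟨q, hq, by omega, by omega⟩
  · have : u.natAbs = 1 := by simpa using h1
    exact Or.inl (Or.inl (by omega))
  · obtain ⟨q, hq, h3, h4⟩ := key u v hv h1 h2
    exact Or.inl (Or.inr ⟨q, hq, h3, h4⟩)

theorem sum_coprimeBox_div_sq_le {f : ℤ[X]} {R : ℤ × ℤ → ℝ} (hR : ∀ ω, 0 ≤ R ω) {C : ℝ} (hC : 0 ≤ C)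
    {m : ℕ} (h : ∀ X : ℕ, 2 ≤ X → ∑ ω ∈ coprimeBox f X, R ω ≤ C * ((X : ℝ) ^ 2 * Real.log X ^ m))
    {Y : ℕ} (hY : 2 ≤ Y) :
    ∑ ω ∈ coprimeBox f Y, R ω / (max ω.1.natAbs ω.2.natAbs : ℕ) ^ 2 ≤
      C * 2 ^ (m + 4) * Real.log Y ^ (m + 1) := by
  classical
  have hmem : ∀ X : ℕ, ∀ ω : ℤ × ℤ, ω ∈ coprimeBox f X ↔ max ω.1.natAbs ω.2.natAbs ≤ X ∧
      Int.gcd ω.1 ω.2 = 1 ∧ binQuartic f ω.1 ω.2 ≠ 0 := fun X ω => by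
    rw [coprimeBox, @mem_filter _ _ (_) _ _, mem_product, mem_Icc, mem_Icc]
    refine and_congr_left fun _ => ?_
    omega
  have hY0 : (2 : ℝ) ≤ Y := by exact_mod_cast hY
  have hl : Real.log 2 ≤ Real.log Y := Real.log_le_log (by norm_num) hY0
  have hl2 := Real.log_two_gt_d9
  have hblock : ∀ i ∈ range (Nat.log 2 Y + 1),
      ∑ ω ∈ coprimeBox f Y with Nat.log 2 (max ω.1.natAbs ω.2.natAbs) = i,
        R ω / (max ω.1.natAbs ω.2.natAbs : ℕ) ^ 2 ≤ C * 2 ^ (m + 2) * Real.log Y ^ m := by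
    intro i hi
    have hiY : 2 ^ i ≤ Y := Nat.pow_le_of_le_log (by omega) (by have := mem_range.1 hi; omega)
    calc _ ≤ ∑ ω ∈ coprimeBox f Y with Nat.log 2 (max ω.1.natAbs ω.2.natAbs) = i,
          R ω / ((2 : ℝ) ^ i) ^ 2 := by
          refine sum_le_sum fun ω hω => ?_
          obtain ⟨h1, h2⟩ := mem_filter.1 hω
          have h3 : max ω.1.natAbs ω.2.natAbs ≠ 0 := fun h0 => by
            have h4 := ((hmem _ _).1 h1).2.1
            have h5 : ω.1 = 0 := by omega
            have h6 : ω.2 = 0 := by omega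
            simp [h5, h6] at h4
          have h4 : (2 : ℝ) ^ i ≤ (max ω.1.natAbs ω.2.natAbs : ℕ) := by
            exact_mod_cast h2 ▸ Nat.pow_log_le_self 2 h3
          have := hR ω
          gcongr
      _ ≤ ∑ ω ∈ coprimeBox f (2 ^ (i + 1)), R ω / ((2 : ℝ) ^ i) ^ 2 := by
          refine sum_le_sum_of_subset_of_nonneg (fun ω hω => ?_) fun ω _ _ => by
            have := hR ω
            positivity
          obtain ⟨h1, h2⟩ := mem_filter.1 hω
          exact (hmem _ _).2 ⟨(h2 ▸ Nat.lt_pow_succ_log_self one_lt_two _).le, ((hmem _ _).1 h1).2⟩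
      _ ≤ C * (((2 ^ (i + 1) : ℕ) : ℝ) ^ 2 * Real.log (2 ^ (i + 1) : ℕ) ^ m) / ((2 : ℝ) ^ i) ^ 2 := by
          rw [← sum_div]
          gcongr
          exact h _ (by rw [pow_succ]; have := Nat.one_le_two_pow (n := i); omega)
      _ = C * 4 * Real.log (2 ^ (i + 1) : ℕ) ^ m := by
          push_cast
          field_simp
          ring
      _ ≤ C * 4 * (2 * Real.log Y) ^ m := by
          have h1 : ((2 ^ (i + 1) : ℕ) : ℝ) ≤ (Y : ℝ) ^ 2 := by
            have : 2 ^ (i + 1) ≤ Y ^ 2 := by rw [pow_succ, sq]; exact Nat.mul_le_mul hiY hY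
            exact_mod_cast this
          have h2 : Real.log (2 ^ (i + 1) : ℕ) ≤ 2 * Real.log Y := by
            have := Real.log_le_log (by positivity) h1
            rwa [Real.log_pow] at this
          have h3 : 0 ≤ Real.log (2 ^ (i + 1) : ℕ) := Real.log_natCast_nonneg _
          gcongr
      _ = _ := by rw [mul_pow]; ring
  have hcount : ((Nat.log 2 Y + 1 : ℕ) : ℝ) ≤ 4 * Real.log Y := by
    have h1 : ((2 ^ Nat.log 2 Y : ℕ) : ℝ) ≤ Y := by exact_mod_cast Nat.pow_log_le_self 2 (by omega)
    have h2 := Real.log_le_log (by positivity) h1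
    push_cast at h2 ⊢
    rw [Real.log_pow] at h2
    nlinarith [(Nat.log 2 Y).cast_nonneg (α := ℝ)]
  rw [← sum_fiberwise_of_maps_to (t := range (Nat.log 2 Y + 1))
    (g := fun ω : ℤ × ℤ => Nat.log 2 (max ω.1.natAbs ω.2.natAbs)) fun ω hω =>
      mem_range.2 (Nat.lt_succ_of_le (Nat.log_mono_right ((hmem _ _).1 hω).1))]
  refine (sum_le_sum hblock).trans ?_
  rw [sum_const, card_range, nsmul_eq_mul]
  calc _ ≤ 4 * Real.log Y * (C * 2 ^ (m + 2) * Real.log Y ^ m) := by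
        have : 0 ≤ Real.log Y := by linarith
        gcongr
    _ = _ := by ring

end Assembly

section Count

open Finset Polynomial

theorem ne_zero_of_primitive {a : ℤ} (ha : a < 0) {y z t N : ℤ} (h1 : Int.gcd y (Int.gcd z t) = 1)
    (h2 : y ^ 2 - a * z ^ 2 = t ^ 2 * N) : t ≠ 0 := by
  rintro rfl
  have hy : y = 0 := by nlinarith [sq_nonneg y, sq_nonneg z]
  have hz : z = 0 := by
    have : a * z ^ 2 = 0 := by rw [hy] at h2; linarith
    simpa [ha.ne] using this
  simp [hy, hz] at h1

theorem card_rep_bounded_le {a : ℤ} (ha : a < 0) {c : ℕ → ℕ} {p₀ M : ℕ} (hM : 1 ≤ M)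
    (hc : ∀ p, p.Prime → c p ≤ 2)
    (hη : ∀ p k : ℕ, p.Prime → k ≠ 0 → sqCount a (p ^ k) ≤ if p ≤ p₀ then M else c p)
    {C : ℝ}
    (hC : ∀ T : ℕ, ∑ t ∈ Ioc 0 T, (radProd (fun p => if p ≤ p₀ then M else c p) t : ℝ) ≤ C * T)
    {N : ℤ} (hN : N ≠ 0) {T : ℕ} (S : Finset (ℤ × ℤ × ℤ))
    (hS : ∀ q ∈ S, Int.gcd q.1 (Int.gcd q.2.1 q.2.2) = 1 ∧
      q.1 ^ 2 - a * q.2.1 ^ 2 = q.2.2 ^ 2 * N ∧ q.2.2.natAbs ≤ T) :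
    (#S : ℝ) ≤ 18 * C * T * primeProd (locWeight p₀ M fun p => c p) N.natAbs := by
  classical
  have hP := primeProd_nonneg (locWeight_nonneg (p₀ := p₀) (Nat.cast_nonneg (α := ℝ) M)
    fun p => Nat.cast_nonneg (c p)) N.natAbs
  rcases S.eq_empty_or_nonempty with rfl | ⟨q₀, hq₀⟩
  · have := (sum_nonneg fun t _ => Nat.cast_nonneg _).trans (hC T)
    simp only [card_empty, Nat.cast_zero]
    nlinarith [mul_nonneg this hP]
  have hNpos : (N.natAbs : ℤ) = N := by
    obtain ⟨h1, h2, -⟩ := hS q₀ hq₀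
    have h3 : 0 < q₀.2.2 ^ 2 := sq_pos_of_ne_zero (ne_zero_of_primitive ha h1 h2)
    have h4 : 0 ≤ q₀.2.2 ^ 2 * N := by nlinarith [sq_nonneg q₀.1, sq_nonneg q₀.2.1]
    have h5 : 0 ≤ N := nonneg_of_mul_nonneg_right h4 h3
    omega
  have hfix : ∀ t : ℤ, t ≠ 0 → (#{q ∈ S | q.2.2 = t} : ℝ) ≤
      9 * radProd (fun p => if p ≤ p₀ then M else c p) t.natAbs *
        primeProd (locWeight p₀ M fun p => c p) N.natAbs := fun t ht => by
    have hinj : Set.InjOn (fun q : ℤ × ℤ × ℤ => (q.1, q.2.1)) ({q ∈ S | q.2.2 = t} : Finset _) := by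
      rintro ⟨y, z, s⟩ h ⟨y', z', s'⟩ h' heq
      have h1 := (mem_filter.1 h).2
      have h2 := (mem_filter.1 h').2
      simp only [Prod.mk.injEq] at heq h1 h2 ⊢
      exact ⟨heq.1, heq.2, h1.trans h2.symm⟩
    rw [← card_image_of_injOn hinj]
    refine card_rep_le ha hM hc hη ht (Int.natAbs_ne_zero.2 hN) _ fun q hq => ?_
    obtain ⟨q', hq', rfl⟩ := mem_image.1 hq
    obtain ⟨h1, rfl⟩ := mem_filter.1 hq'
    rw [hNpos]
    exact ⟨(hS q' h1).1, (hS q' h1).2.1⟩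
  rw [card_eq_sum_card_fiberwise (f := fun q : ℤ × ℤ × ℤ => q.2.2.natAbs) (t := Ioc 0 T)
    fun q hq => by
      obtain ⟨h1, h2, h3⟩ := hS q hq
      exact mem_coe.2 (mem_Ioc.2 ⟨Int.natAbs_pos.2 (ne_zero_of_primitive ha h1 h2), h3⟩)]
  push_cast
  calc _ ≤ ∑ t ∈ Ioc 0 T, 18 * (radProd (fun p => if p ≤ p₀ then M else c p) t : ℝ) *
        primeProd (locWeight p₀ M fun p => c p) N.natAbs := by
        refine sum_le_sum fun t ht => ?_
        have ht0 : (t : ℤ) ≠ 0 := by have := mem_Ioc.1 ht; omega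
        have h1 : #{q ∈ S | q.2.2.natAbs = t} ≤
            #{q ∈ S | q.2.2 = (t : ℤ)} + #{q ∈ S | q.2.2 = -(t : ℤ)} := by
          refine (card_le_card fun q hq => ?_).trans (card_union_le _ _)
          obtain ⟨h2, h3⟩ := mem_filter.1 hq
          simp only [mem_union, mem_filter, h2, true_and]
          omega
        have h2 : (#{q ∈ S | q.2.2.natAbs = t} : ℝ) ≤
            #{q ∈ S | q.2.2 = (t : ℤ)} + #{q ∈ S | q.2.2 = -(t : ℤ)} := by exact_mod_cast h1
        have h3 := hfix t ht0
        have h4 := hfix (-t) (neg_ne_zero.2 ht0)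
        rw [Int.natAbs_neg] at h4
        rw [Int.natAbs_natCast] at h3 h4
        linarith
    _ = 18 * (∑ t ∈ Ioc 0 T, (radProd (fun p => if p ≤ p₀ then M else c p) t : ℝ)) *
        primeProd (locWeight p₀ M fun p => c p) N.natAbs := by rw [mul_sum, sum_mul]
    _ ≤ 18 * (C * T) * primeProd (locWeight p₀ M fun p => c p) N.natAbs := by
        gcongr
        exact hC T
    _ = _ := by ring

/-- The weight bounding the number of representations of a value of the form, together with the
bounds it satisfies on average. -/
theorem exists_rep_weight {a : ℤ} (ha : ¬ IsSquare a) (haneg : a < 0) {f : ℤ[X]}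
    (hdeg : f.natDegree = 3 ∨ f.natDegree = 4)
    (hf : Squarefree (f.map (Int.castRingHom ℚ))) {c : ℚ} {r : ℕ} {g : Fin r → ℚ[X]}
    (hirr : ∀ i, Irreducible (g i)) (hfac : f.map (Int.castRingHom ℚ) = C c * ∏ i, g i) :
    ∃ R : ℤ → ℝ, (∀ N, 0 ≤ R N) ∧
      (∀ N : ℤ, N ≠ 0 → ∀ T : ℕ, ∀ S : Finset (ℤ × ℤ × ℤ),
        (∀ q ∈ S, Int.gcd q.1 (Int.gcd q.2.1 q.2.2) = 1 ∧
          q.1 ^ 2 - a * q.2.1 ^ 2 = q.2.2 ^ 2 * N ∧ q.2.2.natAbs ≤ T) → (#S : ℝ) ≤ T * R N) ∧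
      ∃ D : ℝ, 0 ≤ D ∧ ∀ Y : ℕ, 2 ≤ Y →
        ∑ ω ∈ coprimeBox f Y, R (binQuartic f ω.1 ω.2) / (max ω.1.natAbs ω.2.natAbs : ℕ) ^ 2 ≤
          D * Real.log Y ^ (Nat.card {i : Fin r // IsSquare (a : AdjoinRoot (g i))} + 1) := by
  obtain ⟨q₀, M, hM, hM1, hM2⟩ := exists_sqCount_pow_le haneg.ne
  obtain ⟨p₀, hp₀, C₁, hC₁, h₁⟩ :=
    exists_sum_primeProd_binQuartic_le ha hdeg hf hirr hfac (Nat.cast_nonneg (α := ℝ) M) q₀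
  obtain ⟨K₁, hK₁⟩ := exists_sum_sqCount_div_le ha
  obtain ⟨K₂, hK₂⟩ := exists_sum_primesLE_le (Nat.factorial_ne_zero p₀)
    (b := fun p => (((if p ≤ p₀ then M else sqCount a p : ℕ) : ℝ) - 1) / p)
    (b' := fun p => ((sqCount a p : ℝ) - 1) / p) fun p hp h => by
      rw [if_neg fun h1 => h ((hp.dvd_factorial).2 h1)]
  obtain ⟨C₂, hC₂, h₂⟩ := exists_sum_radProd_le
    (c := fun p => if p ≤ p₀ then M else sqCount a p) (M := max M 2) (K := K₁ + K₂)
    (fun p hp => by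
      split_ifs
      · exact le_max_left _ _
      · exact (sqCount_le_two a hp).trans (le_max_right _ _))
    fun Y hY => (hK₂ Y).trans (by linarith [hK₁ Y hY])
  have hP := primeProd_nonneg (locWeight_nonneg (p₀ := p₀) (Nat.cast_nonneg (α := ℝ) M)
    fun p => Nat.cast_nonneg (sqCount a p))
  refine ⟨fun N => 18 * C₂ * primeProd (locWeight p₀ M fun p => sqCount a p) N.natAbs,
    fun N => mul_nonneg (by positivity) (hP _), fun N hN T S hS => ?_,
    18 * C₂ * C₁ * 2 ^ (Nat.card {i : Fin r // IsSquare (a : AdjoinRoot (g i))} + 4),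
    by positivity, fun Y hY => ?_⟩
  · refine (card_rep_bounded_le haneg hM (fun p hp => sqCount_le_two a hp) (fun p k hp hk => ?_)
      h₂ hN S hS).trans_eq (by ring)
    split_ifs with h
    · exact hM1 p k hp
    · exact hM2 p k hp (by omega) hk
  · refine sum_coprimeBox_div_sq_le (C := 18 * C₂ * C₁)
      (R := fun ω => 18 * C₂ * primeProd (locWeight p₀ M fun p => sqCount a p)
        (binQuartic f ω.1 ω.2).natAbs) (fun ω => mul_nonneg (by positivity) (hP _))
      (by positivity) (fun X hX => ?_) hY
    rw [← mul_sum, mul_assoc (18 * C₂)]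
    gcongr
    exact h₁ X hX

end Count

section Final

open Finset Polynomial

/-- Integral points of bounded height satisfying the equation are finite in number and their
coordinates are controlled. -/
theorem coord_bounds {a : ℤ} (ha : a < 0) {nrm : Seminorm ℝ (Fin 5 → ℝ)} {K : ℝ} (hK0 : 1 ≤ K)
    (hK : ∀ x i, |x i| ≤ K * nrm x) {B : ℝ} {y z t u v N : ℤ}
    (h1 : Int.gcd y (Int.gcd z t) = 1)
    (h2 : nrm ![((v ^ 2 * t : ℤ) : ℝ), ((u * v * t : ℤ) : ℝ), ((u ^ 2 * t : ℤ) : ℝ), (y : ℝ),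
      (z : ℝ)] ≤ B)
    (h3 : y ^ 2 - a * z ^ 2 = t ^ 2 * N) :
    t ≠ 0 ∧ y.natAbs ≤ ⌊K * B⌋₊ ∧ z.natAbs ≤ ⌊K * B⌋₊ ∧
      t.natAbs * max u.natAbs v.natAbs ^ 2 ≤ ⌊K * B⌋₊ := by
  have key : ∀ (n : ℤ) (i : Fin 5), ![((v ^ 2 * t : ℤ) : ℝ), ((u * v * t : ℤ) : ℝ),
      ((u ^ 2 * t : ℤ) : ℝ), (y : ℝ), (z : ℝ)] i = n → n.natAbs ≤ ⌊K * B⌋₊ := fun n i hn => by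
    refine Nat.le_floor ?_
    rw [Nat.cast_natAbs, Int.cast_abs, ← hn]
    exact (hK _ i).trans (by gcongr)
  refine ⟨ne_zero_of_primitive ha h1 h3, key y 3 rfl, key z 4 rfl, ?_⟩
  have hv := key _ 0 rfl
  have hu := key _ 2 rfl
  rw [Int.natAbs_mul, Int.natAbs_pow, mul_comm] at hu hv
  rcases max_choice u.natAbs v.natAbs with h | h <;> rwa [h]

/-- Linear growth for Châtelet surfaces (main theorem, with `a < 0`), expressed via the
counting function of Lemma 2: for any norm on `ℝ⁵`, the number of pairs of primitive vectors
`(y,z,t) ∈ ℤ³`, `(u,v) ∈ ℤ²` with `‖(v²t, uvt, u²t, y, z)‖ ≤ B` and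
`y² - a z² = t² F(u,v)` is `O(B (log B)^(ρ-1))`. -/
theorem chatelet_linear_growth
    (a : ℤ) (ha : ¬ IsSquare a) (haneg : a < 0)
    (f : Polynomial ℤ) (hdeg : f.natDegree = 3 ∨ f.natDegree = 4)
    (hsf : Squarefree (f.map (Int.castRingHom ℚ)))
    (c : ℚ) (r : ℕ) (fi : Fin r → Polynomial ℚ)
    (hmonic : ∀ i, (fi i).Monic) (hirr : ∀ i, Irreducible (fi i))
    (hfac : f.map (Int.castRingHom ℚ) = Polynomial.C c * ∏ i, fi i)
    (ρ : ℕ) (hρ : ρ = 2 + Nat.card {i : Fin r // IsSquare ((a : AdjoinRoot (fi i)))})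
    (nrm : Seminorm ℝ (Fin 5 → ℝ)) (hnrm : ∀ x, nrm x = 0 → x = 0) :
    ∃ C : ℝ, 0 < C ∧ ∀ B : ℝ, 2 ≤ B →
      ({q : (ℤ × ℤ × ℤ) × ℤ × ℤ |
          Int.gcd q.1.1 (Int.gcd q.1.2.1 q.1.2.2) = 1 ∧
          Int.gcd q.2.1 q.2.2 = 1 ∧
          nrm ![((q.2.2 ^ 2 * q.1.2.2 : ℤ) : ℝ), ((q.2.1 * q.2.2 * q.1.2.2 : ℤ) : ℝ),
                ((q.2.1 ^ 2 * q.1.2.2 : ℤ) : ℝ), ((q.1.1 : ℤ) : ℝ), ((q.1.2.1 : ℤ) : ℝ)] ≤ B ∧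
          q.1.1 ^ 2 - a * q.1.2.1 ^ 2 = q.1.2.2 ^ 2 * binQuartic f q.2.1 q.2.2}.ncard : ℝ)
        ≤ C * B * Real.log B ^ (ρ - 1) := by
  classical
  obtain ⟨K, hK1, hK⟩ := exists_abs_apply_le_seminorm nrm hnrm
  obtain ⟨R, hR0, hR, D, hD0, hD⟩ := exists_rep_weight ha haneg hdeg hsf hirr hfac
  obtain ⟨m, hm⟩ : ∃ m, m = Nat.card {i : Fin r // IsSquare ((a : AdjoinRoot (fi i)))} := ⟨_, rfl⟩
  rw [← hm] at hρ hD
  rw [show ρ - 1 = m + 1 by omega]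
  have hf0 : f ≠ 0 := by rintro rfl; simp at hdeg
  obtain ⟨Z, hZ⟩ := (finite_binQuartic_eq_zero (f := f) (by omega) hf0).exists_finset
  obtain ⟨E, hE⟩ : ∃ E, E = Real.log (K + 1) / Real.log 2 + 1 := ⟨_, rfl⟩
  have hl2 : 0 < Real.log 2 := Real.log_pos (by norm_num)
  have hE0 : 0 ≤ E := by
    have := Real.log_nonneg (show 1 ≤ K + 1 by linarith)
    rw [hE]; positivity
  refine ⟨(2 * #Z) / Real.log 2 ^ (m + 1) + K * (D * E ^ (m + 1)) + 1, by positivity,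
    fun B hB => ?_⟩
  have hlB : Real.log 2 ≤ Real.log B := Real.log_le_log (by norm_num) hB
  have hlB0 : 0 < Real.log B := hl2.trans_le hlB
  have hKB : 2 ≤ K * B := by nlinarith
  obtain ⟨n, hn⟩ : ∃ n, n = ⌊K * B⌋₊ := ⟨_, rfl⟩
  have hn2 : 2 ≤ n := hn ▸ Nat.le_floor (by exact_mod_cast hKB)
  have hnKB : (n : ℝ) ≤ K * B := hn ▸ Nat.floor_le (by linarith)
  have hlogn : Real.log n ≤ E * Real.log B := by
    have h1 : Real.log n ≤ Real.log ((K + 1) * B) :=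
      Real.log_le_log (by exact_mod_cast (by omega : 0 < n)) (by linarith)
    rw [Real.log_mul (by linarith) (by linarith)] at h1
    have h2 : Real.log (K + 1) ≤ Real.log (K + 1) / Real.log 2 * Real.log B := by
      rw [div_mul_eq_mul_div, le_div_iff₀ hl2]
      have := Real.log_nonneg (show 1 ≤ K + 1 by linarith)
      gcongr
    rw [hE]; linarith
  obtain ⟨A, hA⟩ : ∃ A : Set ((ℤ × ℤ × ℤ) × ℤ × ℤ), A = {q |
          Int.gcd q.1.1 (Int.gcd q.1.2.1 q.1.2.2) = 1 ∧
          Int.gcd q.2.1 q.2.2 = 1 ∧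
          nrm ![((q.2.2 ^ 2 * q.1.2.2 : ℤ) : ℝ), ((q.2.1 * q.2.2 * q.1.2.2 : ℤ) : ℝ),
                ((q.2.1 ^ 2 * q.1.2.2 : ℤ) : ℝ), ((q.1.1 : ℤ) : ℝ), ((q.1.2.1 : ℤ) : ℝ)] ≤ B ∧
          q.1.1 ^ 2 - a * q.1.2.1 ^ 2 = q.1.2.2 ^ 2 * binQuartic f q.2.1 q.2.2} := ⟨_, rfl⟩
  rw [← hA]
  have hb : ∀ q ∈ A, q.1.2.2 ≠ 0 ∧ q.1.1.natAbs ≤ n ∧ q.1.2.1.natAbs ≤ n ∧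
      q.1.2.2.natAbs * max q.2.1.natAbs q.2.2.natAbs ^ 2 ≤ n := fun q hq => by
    rw [hA] at hq
    rw [hn]
    exact coord_bounds haneg hK1 hK hq.1 hq.2.2.1 hq.2.2.2
  have hmax : ∀ q ∈ A, 0 < max q.2.1.natAbs q.2.2.natAbs := fun q hq => by
    rw [hA] at hq
    by_contra h0
    have h5 : q.2.1 = 0 := by omega
    have h6 : q.2.2 = 0 := by omega
    have := hq.2.1
    simp [h5, h6] at this
  have hb' : ∀ q ∈ A, q.1.2.2.natAbs ≤ n ∧ max q.2.1.natAbs q.2.2.natAbs ≤ n := fun q hq => by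
    obtain ⟨h1, -, -, h2⟩ := hb q hq
    have h3 := hmax q hq
    exact ⟨(Nat.le_mul_of_pos_right _ (by positivity)).trans h2,
      ((Nat.le_self_pow two_ne_zero _).trans
        (Nat.le_mul_of_pos_left _ (Int.natAbs_pos.2 h1))).trans h2⟩
  have hfin : A.Finite := by
    refine Set.Finite.subset (((Icc (-n : ℤ) n ×ˢ Icc (-n : ℤ) n ×ˢ Icc (-n : ℤ) n) ×ˢ
      Icc (-n : ℤ) n ×ˢ Icc (-n : ℤ) n).finite_toSet) fun q hq => ?_
    have h1 := hb q hq
    have h2 := hb' q hq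
    simp only [mem_coe, mem_product, mem_Icc]
    omega
  obtain ⟨S, hS⟩ := hfin.exists_finset
  have hcard : A.ncard = #S := by
    rw [← Set.ncard_coe_finset]
    congr 1
    ext q
    exact (hS q).symm
  rw [hcard, ← card_filter_add_card_filter_not (fun q => binQuartic f q.2.1 q.2.2 = 0)]
  have hS0 : #{q ∈ S | binQuartic f q.2.1 q.2.2 = 0} ≤ 2 * #Z := by
    have hsub : {q ∈ S | binQuartic f q.2.1 q.2.2 = 0} ⊆
        (({1, -1} : Finset ℤ) ×ˢ Z).image fun x => ((0, 0, x.1), x.2) := fun q hq => by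
      obtain ⟨h1, h2⟩ := mem_filter.1 hq
      have h3 := (hS q).1 h1
      rw [hA] at h3
      obtain ⟨h4, h5, -, h6⟩ := h3
      rw [h2, mul_zero] at h6
      have hy : q.1.1 = 0 := by nlinarith [sq_nonneg q.1.1, sq_nonneg q.1.2.1]
      have hz : q.1.2.1 = 0 := by
        have : a * q.1.2.1 ^ 2 = 0 := by rw [hy] at h6; linarith
        simpa [haneg.ne] using this
      rw [hy, hz] at h4
      have ht : q.1.2.2.natAbs = 1 := by simpa [Int.natAbs_abs] using h4
      refine mem_image.2 ⟨(q.1.2.2, q.2), mem_product.2 ⟨?_, (hZ _).2 ⟨h5, h2⟩⟩, ?_⟩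
      · simp only [mem_insert, mem_singleton]; omega
      · exact Prod.ext (Prod.ext hy.symm (Prod.ext hz.symm rfl)) rfl
    refine (card_le_card hsub).trans (card_image_le.trans ?_)
    rw [card_product]
    exact Nat.mul_le_mul_right _ card_le_two
  have hS1 : (#{q ∈ S | ¬ binQuartic f q.2.1 q.2.2 = 0} : ℝ) ≤
      K * B * (D * Real.log n ^ (m + 1)) := by
    rw [card_eq_sum_card_fiberwise (f := Prod.snd) (t := coprimeBox f n) fun q hq => ?_]
    · push_cast
      calc _ ≤ ∑ ω ∈ coprimeBox f n, (n : ℝ) * (R (binQuartic f ω.1 ω.2) /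
            (max ω.1.natAbs ω.2.natAbs : ℕ) ^ 2) := sum_le_sum fun ω hω => ?_
        _ ≤ (n : ℝ) * (D * Real.log n ^ (m + 1)) := by
            rw [← mul_sum]
            gcongr
            exact hD n hn2
        _ ≤ _ := by
            have := Real.log_natCast_nonneg n
            gcongr
      have hω0 := ((@mem_filter _ _ (_) _ _).1 hω).2.2
      rw [← card_image_of_injOn (f := Prod.fst) (fun x hx y hy h =>
        Prod.ext h ((mem_filter.1 hx).2.trans (mem_filter.1 hy).2.symm))]
      refine (hR _ hω0 (n / max ω.1.natAbs ω.2.natAbs ^ 2) _ fun q hq => ?_).trans ?_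
      · obtain ⟨⟨q', ω'⟩, h1, rfl⟩ := mem_image.1 hq
        obtain ⟨h2, rfl⟩ := mem_filter.1 h1
        have h3 := (hS _).1 (mem_filter.1 h2).1
        have h4 := (hb _ h3).2.2.2
        have h5 := hmax _ h3
        rw [hA] at h3
        exact ⟨h3.1, h3.2.2.2, (Nat.le_div_iff_mul_le (by positivity)).2 h4⟩
      · have h1 := @Nat.cast_div_le ℝ _ _ _ n (max ω.1.natAbs ω.2.natAbs ^ 2)
        calc _ ≤ (n : ℝ) / (max ω.1.natAbs ω.2.natAbs ^ 2 : ℕ) * R (binQuartic f ω.1 ω.2) := by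
              have := hR0 (binQuartic f ω.1 ω.2)
              gcongr
          _ = _ := by push_cast; ring
    · obtain ⟨h1, h2⟩ := mem_filter.1 (mem_coe.1 hq)
      have h3 := (hS q).1 h1
      have h4 := (hb' q h3).2
      rw [hA] at h3
      refine mem_coe.2 ((@mem_filter _ _ (_) _ _).2 ⟨?_, h3.2.1, h2⟩)
      rw [mem_product, mem_Icc, mem_Icc]
      omega
  push_cast
  have hS0' : (#{q ∈ S | binQuartic f q.2.1 q.2.2 = 0} : ℝ) ≤ 2 * #Z := by exact_mod_cast hS0
  have h1 : (2 * #Z : ℝ) ≤ 2 * #Z / Real.log 2 ^ (m + 1) * B * Real.log B ^ (m + 1) := by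
    have h2 : Real.log 2 ^ (m + 1) ≤ Real.log B ^ (m + 1) := by gcongr
    have h3 : (1 : ℝ) * Real.log 2 ^ (m + 1) ≤ B * Real.log B ^ (m + 1) := by
      gcongr
      linarith
    calc (2 * #Z : ℝ) = 2 * #Z / Real.log 2 ^ (m + 1) * (1 * Real.log 2 ^ (m + 1)) := by
          field_simp
      _ ≤ 2 * #Z / Real.log 2 ^ (m + 1) * (B * Real.log B ^ (m + 1)) := by gcongr
      _ = _ := by ring
  have h2 : K * B * (D * Real.log n ^ (m + 1)) ≤
      K * (D * E ^ (m + 1)) * B * Real.log B ^ (m + 1) := by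
    have := Real.log_natCast_nonneg n
    calc _ ≤ K * B * (D * (E * Real.log B) ^ (m + 1)) := by gcongr
      _ = _ := by rw [mul_pow]; ring
  have h3 : 0 ≤ B * Real.log B ^ (m + 1) := by positivity
  linarith

end Final
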